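/- Let $X$ be a smooth closed subvariety of $\mathbb{C}^n$. Then for a general point $\bm{\beta} = (\beta_0, \beta_1, \dots, \beta_n) \in \mathbb{C}^{n+1}$, one has $\mathrm{EDdeg}(X) = (-1)^{\dim X}\,\chi(X \cap U_{\bm\beta})$, where $U_{\bm\beta}$ is the complement in $\mathbb{C}^n$ of the hypersurface $\{\sum_{i=1}^n (z_i-\beta_i)^2 + \beta_0 = 0\}$ and $\chi$ denotes the topological Euler characteristic. -/

import Mathlib

open scoped Manifold Topology
open Filter

noncomputable section

namespace PaperED

/-! Affine algebraic geometry over ℂ: algebraic subsets of ℂⁿ, genericity,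
Zariski tangent spaces, smoothness, and the Euclidean distance degree. -/

/-- "P holds for a general point": P holds on a nonempty Zariski-open subset. -/
def Generically {K : Type} [CommSemiring K] {σ : Type} (P : (σ → K) → Prop) : Prop :=
  ∃ q : MvPolynomial σ K, q ≠ 0 ∧ ∀ a : σ → K, MvPolynomial.eval a q ≠ 0 → P a

/-- Affine algebraic subsets of ℂⁿ (common zero loci of polynomials). -/
def IsAlgSet {n : ℕ} (X : Set (Fin n → ℂ)) : Prop :=
  ∃ S : Set (MvPolynomial (Fin n) ℂ),
    X = {x | ∀ p ∈ S, MvPolynomial.eval x p = 0}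

/-- The differential of a polynomial at a point, as a linear functional. -/
def diffAt {n : ℕ} (p : MvPolynomial (Fin n) ℂ) (x : Fin n → ℂ) : (Fin n → ℂ) →ₗ[ℂ] ℂ :=
  ∑ i, MvPolynomial.eval x (MvPolynomial.pderiv i p) • LinearMap.proj i

/-- The Zariski tangent space of `X ⊆ ℂⁿ` at `x`. -/
def zTangent {n : ℕ} (X : Set (Fin n → ℂ)) (x : Fin n → ℂ) : Submodule ℂ (Fin n → ℂ) :=
  ⨅ p ∈ {p : MvPolynomial (Fin n) ℂ | ∀ y ∈ X, MvPolynomial.eval y p = 0},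
    LinearMap.ker (diffAt p x)

/-- `ψ` is a local holomorphic parametrization of `S` around `x`, with `d` parameters. -/
def IsParamAt {E : Type} [NormedAddCommGroup E] [NormedSpace ℂ E]
    (S : Set E) (x : E) (d : ℕ) (ψ : (Fin d → ℂ) → E) (U : Set (Fin d → ℂ)) : Prop :=
  IsOpen U ∧ (0 : Fin d → ℂ) ∈ U ∧ ψ 0 = x ∧ DifferentiableOn ℂ ψ U ∧
    Set.InjOn ψ U ∧ Function.Injective (fderiv ℂ ψ 0) ∧
    ∃ V ∈ 𝓝 x, ψ '' U = S ∩ V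

/-- `S` is, near `x`, a `d`-dimensional complex submanifold. -/
def IsSmoothGermAt {E : Type} [NormedAddCommGroup E] [NormedSpace ℂ E]
    (S : Set E) (x : E) (d : ℕ) : Prop :=
  ∃ ψ U, IsParamAt S x d ψ U

/-- `X` is a (nonempty) smooth closed subvariety of ℂⁿ of pure dimension `d`. -/
def IsSmoothClosedOfDim {n : ℕ} (X : Set (Fin n → ℂ)) (d : ℕ) : Prop :=
  IsAlgSet X ∧ X.Nonempty ∧
    ∀ x ∈ X, IsSmoothGermAt X x d ∧ Module.finrank ℂ ↥(zTangent X x) = d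

/-- Critical points of the squared distance function `f_α` on the locus of `X` where
the tangent space has dimension `d` (the smooth locus, when `dim X = d`):
the vector `x - α` is orthogonal to the tangent space w.r.t. `∑ zᵢwᵢ`. -/
def edCritSet {n : ℕ} (X : Set (Fin n → ℂ)) (d : ℕ) (α : Fin n → ℂ) : Set (Fin n → ℂ) :=
  {x | x ∈ X ∧ Module.finrank ℂ ↥(zTangent X x) = d ∧
    ∀ v ∈ zTangent X x, (∑ i, (x i - α i) * v i) = 0}

/-- The Euclidean distance degree of `X` (of dimension `d`) equals `k`: for a general
data point `α`, the squared distance function `f_α` has exactly `k` critical points on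
the smooth locus of `X`. -/
def HasEDDeg {n : ℕ} (X : Set (Fin n → ℂ)) (d : ℕ) (k : ℕ) : Prop :=
  Generically (K := ℂ) (σ := Fin n) fun α =>
    (edCritSet X d α).Finite ∧ (edCritSet X d α).ncard = k

/-- `U_β`: the complement in ℂⁿ of the hypersurface `∑ (zᵢ - βᵢ)² + β₀ = 0`. -/
def quadCompl {n : ℕ} (β : Fin (n + 1) → ℂ) : Set (Fin n → ℂ) :=
  {z | (∑ i : Fin n, (z i - β i.succ) ^ 2) + β 0 ≠ 0}

/-! Topological Euler characteristic, via homotopy equivalence with a space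
built from finitely many cells. -/

def cellSphere (d : ℕ) : Set (EuclideanSpace ℝ (Fin d)) := Metric.sphere 0 1
def cellBall (d : ℕ) : Set (EuclideanSpace ℝ (Fin d)) := Metric.closedBall 0 1

def attachRel {d : ℕ} {A : Type} [TopologicalSpace A] (φ : C(↥(cellSphere d), A)) :
    (A ⊕ ↥(cellBall d)) → (A ⊕ ↥(cellBall d)) → Prop := fun p q =>
  ∃ x : ↥(cellSphere d),
    p = Sum.inl (φ x) ∧ q = Sum.inr ⟨x.1, Metric.sphere_subset_closedBall x.2⟩

/-- The space obtained from `A` by attaching a `d`-cell along `φ`. -/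
def attachSp {d : ℕ} {A : Type} [TopologicalSpace A] (φ : C(↥(cellSphere d), A)) : Type :=
  Quot (attachRel φ)

instance {d : ℕ} {A : Type} [TopologicalSpace A] (φ : C(↥(cellSphere d), A)) :
    TopologicalSpace (attachSp φ) := inferInstanceAs (TopologicalSpace (Quot _))

/-- `B` is (homeomorphic to) the result of attaching one `d`-cell to `A`. -/
def AttachOneCell (A B : TopCat.{0}) (d : ℕ) : Prop :=
  ∃ φ : C(↥(cellSphere d), ↑A), Nonempty (↑B ≃ₜ attachSp φ)

/-- `Z` is obtained from `A` by attaching cells whose dimensions are listed in `L`. -/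
def AttachedCells : TopCat.{0} → TopCat.{0} → List ℕ → Prop
  | A, Z, [] => Nonempty (↑A ≃ₜ ↑Z)
  | A, Z, d :: L => ∃ B : TopCat.{0}, AttachOneCell A B d ∧ AttachedCells B Z L

/-- `X` has (topological) Euler characteristic `c`: `X` is homotopy equivalent to a
space built from finitely many cells, and `c` is the alternating sum of the
numbers of cells. -/
def HasEulerChar (X : Type) [TopologicalSpace X] (c : ℤ) : Prop :=
  ∃ (Z : TopCat.{0}) (L : List ℕ),
    AttachedCells (TopCat.of Empty) Z L ∧
    Nonempty (ContinuousMap.HomotopyEquiv X ↑Z) ∧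
    c = (L.map fun d => (-1 : ℤ) ^ d).sum

section Attach

variable {d : ℕ} {A A' W T : Type} [TopologicalSpace A] [TopologicalSpace A']
  [TopologicalSpace W] [TopologicalSpace T]

/-- The inclusion of the boundary sphere into the closed ball. -/
def sphereIncl (d : ℕ) : C(↥(cellSphere d), ↥(cellBall d)) :=
  ⟨fun x => ⟨x.1, Metric.sphere_subset_closedBall x.2⟩, by fun_prop⟩

def attachBase (φ : C(↥(cellSphere d), A)) : C(A, attachSp φ) :=
  ⟨fun a => Quot.mk _ (Sum.inl a), continuous_quot_mk.comp continuous_inl⟩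

def attachCell (φ : C(↥(cellSphere d), A)) : C(↥(cellBall d), attachSp φ) :=
  ⟨fun a => Quot.mk _ (Sum.inr a), continuous_quot_mk.comp continuous_inr⟩

lemma attachBase_apply_eq (φ : C(↥(cellSphere d), A)) (x : ↥(cellSphere d)) :
    attachBase φ (φ x) = attachCell φ (sphereIncl d x) :=
  Quot.sound ⟨x, rfl, rfl⟩

def attachDesc {φ : C(↥(cellSphere d), A)} (f : C(A, W)) (g : C(↥(cellBall d), W))
    (h : ∀ x, f (φ x) = g (sphereIncl d x)) : C(attachSp φ, W) :=
  ⟨Quot.lift (Sum.elim f g) (by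
      rintro _ _ ⟨x, rfl, rfl⟩
      exact h x),
    continuous_quot_lift _ (by fun_prop)⟩

@[simp] lemma attachDesc_base {φ : C(↥(cellSphere d), A)} (f : C(A, W))
    (g : C(↥(cellBall d), W)) (h : ∀ x, f (φ x) = g (sphereIncl d x)) (a : A) :
    attachDesc f g h (attachBase φ a) = f a := rfl

@[simp] lemma attachDesc_cell {φ : C(↥(cellSphere d), A)} (f : C(A, W))
    (g : C(↥(cellBall d), W)) (h : ∀ x, f (φ x) = g (sphereIncl d x)) (a : ↥(cellBall d)) :
    attachDesc f g h (attachCell φ a) = g a := rfl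

lemma attach_ind {φ : C(↥(cellSphere d), A)} {P : attachSp φ → Prop}
    (h1 : ∀ a, P (attachBase φ a)) (h2 : ∀ y, P (attachCell φ y)) (z : attachSp φ) : P z := by
  induction z using Quot.ind with
  | mk z => rcases z with a | y; exacts [h1 a, h2 y]

lemma attach_homotopic {φ : C(↥(cellSphere d), A)} {f₀ f₁ : C(attachSp φ, W)}
    (H : C(A × unitInterval, W)) (K : C(↥(cellBall d) × unitInterval, W))
    (hHK : ∀ x t, H (φ x, t) = K (sphereIncl d x, t))
    (hH0 : ∀ a, H (a, 0) = f₀ (attachBase φ a)) (hH1 : ∀ a, H (a, 1) = f₁ (attachBase φ a))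
    (hK0 : ∀ y, K (y, 0) = f₀ (attachCell φ y)) (hK1 : ∀ y, K (y, 1) = f₁ (attachCell φ y)) :
    f₀.Homotopic f₁ := by
  let F : C(attachSp φ, C(unitInterval, W)) :=
    attachDesc H.curry K.curry (fun x => by ext t; exact hHK x t)
  have hF0 : ∀ z, F z 0 = f₀ z := attach_ind hH0 hK0
  have hF1 : ∀ z, F z 1 = f₁ z := attach_ind hH1 hK1
  refine ⟨⟨⟨fun p => F p.2 p.1, ?_⟩, hF0, hF1⟩⟩
  exact (F.uncurry.continuous).comp continuous_swap

/-- Extend a map on the closed unit ball to the whole Euclidean space along a radial homotopy. -/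
def radialExt (g : C(↥(cellBall d), W)) (G : C(T × ↥(cellSphere d) × ℝ, W))
    (hG : ∀ t x, G (t, x, 0) = g (sphereIncl d x)) :
    C(T × EuclideanSpace ℝ (Fin d), W) where
  toFun p := if h : ‖p.2‖ ≤ 1 then g ⟨p.2, by simpa [cellBall] using h⟩ else
    G (p.1, ⟨‖p.2‖⁻¹ • p.2, by
      have : ‖p.2‖ ≠ 0 := by intro h0; rw [h0] at h; norm_num at h
      simp [cellSphere, norm_smul, this]⟩, ‖p.2‖ - 1)
  continuous_toFun := by
    rw [← continuousOn_univ]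
    have hun : (Set.univ : Set (T × EuclideanSpace ℝ (Fin d))) =
        {p | ‖p.2‖ ≤ 1} ∪ {p | 1 ≤ ‖p.2‖} := by
      ext p; simp [le_total]
    rw [hun]
    refine ContinuousOn.union_of_isClosed ?_ ?_ (isClosed_le (by fun_prop) (by fun_prop))
      (isClosed_le (by fun_prop) (by fun_prop))
    · rw [continuousOn_iff_continuous_domRestrict]
      have hm : ∀ p : {p : T × EuclideanSpace ℝ (Fin d) | ‖p.2‖ ≤ 1}, p.1.2 ∈ cellBall d :=
        fun p => by have h : ‖p.1.2‖ ≤ 1 := p.2; simpa [cellBall] using h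
      have : Continuous fun p : {p : T × EuclideanSpace ℝ (Fin d) | ‖p.2‖ ≤ 1} =>
          g ⟨p.1.2, hm p⟩ :=
        g.continuous.comp (by fun_prop)
      refine this.congr fun p => ?_
      have hp : ‖p.1.2‖ ≤ 1 := p.2
      simp [Set.domRestrict, hp]
    · rw [continuousOn_iff_continuous_domRestrict]
      have h0 : ∀ p : {p : T × EuclideanSpace ℝ (Fin d) | 1 ≤ ‖p.2‖}, ‖p.1.2‖ ≠ 0 := by
        intro p; have hp : 1 ≤ ‖p.1.2‖ := p.2; linarith
      have : Continuous fun p : {p : T × EuclideanSpace ℝ (Fin d) | 1 ≤ ‖p.2‖} =>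
          G (p.1.1, ⟨‖p.1.2‖⁻¹ • p.1.2, by simp [cellSphere, norm_smul, h0 p]⟩, ‖p.1.2‖ - 1) := by
        refine G.continuous.comp ?_
        refine (by fun_prop : Continuous _).prodMk (Continuous.prodMk ?_ (by fun_prop))
        refine Continuous.subtype_mk (Continuous.smul (Continuous.inv₀ (by fun_prop) h0)
          (by fun_prop)) _
      refine this.congr fun p => ?_
      have hp : 1 ≤ ‖p.1.2‖ := p.2
      by_cases h : ‖p.1.2‖ ≤ 1
      · have h1 : ‖p.1.2‖ = 1 := le_antisymm h hp
        simp only [Set.domRestrict, h1, sub_self, hG]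
        rw [dif_pos le_rfl]
        congr 1
        apply Subtype.ext
        simp [sphereIncl]
      · simp [Set.domRestrict, h]

lemma radialExt_of_le (g : C(↥(cellBall d), W)) (G : C(T × ↥(cellSphere d) × ℝ, W))
    (hG : ∀ t x, G (t, x, 0) = g (sphereIncl d x)) (t : T) (y : ↥(cellBall d)) :
    radialExt g G hG (t, y.1) = g y := by
  have : ‖y.1‖ ≤ 1 := by simpa [cellBall] using y.2
  simp [radialExt, this]

lemma radialExt_smul (g : C(↥(cellBall d), W)) (G : C(T × ↥(cellSphere d) × ℝ, W))
    (hG : ∀ t x, G (t, x, 0) = g (sphereIncl d x)) (t : T) (x : ↥(cellSphere d)) (s : ℝ)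
    (hs : 1 ≤ s) : radialExt g G hG (t, s • x.1) = G (t, x, s - 1) := by
  have hx : ‖x.1‖ = 1 := by simpa [cellSphere] using x.2
  have hn : ‖s • x.1‖ = s := by rw [norm_smul, hx, Real.norm_of_nonneg (by linarith), mul_one]
  by_cases h : s ≤ 1
  · obtain rfl : s = 1 := le_antisymm h hs
    simp only [radialExt, ContinuousMap.coe_mk, hn, le_refl, dif_pos, sub_self, hG]
    congr 1
    apply Subtype.ext
    simp [sphereIncl]
  · simp only [radialExt, ContinuousMap.coe_mk, hn, h, dif_neg, not_false_eq_true]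
    congr 3
    apply Subtype.ext
    simp [smul_smul, inv_mul_cancel₀ (by linarith : s ≠ 0)]

lemma exists_sphere_smul {y : EuclideanSpace ℝ (Fin d)} (hy : y ≠ 0) :
    ∃ x : ↥(cellSphere d), y = ‖y‖ • x.1 := by
  have := norm_ne_zero_iff.mpr hy
  exact ⟨⟨‖y‖⁻¹ • y, by simp [cellSphere, norm_smul, this]⟩, by simp [smul_smul, this]⟩

/-- Functoriality of cell attachment in the base. -/
def attachMap {φ : C(↥(cellSphere d), A)} {φ' : C(↥(cellSphere d), A')} (j : C(A, A'))
    (h : ∀ x, j (φ x) = φ' x) : C(attachSp φ, attachSp φ') :=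
  attachDesc ((attachBase φ').comp j) (attachCell φ') (fun x => by
    simp only [ContinuousMap.comp_apply, h, attachBase_apply_eq])

/-- The collar homotopy used to move an attaching map. -/
def collar {φ : C(↥(cellSphere d), A)} (H : C(unitInterval × ↥(cellSphere d), A))
    (θ : C(T × ℝ, ℝ)) :
    C(T × ↥(cellSphere d) × ℝ, attachSp φ) :=
  ⟨fun p => attachBase φ (H (Set.projIcc 0 1 zero_le_one (θ (p.1, p.2.2)), p.2.1)), by
    have := (attachBase φ).continuous
    have h2 := H.continuous
    have h3 := θ.continuous
    have h4 : Continuous (Set.projIcc (0:ℝ) 1 zero_le_one) := continuous_projIcc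
    fun_prop⟩

lemma collar_apply {φ : C(↥(cellSphere d), A)} (H : C(unitInterval × ↥(cellSphere d), A))
    (θ : C(T × ℝ, ℝ)) (t : T) (x : ↥(cellSphere d)) (s : ℝ) :
    collar (φ := φ) H θ (t, x, s) =
      attachBase φ (H (Set.projIcc 0 1 zero_le_one (θ (t, s)), x)) := rfl

lemma projIcc_zero' {s : ℝ} (h : s = 0) :
    Set.projIcc (0:ℝ) 1 zero_le_one s = (0 : unitInterval) := by
  subst h; exact Set.projIcc_left _

lemma projIcc_one' {s : ℝ} (h : s = 1) :
    Set.projIcc (0:ℝ) 1 zero_le_one s = (1 : unitInterval) := by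
  subst h; exact Set.projIcc_right _

/-- The extension of a cell along a homotopy of its attaching map. -/
def slideExt {φ₀ φ₁ : C(↥(cellSphere d), A)} (H : φ₀.Homotopy φ₁) (θ : C(T × ℝ, ℝ))
    (hθ : ∀ t, θ (t, 0) = 1) : C(T × EuclideanSpace ℝ (Fin d), attachSp φ₁) :=
  radialExt (attachCell φ₁) (collar (φ := φ₁) H.toContinuousMap θ) (fun t x => by
    rw [collar_apply, projIcc_one' (hθ t)]
    simp [← attachBase_apply_eq])

lemma slideExt_of_le {φ₀ φ₁ : C(↥(cellSphere d), A)} (H : φ₀.Homotopy φ₁) (θ : C(T × ℝ, ℝ))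
    (hθ : ∀ t, θ (t, 0) = 1) (t : T) (y : ↥(cellBall d)) :
    slideExt H θ hθ (t, y.1) = attachCell φ₁ y := radialExt_of_le _ _ _ _ _

lemma slideExt_smul {φ₀ φ₁ : C(↥(cellSphere d), A)} (H : φ₀.Homotopy φ₁) (θ : C(T × ℝ, ℝ))
    (hθ : ∀ t, θ (t, 0) = 1) (t : T) (x : ↥(cellSphere d)) (s : ℝ) (hs : 1 ≤ s) :
    slideExt H θ hθ (t, s • x.1) =
      attachBase φ₁ (H (Set.projIcc 0 1 zero_le_one (θ (t, s - 1)), x)) :=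
  radialExt_smul _ _ _ _ _ _ hs

def slideProfile : C(Unit × ℝ, ℝ) := ⟨fun p => 1 - p.2, by fun_prop⟩

/-- Comparison of the spaces obtained from homotopic attaching maps. -/
def attachSlide {φ₀ φ₁ : C(↥(cellSphere d), A)} (H : φ₀.Homotopy φ₁) :
    C(attachSp φ₀, attachSp φ₁) :=
  attachDesc (attachBase φ₁)
    ⟨fun y => slideExt H slideProfile (by simp [slideProfile]) ((), (2:ℝ) • y.1), by fun_prop⟩
    (fun x => by
      refine Eq.trans ?_ (slideExt_smul H slideProfile (by simp [slideProfile]) () x 2 (by norm_num)).symm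
      rw [projIcc_zero' (by simp [slideProfile]; norm_num)]
      simp)

lemma attachSlide_map_homotopic {φ : C(↥(cellSphere d), A)} {l : C(A, A)}
    {φ' : C(↥(cellSphere d), A)} (h : ∀ x, l (φ x) = φ' x)
    (K : l.Homotopy (ContinuousMap.id A)) (H : φ'.Homotopy φ) (hH : ∀ t x, H (t, x) = K (t, φ x)) :
    ((attachSlide H).comp (attachMap l h)).Homotopic (ContinuousMap.id _) := by
  refine attach_homotopic ⟨fun p => attachBase φ (K (p.2, p.1)), by fun_prop⟩
    ⟨fun p => slideExt H slideProfile (by simp [slideProfile]) ((), (2 - p.2 : ℝ) • p.1.1),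
      by fun_prop⟩ ?_ ?_ ?_ ?_ ?_
  · intro x t
    have ht := t.2.2
    refine Eq.trans ?_ (slideExt_smul H slideProfile (by simp [slideProfile]) () x (2 - t) (by linarith)).symm
    have : Set.projIcc (0:ℝ) 1 zero_le_one (slideProfile ((), (2 - t : ℝ) - 1)) = t := by
      rw [show slideProfile ((), (2 - t : ℝ) - 1) = (t:ℝ) by simp [slideProfile]; ring]
      exact Set.projIcc_val _ t
    rw [this]
    exact congrArg (attachBase φ) (hH t x).symm
  · intro a; simp [attachMap, attachSlide]
  · intro a; simp
  · intro y
    simp [attachMap, attachSlide]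
  · intro y
    simp only [ContinuousMap.coe_mk, Set.Icc.coe_one, ContinuousMap.id_apply]
    rw [show (2 - 1 : ℝ) • y.1 = y.1 by norm_num]
    exact slideExt_of_le _ _ _ _ y

/-- The profile of the homotopy contracting a path followed by its reverse. -/
def tentProfile : C(unitInterval × ℝ, ℝ) :=
  ⟨fun p => 1 - min p.2 (max ((3 - 3 * p.1 - p.2) / 2) 0), by fun_prop⟩

lemma attachSlide_symm_homotopic {φ₀ φ₁ : C(↥(cellSphere d), A)} (H : φ₀.Homotopy φ₁) :
    ((attachSlide H).comp (attachSlide H.symm)).Homotopic (ContinuousMap.id _) := by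
  have hz : ∀ t, tentProfile (t, 0) = 1 := by
    intro t; simp [tentProfile]
  refine attach_homotopic ⟨fun p => attachBase φ₁ p.1, by fun_prop⟩
    ⟨fun p => slideExt H tentProfile hz (p.2, (4 - 3 * p.2 : ℝ) • p.1.1),
      by fun_prop⟩ ?_ ?_ ?_ ?_ ?_
  · intro x t
    have ht := t.2.2
    refine Eq.trans ?_ (slideExt_smul H tentProfile hz t x (4 - 3 * t) (by linarith)).symm
    rw [projIcc_one']
    · simp
    · simp only [tentProfile, ContinuousMap.coe_mk]
      rw [max_eq_right (by linarith), min_eq_right (by linarith)]; simp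
  · intro a; simp [attachSlide]
  · intro a; simp
  · intro y
    have hy : ‖y.1‖ ≤ 1 := by simpa [cellBall] using y.2
    have key : ∀ z : EuclideanSpace ℝ (Fin d), ‖z‖ ≤ 2 →
        slideExt H slideProfile (by simp [slideProfile]) ((), z) =
          slideExt H tentProfile hz (0, z) := by
      intro z hz2
      rcases le_total ‖z‖ 1 with h | h
      · have hm : z ∈ cellBall d := by simpa [cellBall] using h
        exact (slideExt_of_le H slideProfile _ () ⟨z, hm⟩).trans
          (slideExt_of_le H tentProfile hz 0 ⟨z, hm⟩).symm
      · obtain ⟨x, hx⟩ := exists_sphere_smul (y := z) (by intro h0; simp [h0] at h; linarith)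
        rw [hx, slideExt_smul _ _ _ _ _ _ h, slideExt_smul _ _ _ _ _ _ h]
        have e : slideProfile ((), ‖z‖ - 1) = tentProfile ((0 : unitInterval), ‖z‖ - 1) := by
          simp only [slideProfile, tentProfile, ContinuousMap.coe_mk, Set.Icc.coe_zero]
          rw [max_eq_left (by linarith), min_eq_left (by linarith)]
        rw [e]
    rcases le_total ‖y.1‖ (1/2) with h | h
    · have hm : (2:ℝ) • y.1 ∈ cellBall d := by
        simp [cellBall, norm_smul]; linarith
      have h1 : attachSlide H.symm (attachCell φ₁ y) = attachCell φ₀ ⟨(2:ℝ) • y.1, hm⟩ :=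
        slideExt_of_le H.symm slideProfile (by simp [slideProfile]) () ⟨_, hm⟩
      rw [ContinuousMap.comp_apply, h1]
      have h4 : (4 - 3 * ((0 : unitInterval) : ℝ)) • y.1 = (2:ℝ) • (2:ℝ) • y.1 := by
        rw [smul_smul]; norm_num
      simp only [ContinuousMap.coe_mk]
      rw [h4]
      refine Eq.symm (Eq.trans ?_ (key ((2:ℝ) • (2:ℝ) • y.1) ?_))
      · rfl
      · simp [norm_smul]; linarith
    · obtain ⟨x, hx⟩ := exists_sphere_smul (y := y.1) (by intro h0; simp [h0] at h; linarith)
      have h1 : attachSlide H.symm (attachCell φ₁ y) =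
          slideExt H.symm slideProfile (by simp [slideProfile]) ((), (2 * ‖y.1‖) • x.1) := by
        rw [mul_smul, ← hx]; rfl
      rw [ContinuousMap.comp_apply, h1, slideExt_smul _ _ _ _ _ _ (by linarith)]
      simp only [ContinuousMap.coe_mk]
      have h2 : (4 - 3 * ((0 : unitInterval) : ℝ)) • y.1 = (4 * ‖y.1‖) • x.1 := by
        conv_lhs => rw [hx]
        simp [smul_smul]
      rw [h2, slideExt_smul _ _ _ _ _ _ (by linarith)]
      simp only [slideProfile, tentProfile, ContinuousMap.coe_mk, Set.Icc.coe_zero,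
        ContinuousMap.Homotopy.symm_apply, attachSlide, attachDesc_base]
      congr 3
      apply Subtype.ext
      have e1 : min (4 * ‖y.1‖ - 1) (max ((3 - 3 * 0 - (4 * ‖y.1‖ - 1)) / 2) 0) =
          2 - 2 * ‖y.1‖ := by
        rw [max_eq_left (by linarith), min_eq_right (by linarith)]; ring
      rw [unitInterval.coe_symm_eq, Set.coe_projIcc, Set.coe_projIcc, e1]
      rw [min_eq_right (by linarith), min_eq_right (by linarith), max_eq_right (by linarith),
        max_eq_right (by linarith)]
      ring
  · intro y
    simp only [ContinuousMap.coe_mk, Set.Icc.coe_one, ContinuousMap.id_apply]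
    rw [show (4 - 3 * 1 : ℝ) • y.1 = y.1 by norm_num]
    exact slideExt_of_le _ _ _ _ y

/-- Homotopy equivalences, as a property of continuous maps. -/
def IsHE {X Y : Type} [TopologicalSpace X] [TopologicalSpace Y] (f : C(X, Y)) : Prop :=
  ∃ g : C(Y, X), (g.comp f).Homotopic (ContinuousMap.id X) ∧
    (f.comp g).Homotopic (ContinuousMap.id Y)

section TwoOutOfSix

variable {X Y Z : Type} [TopologicalSpace X] [TopologicalSpace Y] [TopologicalSpace Z]

lemma IsHE.of_comp {k : C(Z, X)} {n : C(Y, Z)} {m : C(X, Y)} {a : C(Z, Y)} (hk : IsHE k)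
    (h : ((k.comp n).comp m).Homotopic (ContinuousMap.id X))
    (ha : (a.comp n).Homotopic (ContinuousMap.id Y)) : IsHE m := by
  obtain ⟨k', hk1, hk2⟩ := hk
  have hb : (n.comp (m.comp k)).Homotopic (ContinuousMap.id Z) := by
    have e1 := ContinuousMap.Homotopic.comp hk1
      (ContinuousMap.Homotopic.refl (n.comp (m.comp k)))
    have e2 := ContinuousMap.Homotopic.comp (ContinuousMap.Homotopic.refl k')
      (ContinuousMap.Homotopic.comp h (ContinuousMap.Homotopic.refl k))
    exact e1.symm.trans (e2.trans hk1)
  have hab : a.Homotopic (m.comp k) := by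
    have e1 := ContinuousMap.Homotopic.comp (ContinuousMap.Homotopic.refl a) hb
    have e2 := ContinuousMap.Homotopic.comp ha (ContinuousMap.Homotopic.refl (m.comp k))
    exact (e1.symm.trans e2)
  refine ⟨k.comp n, h, ?_⟩
  exact (ContinuousMap.Homotopic.comp hab.symm (ContinuousMap.Homotopic.refl n)).trans ha

end TwoOutOfSix

lemma attachSlide_isHE {φ₀ φ₁ : C(↥(cellSphere d), A)} (H : φ₀.Homotopy φ₁) :
    IsHE (attachSlide H) := by
  refine ⟨attachSlide H.symm, ?_, attachSlide_symm_homotopic H⟩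
  have := attachSlide_symm_homotopic H.symm
  rwa [ContinuousMap.Homotopy.symm_symm] at this

lemma attachMap_isHE {φ : C(↥(cellSphere d), A)} {j : C(A, A')} (hj : IsHE j) :
    IsHE (attachMap (φ := φ) (φ' := j.comp φ) j (fun _ => rfl)) := by
  obtain ⟨l, ⟨K⟩, ⟨K'⟩⟩ := hj
  let H : (l.comp (j.comp φ)).Homotopy φ :=
    ⟨⟨fun p => K (p.1, φ p.2), by fun_prop⟩, by intro x; simp, by intro x; simp⟩
  let H' : (j.comp (l.comp (j.comp φ))).Homotopy (j.comp φ) :=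
    ⟨⟨fun p => K' (p.1, j (φ p.2)), by fun_prop⟩, by intro x; simp, by intro x; simp⟩
  have h1 := attachSlide_map_homotopic (φ := φ) (l := l.comp j) (φ' := l.comp (j.comp φ))
    (fun _ => rfl) K H (fun _ _ => rfl)
  have h2 := attachSlide_map_homotopic (φ := j.comp φ) (l := j.comp l)
    (φ' := j.comp (l.comp (j.comp φ))) (fun _ => rfl) K' H' (fun _ _ => rfl)
  refine IsHE.of_comp (k := attachSlide H)
    (n := attachMap (φ := j.comp φ) (φ' := l.comp (j.comp φ)) l (fun _ => rfl))
    (a := (attachSlide H').comp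
      (attachMap (φ := l.comp (j.comp φ)) (φ' := j.comp (l.comp (j.comp φ))) j (fun _ => rfl)))
    (attachSlide_isHE H) ?_ ?_
  · refine (ContinuousMap.Homotopic.trans ?_ h1)
    rw [ContinuousMap.comp_assoc]
    have : ∀ (f g : C(attachSp φ, attachSp φ)), f = g → f.Homotopic g := by
      rintro f _ rfl; exact .refl _
    apply this
    ext z
    induction z using attach_ind <;> rfl
  · refine (ContinuousMap.Homotopic.trans ?_ h2)
    rw [ContinuousMap.comp_assoc]
    have : ∀ (f g : C(attachSp (j.comp φ), attachSp (j.comp φ))), f = g → f.Homotopic g := by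
      rintro f _ rfl; exact .refl _
    apply this
    ext z
    induction z using attach_ind <;> rfl

lemma IsHE.hasEulerChar {X Y : Type} [TopologicalSpace X] [TopologicalSpace Y] {f : C(X, Y)}
    (hf : IsHE f) {c : ℤ} (h : HasEulerChar Y c) : HasEulerChar X c := by
  obtain ⟨Z, L, hL, ⟨e⟩, hc⟩ := h
  obtain ⟨g, h1, h2⟩ := hf
  exact ⟨Z, L, hL, ⟨ContinuousMap.HomotopyEquiv.trans ⟨f, g, h1, h2⟩ e⟩, hc⟩

lemma IsHE.hasEulerChar' {X Y : Type} [TopologicalSpace X] [TopologicalSpace Y] {f : C(X, Y)}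
    (hf : IsHE f) {c : ℤ} (h : HasEulerChar X c) : HasEulerChar Y c := by
  obtain ⟨g, h1, h2⟩ := hf
  exact IsHE.hasEulerChar (f := g) ⟨f, h2, h1⟩ h

lemma isHE_homeomorph {X Y : Type} [TopologicalSpace X] [TopologicalSpace Y] (e : X ≃ₜ Y) :
    IsHE (e : C(X, Y)) :=
  ⟨(e.symm : C(Y, X)), by simp [ContinuousMap.Homotopic.refl],
    by simp [ContinuousMap.Homotopic.refl]⟩

lemma hasEulerChar_congr {X Y : Type} [TopologicalSpace X] [TopologicalSpace Y] (e : X ≃ₜ Y)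
    {c : ℤ} : HasEulerChar X c ↔ HasEulerChar Y c :=
  ⟨(isHE_homeomorph e).hasEulerChar', (isHE_homeomorph e).hasEulerChar⟩

/-- Attaching one more cell at the end. -/
lemma AttachedCells.append {A Z W : TopCat.{0}} {L : List ℕ} (h : AttachedCells A Z L)
    {d : ℕ} (hW : AttachOneCell Z W d) : AttachedCells A W (L ++ [d]) := by
  induction L generalizing A with
  | nil =>
    obtain ⟨e⟩ := h
    obtain ⟨φ, ⟨e'⟩⟩ := hW
    let φ' : C(↥(cellSphere d), A) := (e.symm : C(Z, A)).comp φ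
    refine ⟨W, ⟨φ', ⟨e'.trans ?_⟩⟩, ⟨Homeomorph.refl _⟩⟩
    exact
      { toFun := attachMap (e.symm : C(Z, A)) (fun _ => rfl)
        invFun := attachMap (e : C(A, Z)) (fun x => by simp [φ'])
        left_inv := fun z => by
          induction z using attach_ind <;> simp [attachMap]
        right_inv := fun z => by
          induction z using attach_ind <;> simp [attachMap]
        continuous_toFun := (attachMap _ _).continuous
        continuous_invFun := (attachMap _ _).continuous }
  | cons a L ih =>
    obtain ⟨B, hB, hL⟩ := h
    exact ⟨B, hB, ih hL⟩

theorem HasEulerChar.attach {c : ℤ} (h : HasEulerChar A c) (φ : C(↥(cellSphere d), A)) :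
    HasEulerChar (attachSp φ) (c + (-1) ^ d) := by
  obtain ⟨Z, L, hL, ⟨e⟩, hc⟩ := h
  have hj : IsHE (e.toFun) := ⟨e.invFun, e.left_inv, e.right_inv⟩
  obtain ⟨g, h1, h2⟩ := attachMap_isHE (φ := φ) hj
  refine ⟨TopCat.of (attachSp (e.toFun.comp φ)), L ++ [d], hL.append ⟨e.toFun.comp φ,
    ⟨Homeomorph.refl _⟩⟩, ⟨⟨_, g, h1, h2⟩⟩, ?_⟩
  simp [hc]

lemma hasEulerChar_empty {X : Type} [TopologicalSpace X] [IsEmpty X] : HasEulerChar X 0 := by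
  refine ⟨TopCat.of Empty, [], ⟨Homeomorph.refl _⟩, ⟨Homeomorph.toHomotopyEquiv ?_⟩, rfl⟩
  exact
    { toFun := fun x => (IsEmpty.false x).elim
      invFun := fun x => x.elim
      left_inv := fun x => (IsEmpty.false x).elim
      right_inv := fun x => x.elim
      continuous_toFun := continuous_of_const fun x => (IsEmpty.false x).elim
      continuous_invFun := continuous_of_const fun x => x.elim }

end Attach

section Handle

lemma exists_glue {W T V : Type} [TopologicalSpace W] [TopologicalSpace T] [TopologicalSpace V]
    {P : Set W} (hP : IsClosed P) {e : T → W} (he : Topology.IsClosedEmbedding e)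
    (hcov : P ∪ Set.range e = Set.univ) (f : C(P, V)) (g : C(T, V))
    (hfg : ∀ t (h : e t ∈ P), f ⟨e t, h⟩ = g t) :
    ∃ F : C(W, V), (∀ p : P, F p = f p) ∧ ∀ t, F (e t) = g t := by
  classical
  have hex : ∀ w, w ∉ P → ∃ t, e t = w := fun w hw => by
    have : w ∈ P ∪ Set.range e := hcov ▸ Set.mem_univ w
    exact this.resolve_left hw
  let F : W → V := fun w => if h : w ∈ P then f ⟨w, h⟩ else g (hex w h).choose
  have hF1 : ∀ p : P, F p = f p := fun p => by simp [F]
  have hF2 : ∀ t, F (e t) = g t := fun t => by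
    by_cases h : e t ∈ P
    · rw [← hfg t h]; exact hF1 ⟨_, h⟩
    · simp only [F, dif_neg h]
      congr 1
      exact he.injective (hex _ h).choose_spec
  refine ⟨⟨F, ?_⟩, hF1, hF2⟩
  rw [← continuousOn_univ, ← hcov]
  refine ContinuousOn.union_of_isClosed ?_ ?_ hP he.isClosed_range
  · rw [continuousOn_iff_continuous_domRestrict]
    exact f.continuous.congr fun p => (hF1 p).symm
  · rw [continuousOn_iff_continuous_domRestrict]
    refine (g.continuous.comp he.isEmbedding.toHomeomorph.symm.continuous).congr ?_
    rintro ⟨_, t, rfl⟩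
    have : he.isEmbedding.toHomeomorph.symm ⟨e t, t, rfl⟩ = t := by
      rw [Homeomorph.symm_apply_eq]; rfl
    simp only [Function.comp_apply, this]
    exact (hF2 t).symm

variable {d : ℕ}

/-- The radial map onto the closed ball. -/
def clampBall (d : ℕ) : C(EuclideanSpace ℝ (Fin d), ↥(cellBall d)) :=
  ⟨fun y => ⟨(max 1 ‖y‖)⁻¹ • y, by
    have : 0 < max 1 ‖y‖ := by positivity
    simp only [cellBall, mem_closedBall_zero_iff, norm_smul, norm_inv, Real.norm_eq_abs,
      abs_of_pos this]
    rw [inv_mul_le_iff₀ this]; simp⟩, by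
    have h : Continuous fun y : EuclideanSpace ℝ (Fin d) => max 1 ‖y‖ := by fun_prop
    exact Continuous.subtype_mk ((h.inv₀ fun y => by positivity).smul continuous_id) _⟩

lemma clampBall_of_le (y : ↥(cellBall d)) : clampBall d y.1 = y := by
  have : ‖y.1‖ ≤ 1 := by simpa [cellBall] using y.2
  apply Subtype.ext
  simp [clampBall, max_eq_left this]

lemma norm_clampBall_of_ge {y : EuclideanSpace ℝ (Fin d)} (h : 1 ≤ ‖y‖) :
    ‖(clampBall d y).1‖ = 1 := by
  have : ‖y‖ ≠ 0 := by linarith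
  simp [clampBall, max_eq_right h, norm_smul, this]

lemma clampBall_smul_sphere (x : ↥(cellSphere d)) {s : ℝ} (hs : 1 ≤ s) :
    clampBall d (s • x.1) = sphereIncl d x := by
  have hx : ‖x.1‖ = 1 := by simpa [cellSphere] using x.2
  have hn : ‖s • x.1‖ = s := by rw [norm_smul, hx, Real.norm_of_nonneg (by linarith), mul_one]
  apply Subtype.ext
  simp only [clampBall, ContinuousMap.coe_mk, hn, max_eq_right hs, smul_smul, sphereIncl]
  rw [inv_mul_cancel₀ (by linarith), one_smul]

variable {W V : Type} [TopologicalSpace W] [AddCommGroup V] [Module ℝ V] [TopologicalSpace V]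
  [ContinuousSMul ℝ V]

theorem handle_hasEulerChar {P : Set W} (hP : IsClosed P) {B : Set V} (hB : Convex ℝ B)
    (h0 : (0 : V) ∈ B) {e : ↥B × ↥(cellBall d) → W} (he : Topology.IsClosedEmbedding e)
    (hcov : P ∪ Set.range e = Set.univ) (hPe : ∀ x y, e (x, y) ∈ P ↔ ‖y.1‖ = 1)
    {c : ℤ} (hc : HasEulerChar ↥P c) : HasEulerChar W (c + (-1) ^ d) := by
  have hn1 : ∀ y : ↥(cellBall d), ‖y.1‖ ≤ 1 := fun y => by simpa [cellBall] using y.2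
  have hs1 : ∀ y : ↥(cellSphere d), ‖y.1‖ = 1 := fun y => by simpa [cellSphere] using y.2
  let b0 : ↥B := ⟨0, h0⟩
  let shrink : C(↥B × ℝ, ↥B) := ⟨fun p => ⟨(Set.projIcc (0:ℝ) 1 zero_le_one p.2 : ℝ) • p.1.1,
    hB.smul_mem_of_zero_mem h0 p.1.2 (Set.projIcc (0:ℝ) 1 zero_le_one p.2).2⟩, by
      have : Continuous (Set.projIcc (0:ℝ) 1 zero_le_one) := continuous_projIcc
      fun_prop⟩
  have hsh0 : ∀ b s, s ≤ 0 → shrink (b, s) = b0 := fun b s hs => by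
    apply Subtype.ext
    simp [shrink, b0, Set.projIcc_of_le_left _ hs]
  have hsh1 : ∀ b, shrink (b, 1) = b := fun b => by
    apply Subtype.ext
    simp [shrink]
  have hshb : ∀ s, shrink (b0, s) = b0 := fun b => by
    apply Subtype.ext
    simp [shrink, b0]
  have hec : Continuous e := he.continuous
  let φ : C(↥(cellSphere d), ↥P) :=
    ⟨fun x => ⟨e (b0, sphereIncl d x), (hPe _ _).2 (hs1 x)⟩, by fun_prop⟩
  let s : C(attachSp φ, W) := attachDesc ⟨Subtype.val, continuous_subtype_val⟩
    ⟨fun y => e (b0, y), by fun_prop⟩ (fun _ => rfl)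
  have hcl : ∀ y : ↥(cellBall d), 1 / 2 ≤ ‖y.1‖ → ‖(clampBall d ((2:ℝ) • y.1)).1‖ = 1 :=
    fun y hy => norm_clampBall_of_ge (by simp [norm_smul]; linarith)
  have hφ : ∀ (y : ↥(cellBall d)) (hy : ‖y.1‖ = 1),
      attachBase φ ⟨e (b0, y), (hPe _ _).2 hy⟩ = attachCell φ y := fun y hy =>
    attachBase_apply_eq φ ⟨y.1, by simpa [cellSphere] using hy⟩
  obtain ⟨g, hg1, hg2⟩ := exists_glue (W := ↥B × ↥(cellBall d)) (V := attachSp φ)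
    (P := {q | 1 / 2 ≤ ‖q.2.1‖}) (isClosed_le (by fun_prop) (by fun_prop))
    (T := {q : ↥B × ↥(cellBall d) | ‖q.2.1‖ ≤ 1 / 2}) (e := Subtype.val)
    (IsClosed.isClosedEmbedding_subtypeVal (isClosed_le (by fun_prop) (by fun_prop)))
    (by
      rw [Subtype.range_coe]; ext q; simp [le_total])
    ⟨fun q => attachBase φ ⟨e (shrink (q.1.1, 2 * ‖q.1.2.1‖ - 1), clampBall d ((2:ℝ) • q.1.2.1)),
      (hPe _ _).2 (hcl _ q.2)⟩, by fun_prop⟩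
    ⟨fun q => attachCell φ (clampBall d ((2:ℝ) • q.1.2.1)), by fun_prop⟩
    (by
      rintro ⟨⟨b, y⟩, (h1 : ‖y.1‖ ≤ 1 / 2)⟩ (h2 : 1 / 2 ≤ ‖y.1‖)
      simp only [ContinuousMap.coe_mk]
      have : shrink (b, 2 * ‖y.1‖ - 1) = b0 := hsh0 _ _ (by linarith)
      simp only [this]
      exact hφ _ (hcl _ h2))
  obtain ⟨r, hr1, hr2⟩ := exists_glue hP he hcov (attachBase φ) g (by
    rintro ⟨b, y⟩ h
    have hy := (hPe _ _).1 h
    have hcy : clampBall d ((2:ℝ) • y.1) = y :=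
      clampBall_smul_sphere ⟨y.1, by simpa [cellSphere] using hy⟩ one_le_two
    refine Eq.trans ?_ (hg1 ⟨(b, y), by simp [hy]; norm_num⟩).symm
    simp only [ContinuousMap.coe_mk, hcy, hy]
    congr 3
    rw [show (2 * 1 - 1 : ℝ) = 1 by norm_num, hsh1])
  have hrs : (r.comp s).Homotopic (ContinuousMap.id _) := by
    refine ContinuousMap.Homotopic.symm (attach_homotopic
      ⟨fun p => attachBase φ p.1, by fun_prop⟩
      ⟨fun p => attachCell φ (clampBall d ((1 + p.2 : ℝ) • p.1.1)), by fun_prop⟩ ?_ ?_ ?_ ?_ ?_)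
    · intro x t
      have ht := t.2.1
      simp only [ContinuousMap.coe_mk]
      rw [show (sphereIncl d x).1 = x.1 from rfl, clampBall_smul_sphere _ (by linarith),
        attachBase_apply_eq]
    · intro a; rfl
    · intro a; exact (hr1 a).symm
    · intro y; simp [clampBall_of_le]
    · intro y
      simp only [ContinuousMap.coe_mk, Set.Icc.coe_one]
      rw [show (1 + 1 : ℝ) = 2 by norm_num]
      refine Eq.trans ?_ (hr2 (b0, y)).symm
      rcases le_total ‖y.1‖ (1 / 2) with h | h
      · exact (hg2 ⟨(b0, y), h⟩).symm
      · refine Eq.trans ?_ (hg1 ⟨(b0, y), h⟩).symm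
        simp only [ContinuousMap.coe_mk, hshb]
        exact (hφ _ (hcl _ h)).symm
  have hsr : (s.comp r).Homotopic (ContinuousMap.id _) := by
    let G : C((↥B × ↥(cellBall d)) × unitInterval, W) :=
      ⟨fun p => e (shrink (p.1.1, (1 - p.2) + p.2 * (max (2 * ‖p.1.2.1‖ - 1) 0)),
        clampBall d ((1 + p.2 : ℝ) • p.1.2.1)), by fun_prop⟩
    obtain ⟨F, hF1, hF2⟩ := exists_glue hP he hcov (V := C(unitInterval, W))
      (ContinuousMap.curry ⟨fun p : ↥P × unitInterval => p.1.1, by fun_prop⟩) G.curry (by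
        rintro ⟨b, y⟩ h
        have hy := (hPe _ _).1 h
        ext t
        have ht := t.2.1
        have hcy : clampBall d ((1 + t : ℝ) • y.1) = y :=
          clampBall_smul_sphere ⟨y.1, by simpa [cellSphere] using hy⟩ (by linarith)
        simp only [ContinuousMap.curry_apply, ContinuousMap.coe_mk, G, hcy, hy]
        rw [max_eq_left (by norm_num), show (1 - (t:ℝ) + t * (2 * 1 - 1)) = 1 by ring, hsh1])
    have hall : ∀ Q : W → Prop, (∀ p : P, Q p) → (∀ b y, Q (e (b, y))) → ∀ w, Q w := by
      intro Q h1 h2 w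
      have : w ∈ P ∪ Set.range e := hcov ▸ Set.mem_univ w
      rcases this with h | ⟨⟨b, y⟩, rfl⟩
      exacts [h1 ⟨w, h⟩, h2 b y]
    have hF0 : ∀ w, F w 0 = w := by
      refine hall _ (fun p => by rw [hF1]; rfl) (fun b y => ?_)
      rw [hF2]
      simp [G, hsh1, clampBall_of_le]
    have hF1' : ∀ w, F w 1 = s (r w) := by
      refine hall _ (fun p => by rw [hF1, hr1]; rfl) (fun b y => ?_)
      rw [hF2, hr2]
      simp only [ContinuousMap.curry_apply, ContinuousMap.coe_mk, G, Set.Icc.coe_one, sub_self,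
        zero_add, one_mul, show (1 + 1 : ℝ) = 2 by norm_num]
      rcases le_total ‖y.1‖ (1 / 2) with h | h
      · refine Eq.trans ?_ (congrArg s (hg2 ⟨(b, y), h⟩)).symm
        rw [max_eq_right (by linarith), hsh0 _ _ le_rfl]
        rfl
      · refine Eq.trans ?_ (congrArg s (hg1 ⟨(b, y), h⟩)).symm
        rw [max_eq_left (by linarith)]
        rfl
    refine ContinuousMap.Homotopic.symm ⟨⟨⟨fun p => F p.2 p.1, ?_⟩, hF0, hF1'⟩⟩
    exact (F.uncurry.continuous).comp continuous_swap
  exact IsHE.hasEulerChar' (f := s) ⟨r, hrs, hsr⟩ (hc.attach φ)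

end Handle

section CircleProduct

variable {d : ℕ}

lemma exists_ball_prod_homeo' {E F : Type} [NormedAddCommGroup E] [NormedSpace ℝ E]
    [NormedAddCommGroup F] [NormedSpace ℝ F] [FiniteDimensional ℝ F] (ℓ : E ≃L[ℝ] ℝ × F) :
    ∃ Θ : ↥(Metric.closedBall (0 : E) 1) ≃ₜ ↥(Set.Icc (-1:ℝ) 1) × ↥(Metric.closedBall (0 : F) 1),
      ∀ z, ‖z.1‖ = 1 ↔ |(Θ z).1.1| = 1 ∨ ‖(Θ z).2.1‖ = 1 := by
  have : ProperSpace F := FiniteDimensional.proper_real F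
  let S : Set (ℝ × F) := Set.Icc (-1) 1 ×ˢ Metric.closedBall 0 1
  have hSi : interior S = Set.Ioo (-1) 1 ×ˢ Metric.ball 0 1 := by
    rw [interior_prod_eq, interior_Icc, interior_closedBall _ one_ne_zero]
  have hSc : IsClosed S := isClosed_Icc.prod Metric.isClosed_closedBall
  let s := ℓ ⁻¹' S
  have hsi : interior s = ℓ ⁻¹' (interior S) := (ℓ.toHomeomorph.preimage_interior S).symm
  have hsc : IsClosed s := hSc.preimage ℓ.continuous
  have hconv : Convex ℝ s :=
    ((convex_Icc _ _).prod (convex_closedBall _ _)).linear_preimage ℓ.toLinearMap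
  have hne : (interior s).Nonempty := ⟨0, by rw [hsi, hSi]; simp⟩
  have hb : Bornology.IsBounded s := by
    have : IsCompact S := isCompact_Icc.prod (isCompact_closedBall _ _)
    have h2 : IsCompact s := by
      have := this.image ℓ.symm.continuous
      rwa [ContinuousLinearEquiv.image_symm_eq_preimage] at this
    exact h2.isBounded
  obtain ⟨h, h1, h2, -⟩ := exists_homeomorph_image_interior_closure_frontier_eq_unitBall hconv hne hb
  rw [hsc.closure_eq] at h2
  have m2 : ∀ z, ‖z‖ ≤ 1 ↔ ℓ (h.symm z) ∈ S := fun z => by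
    rw [← mem_closedBall_zero_iff, ← h2, Homeomorph.image_eq_preimage_symm]; rfl
  have m1 : ∀ z, ‖z‖ < 1 ↔ ℓ (h.symm z) ∈ interior S := fun z => by
    rw [← mem_ball_zero_iff, ← h1, Homeomorph.image_eq_preimage_symm, hsi]; rfl
  have hz1 : ∀ z : ↥(Metric.closedBall (0 : E) 1), ‖z.1‖ ≤ 1 := fun z => mem_closedBall_zero_iff.1 z.2
  have hzS : ∀ z : ↥(Metric.closedBall (0 : E) 1), ℓ (h.symm z.1) ∈ S := fun z => (m2 _).1 (hz1 z)
  have hSz : ∀ p ∈ S, h (ℓ.symm p) ∈ Metric.closedBall (0 : E) 1 := fun p hp => by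
    rw [mem_closedBall_zero_iff, m2, Homeomorph.symm_apply_apply,
      ContinuousLinearEquiv.apply_symm_apply]
    exact hp
  have hc1 := h.symm.continuous
  have hc2 := h.continuous
  let Θ : ↥(Metric.closedBall (0 : E) 1) ≃ₜ
      ↥(Set.Icc (-1:ℝ) 1) × ↥(Metric.closedBall (0 : F) 1) :=
    { toFun := fun z => (⟨(ℓ (h.symm z.1)).1, (hzS z).1⟩, ⟨(ℓ (h.symm z.1)).2, (hzS z).2⟩)
      invFun := fun p => ⟨h (ℓ.symm (p.1.1, p.2.1)), hSz (p.1.1, p.2.1) ⟨p.1.2, p.2.2⟩⟩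
      left_inv := fun z => Subtype.ext (by
        change h (ℓ.symm (ℓ (h.symm z.1))) = z.1
        rw [ContinuousLinearEquiv.symm_apply_apply, Homeomorph.apply_symm_apply])
      right_inv := fun p => by
        have : ℓ (h.symm (h (ℓ.symm (p.1.1, p.2.1)))) = (p.1.1, p.2.1) := by
          rw [Homeomorph.symm_apply_apply, ContinuousLinearEquiv.apply_symm_apply]
        exact Prod.ext (Subtype.ext (congrArg Prod.fst this)) (Subtype.ext (congrArg Prod.snd this))
      continuous_toFun := by
        have hc := ℓ.continuous.comp (hc1.comp
          (continuous_subtype_val (p := fun z : E => z ∈ Metric.closedBall (0 : E) 1)))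
        exact (Continuous.subtype_mk hc.fst _).prodMk (Continuous.subtype_mk hc.snd _)
      continuous_invFun := by
        refine Continuous.subtype_mk (hc2.comp (ℓ.symm.continuous.comp ?_)) _
        exact (continuous_subtype_val.comp continuous_fst).prodMk
          (continuous_subtype_val.comp continuous_snd) }
  refine ⟨Θ, ?_⟩
  intro z
  have e1 : ‖z.1‖ = 1 ↔ ¬ ‖z.1‖ < 1 := by
    have := hz1 z
    constructor
    · intro h; simp [h]
    · intro h; linarith
  have hS := hzS z
  have h3 : |(Θ z).1.1| ≤ 1 := abs_le.2 hS.1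
  have h4 : ‖(Θ z).2.1‖ ≤ 1 := mem_closedBall_zero_iff.1 hS.2
  have h5 : ‖z.1‖ < 1 ↔ |(Θ z).1.1| < 1 ∧ ‖(Θ z).2.1‖ < 1 := by
    rw [m1, hSi, abs_lt, ← mem_ball_zero_iff]; rfl
  rw [e1, h5, not_and_or, not_lt, not_lt]
  constructor
  · rintro (h | h)
    · exact Or.inl (le_antisymm h3 h)
    · exact Or.inr (le_antisymm h4 h)
  · rintro (h | h)
    · exact Or.inl h.ge
    · exact Or.inr h.ge

lemma exists_ball_prod_homeo (d m : ℕ) (hm : m = d + 1) :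
    ∃ Θ : ↥(cellBall m) ≃ₜ ↥(Set.Icc (-1:ℝ) 1) × ↥(cellBall d),
      ∀ z, ‖z.1‖ = 1 ↔ |(Θ z).1.1| = 1 ∨ ‖(Θ z).2.1‖ = 1 := by
  obtain ⟨ℓ⟩ : Nonempty (EuclideanSpace ℝ (Fin m) ≃L[ℝ] ℝ × EuclideanSpace ℝ (Fin d)) :=
    FiniteDimensional.nonempty_continuousLinearEquiv_of_finrank_eq (by simp; omega)
  exact exists_ball_prod_homeo' ℓ

variable {A : Type} [TopologicalSpace A] (φ : C(↥(cellSphere d), A))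

lemma attachBase_isClosedEmbedding : Topology.IsClosedEmbedding (attachBase φ) := by
  let pr : Set A → attachSp φ → Prop := fun C => Quot.lift
    (Sum.elim (fun a => a ∈ C) (fun y => ∃ x, φ x ∈ C ∧ sphereIncl d x = y)) (by
      rintro _ _ ⟨x, rfl, rfl⟩
      apply propext
      constructor
      · intro h; exact ⟨x, h, rfl⟩
      · rintro ⟨x', h, hx⟩
        have : x' = x := by
          have h2 : (sphereIncl d x').1 = x.1 := by rw [hx]
          exact Subtype.ext h2
        exact this ▸ h)
  have hpr : ∀ C z, z ∈ attachBase φ '' C ↔ pr C z := by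
    intro C z
    constructor
    · rintro ⟨a, ha, rfl⟩; exact ha
    · induction z using attach_ind with
      | h1 a => exact fun h => ⟨a, h, rfl⟩
      | h2 y =>
        rintro ⟨x, hx, rfl⟩
        exact ⟨φ x, hx, attachBase_apply_eq φ x⟩
  have hinj : Function.Injective (attachBase φ) := by
    intro a a' h
    have : attachBase φ a ∈ attachBase φ '' {a'} := ⟨a', rfl, h.symm⟩
    exact (hpr _ _).1 this
  refine Topology.IsClosedEmbedding.of_continuous_injective_isClosedMap
    (attachBase φ).continuous hinj ?_
  intro C hC
  have hq : Topology.IsQuotientMap (Quot.mk (attachRel φ)) := isQuotientMap_quot_mk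
  refine hq.isClosed_preimage.1 ?_
  have hemb : IsClosedMap (sphereIncl d) := by
    have : CompactSpace ↥(cellSphere d) := isCompact_iff_compactSpace.1 (isCompact_sphere _ _)
    exact (sphereIncl d).continuous.isClosedMap
  rw [isClosed_sum_iff]
  constructor
  · convert hC using 1
    ext a
    exact (hpr C (attachBase φ a))
  · convert hemb _ (hC.preimage φ.continuous) using 1
    ext y
    exact (hpr C (attachCell φ y))

/-- The radius function of an attached cell, equal to `1` on the base. -/
def attachRad : C(attachSp φ, ℝ) :=
  attachDesc ⟨fun _ => 1, continuous_const⟩ ⟨fun y => ‖y.1‖, by fun_prop⟩ (fun x => by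
    have : ‖x.1‖ = 1 := by simpa [cellSphere] using x.2
    simp [sphereIncl, this])

/-- A coordinate on an attached cell, equal to twice the tautological one on the half-cell. -/
def attachCoord : C(attachSp φ, ↥(cellBall d)) :=
  attachDesc ⟨fun _ => clampBall d 0, continuous_const⟩
    ⟨fun y => clampBall d ((2 * min 1 (2 * (1 - ‖y.1‖))) • y.1), by fun_prop⟩ (fun x => by
    have : ‖x.1‖ = 1 := by simpa [cellSphere] using x.2
    simp [sphereIncl, this])

end CircleProduct

section CircleProduct

variable {V : Type} [AddCommGroup V] [Module ℝ V] [TopologicalSpace V] [ContinuousSMul ℝ V]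
variable {d : ℕ}

theorem handle_set_hasEulerChar {N : Type} [TopologicalSpace N] {P W : Set N} {B : Set V}
    (hB : Convex ℝ B) (h0 : (0 : V) ∈ B) {e : ↥B × ↥(cellBall d) → N}
    (he : Topology.IsEmbedding e) (hcov : P ∪ Set.range e = W)
    (hP : IsClosed (Subtype.val ⁻¹' P : Set ↥W))
    (hK : IsClosed (Subtype.val ⁻¹' Set.range e : Set ↥W))
    (hPe : ∀ x y, e (x, y) ∈ P ↔ ‖y.1‖ = 1)
    {c : ℤ} (hc : HasEulerChar ↥P c) : HasEulerChar ↥W (c + (-1) ^ d) := by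
  have heW : ∀ p, e p ∈ W := fun p => hcov ▸ Or.inr ⟨p, rfl⟩
  have hPW : P ⊆ W := hcov ▸ Set.subset_union_left
  have hr : Set.range (Set.codRestrict e W heW) = Subtype.val ⁻¹' Set.range e := by
    ext ⟨w, hw⟩
    simp
  refine handle_hasEulerChar (W := ↥W) hP hB h0 (e := Set.codRestrict e W heW)
    ⟨he.codRestrict W heW, by rwa [hr]⟩ ?_ (fun x y => hPe x y) ?_
  · rw [hr, ← Set.preimage_union, hcov]
    ext w; simp
  · let ι : ↥P ≃ₜ ↥(Subtype.val ⁻¹' P : Set ↥W) :=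
      { toFun := fun p => ⟨⟨p.1, hPW p.2⟩, p.2⟩
        invFun := fun p => ⟨p.1.1, p.2⟩
        left_inv := fun _ => rfl
        right_inv := fun _ => rfl
        continuous_toFun := by fun_prop
        continuous_invFun := by fun_prop }
    exact (hasEulerChar_congr ι).1 hc

/-- The half circles, parametrized by the imaginary part. -/
def halfArc (ε : ℝ) (hε : ε ^ 2 = 1) : C(↥(Set.Icc (-1:ℝ) 1), Circle) :=
  ⟨fun s => ⟨⟨ε * √(1 - s.1 ^ 2), s.1⟩, by
    have h : 0 ≤ 1 - s.1 ^ 2 := by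
      have := s.2.1; have := s.2.2; nlinarith
    change _ ∈ Metric.sphere (0 : ℂ) 1
    rw [mem_sphere_zero_iff_norm]
    rw [← sq_eq_sq₀ (norm_nonneg _) zero_le_one, Complex.sq_norm, Complex.normSq_mk]
    have := Real.mul_self_sqrt h
    linear_combination (√(1 - s.1 ^ 2) * √(1 - s.1 ^ 2)) * hε + this⟩, by
    refine Continuous.subtype_mk ?_ _
    have : (fun s : ↥(Set.Icc (-1:ℝ) 1) => (⟨ε * √(1 - s.1 ^ 2), s.1⟩ : ℂ)) =
      fun s => Complex.equivRealProdCLM.symm (ε * √(1 - s.1 ^ 2), s.1) := rfl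
    rw [this]
    fun_prop⟩

lemma circle_im_mem (z : Circle) : (z : ℂ).im ∈ Set.Icc (-1:ℝ) 1 := by
  have := Complex.abs_im_le_norm (z : ℂ)
  rw [Circle.norm_coe] at this
  exact abs_le.1 this

lemma range_halfArc (ε : ℝ) (hε : ε ^ 2 = 1) :
    Set.range (halfArc ε hε) = {z : Circle | 0 ≤ ε * (z : ℂ).re} := by
  ext z
  constructor
  · rintro ⟨s, rfl⟩
    change 0 ≤ ε * (ε * √(1 - s.1 ^ 2))
    rw [← mul_assoc, ← sq, hε, one_mul]; positivity
  · intro hz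
    refine ⟨⟨(z : ℂ).im, circle_im_mem z⟩, ?_⟩
    apply Subtype.ext
    have h1 : (z : ℂ).re ^ 2 + (z : ℂ).im ^ 2 = 1 := by
      have := Circle.normSq_coe z
      rw [Complex.normSq_apply] at this; linarith
    apply Complex.ext
    · change ε * √(1 - (z : ℂ).im ^ 2) = (z : ℂ).re
      have : 1 - (z : ℂ).im ^ 2 = (ε * (z : ℂ).re) ^ 2 := by rw [mul_pow, hε]; linarith
      rw [this, Real.sqrt_sq hz, ← mul_assoc, ← sq, hε, one_mul]
    · rfl

variable {A : Type} [TopologicalSpace A] (φ : C(↥(cellSphere d), A))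

/-- The half-size cell. -/
def halfCell : C(↥(cellBall d), attachSp φ) :=
  ⟨fun y => attachCell φ (clampBall d ((1/2 : ℝ) • y.1)), by fun_prop⟩

lemma coe_clampBall_half (y : ↥(cellBall d)) :
    (clampBall d ((1/2 : ℝ) • y.1)).1 = (1/2 : ℝ) • y.1 := by
  have h : ‖y.1‖ ≤ 1 := by simpa [cellBall] using y.2
  have hm : (1/2 : ℝ) • y.1 ∈ cellBall d := by simp [cellBall, norm_smul]; linarith
  exact congrArg Subtype.val (clampBall_of_le ⟨_, hm⟩)

lemma attachRad_halfCell (y : ↥(cellBall d)) : attachRad φ (halfCell φ y) = ‖y.1‖ / 2 := by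
  change ‖(clampBall d ((1/2 : ℝ) • y.1)).1‖ = _
  rw [coe_clampBall_half, norm_smul]; norm_num; ring

lemma attachCoord_halfCell (y : ↥(cellBall d)) : attachCoord φ (halfCell φ y) = y := by
  have h : ‖y.1‖ ≤ 1 := by simpa [cellBall] using y.2
  change clampBall d ((2 * min 1 (2 * (1 - ‖(clampBall d ((1/2 : ℝ) • y.1)).1‖))) •
    (clampBall d ((1/2 : ℝ) • y.1)).1) = y
  rw [coe_clampBall_half]
  have : ‖(1/2 : ℝ) • y.1‖ = ‖y.1‖ / 2 := by rw [norm_smul]; norm_num; ring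
  rw [this, min_eq_left (by linarith), smul_smul]
  norm_num
  exact clampBall_of_le y

lemma range_halfCell : Set.range (halfCell φ) = {w | attachRad φ w ≤ 1 / 2} := by
  ext w
  constructor
  · rintro ⟨y, rfl⟩
    have h : ‖y.1‖ ≤ 1 := by simpa [cellBall] using y.2
    simp only [Set.mem_ofPred_eq, attachRad_halfCell]; linarith
  · induction w using attach_ind with
    | h1 a =>
      intro h
      change (1:ℝ) ≤ 1 / 2 at h
      norm_num at h
    | h2 y =>
      intro h
      change ‖y.1‖ ≤ 1 / 2 at h
      have hm : (2 : ℝ) • y.1 ∈ cellBall d := by simp [cellBall, norm_smul]; linarith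
      refine ⟨⟨_, hm⟩, ?_⟩
      change attachCell φ _ = _
      congr 1
      apply Subtype.ext
      rw [coe_clampBall_half, smul_smul]; norm_num

/-- Complement of an open half-cell, times a circle. -/
def outerSet : Set (attachSp φ × Circle) := {q | 1 / 2 ≤ attachRad φ q.1}

lemma outerSet_hasEulerChar {c : ℤ} (h : HasEulerChar (A × Circle) c) :
    HasEulerChar ↥(outerSet φ) c := by
  let st : C(attachSp φ, C(unitInterval, attachSp φ)) := attachDesc
    (ContinuousMap.curry ⟨fun p : A × unitInterval => attachBase φ p.1, by fun_prop⟩)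
    (ContinuousMap.curry ⟨fun p : ↥(cellBall d) × unitInterval =>
      attachCell φ (clampBall d ((1 + p.2 : ℝ) • p.1.1)), by fun_prop⟩) (by
    intro x
    ext t
    simp only [ContinuousMap.curry_apply, ContinuousMap.coe_mk]
    have := t.2.1
    rw [show (sphereIncl d x).1 = x.1 from rfl, clampBall_smul_sphere x (by linarith),
      attachBase_apply_eq])
  have stb : ∀ a t, st (attachBase φ a) t = attachBase φ a := fun a t => rfl
  have stc : ∀ y (t : unitInterval), st (attachCell φ y) t =
    attachCell φ (clampBall d ((1 + t : ℝ) • y.1)) := fun a t => rfl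
  have st0 : ∀ w, st w 0 = w := by
    intro w
    induction w using attach_ind with
    | h1 a => rfl
    | h2 y => rw [stc]; simp [clampBall_of_le]
  have st1 : ∀ w, 1 / 2 ≤ attachRad φ w → st w 1 ∈ Set.range (attachBase φ) := by
    intro w
    induction w using attach_ind with
    | h1 a => exact fun _ => ⟨a, rfl⟩
    | h2 y =>
      intro hy
      change 1 / 2 ≤ ‖y.1‖ at hy
      have : ‖(clampBall d ((1 + (1 : unitInterval) : ℝ) • y.1)).1‖ = 1 :=
        norm_clampBall_of_ge (by
          rw [norm_smul]; norm_num; linarith)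
      rw [stc]
      exact ⟨φ ⟨_, mem_sphere_zero_iff_norm.2 this⟩, attachBase_apply_eq φ ⟨_, _⟩⟩
  have strad : ∀ w t, 1 / 2 ≤ attachRad φ w → 1 / 2 ≤ attachRad φ (st w t) := by
    intro w t
    induction w using attach_ind with
    | h1 a => exact fun h => h
    | h2 y =>
      intro hy
      change 1 / 2 ≤ ‖y.1‖ at hy
      change 1 / 2 ≤ ‖(clampBall d ((1 + t : ℝ) • y.1)).1‖
      have ht := t.2.1
      have hn : ‖(1 + t : ℝ) • y.1‖ = (1 + t) * ‖y.1‖ := by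
        rw [norm_smul, Real.norm_of_nonneg (by linarith)]
      rcases le_total ‖(1 + t : ℝ) • y.1‖ 1 with h1 | h1
      · have hm : (1 + t : ℝ) • y.1 ∈ cellBall d := by simpa [cellBall] using h1
        have h2 : (clampBall d ((1 + t : ℝ) • y.1)) = ⟨_, hm⟩ := clampBall_of_le ⟨_, hm⟩
        rw [h2]
        change _ ≤ ‖(1 + t : ℝ) • y.1‖
        rw [hn]; nlinarith
      · rw [norm_clampBall_of_ge h1]; norm_num
  have hb := attachBase_isClosedEmbedding φ
  let f : C(A × Circle, ↥(outerSet φ)) := ⟨fun p => ⟨(attachBase φ p.1, p.2), by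
    change (1/2 : ℝ) ≤ 1; norm_num⟩, by fun_prop⟩
  let ρ : C(↥(outerSet φ), A) := ⟨fun q => hb.isEmbedding.toHomeomorph.symm
    ⟨st q.1.1 1, st1 _ q.2⟩, by
      have := hb.isEmbedding.toHomeomorph.symm.continuous
      fun_prop⟩
  have hρ : ∀ q, attachBase φ (ρ q) = st q.1.1 1 := by
    intro q
    have := hb.isEmbedding.toHomeomorph.apply_symm_apply ⟨st q.1.1 1, st1 _ q.2⟩
    exact congrArg Subtype.val this
  let g : C(↥(outerSet φ), A × Circle) := ⟨fun q => (ρ q, q.1.2), by fun_prop⟩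
  refine IsHE.hasEulerChar' (f := f) ⟨g, ?_, ?_⟩ h
  · have : g.comp f = ContinuousMap.id _ := by
      ext p
      · exact hb.injective (hρ (f p))
      · rfl
    rw [this]
  · refine ContinuousMap.Homotopic.symm ⟨⟨⟨fun p => ⟨(st p.2.1.1 p.1, p.2.1.2),
      strad _ _ p.2.2⟩, ?_⟩, ?_, ?_⟩⟩
    · have := st.uncurry.continuous
      have h2 : Continuous fun p : attachSp φ × unitInterval => st p.1 p.2 := this
      have h3 : Continuous fun p : unitInterval × ↥(outerSet φ) => st p.2.1.1 p.1 :=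
        h2.comp (f := fun p : unitInterval × ↥(outerSet φ) => (p.2.1.1, p.1)) (by fun_prop)
      fun_prop
    · intro q
      exact Subtype.ext (Prod.ext (st0 _) rfl)
    · intro q
      exact Subtype.ext (Prod.ext (hρ q).symm rfl)

lemma attach_circle_hasEulerChar {c : ℤ} (h : HasEulerChar (A × Circle) c) :
    HasEulerChar (attachSp φ × Circle) c := by
  have hn : ∀ y : ↥(cellBall d), ‖y.1‖ ≤ 1 := fun y => by simpa [cellBall] using y.2
  have he1 : ((-1 : ℝ)) ^ 2 = 1 := by norm_num
  have he2 : (1 : ℝ) ^ 2 = 1 := by norm_num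
  have hP := outerSet_hasEulerChar φ h
  have him : ∀ ε hε s, (halfArc ε hε s : ℂ).im = s.1 := fun _ _ _ => rfl
  have hre : ∀ ε hε s, (halfArc ε hε s : ℂ).re = ε * √(1 - s.1 ^ 2) := fun _ _ _ => rfl
  let e : ∀ ε : ℝ, ε ^ 2 = 1 → ↥(Set.Icc (-1:ℝ) 1) × ↥(cellBall d) → attachSp φ × Circle :=
    fun ε hε p => (halfCell φ p.2, halfArc ε hε p.1)
  let g : attachSp φ × Circle → ↥(Set.Icc (-1:ℝ) 1) × ↥(cellBall d) :=
    fun q => (⟨(q.2 : ℂ).im, circle_im_mem q.2⟩, attachCoord φ q.1)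
  have hg : Continuous g := by
    have : Continuous fun q : attachSp φ × Circle => (q.2 : ℂ).im := by fun_prop
    fun_prop
  have hec : ∀ ε hε, Continuous (e ε hε) := fun ε hε => by fun_prop
  have hge : ∀ ε hε p, g (e ε hε p) = p := fun ε hε p =>
    Prod.ext (Subtype.ext rfl) (attachCoord_halfCell φ p.2)
  have hemb : ∀ ε hε, Topology.IsEmbedding (e ε hε) := fun ε hε =>
    Function.LeftInverse.isEmbedding (hge ε hε) hg (hec ε hε)
  have hrange : ∀ ε hε, Set.range (e ε hε) =
      {q | attachRad φ q.1 ≤ 1 / 2 ∧ 0 ≤ ε * (q.2 : ℂ).re} := by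
    intro ε hε
    ext ⟨w, z⟩
    have h1 := Set.ext_iff.1 (range_halfCell φ) w
    have h2 := Set.ext_iff.1 (range_halfArc ε hε) z
    change _ ↔ w ∈ {w | attachRad φ w ≤ 1 / 2} ∧ z ∈ {z : Circle | 0 ≤ ε * (z : ℂ).re}
    rw [← h1, ← h2]
    constructor
    · rintro ⟨p, hp⟩
      exact ⟨⟨p.2, congrArg Prod.fst hp⟩, ⟨p.1, congrArg Prod.snd hp⟩⟩
    · rintro ⟨⟨y, rfl⟩, ⟨s, rfl⟩⟩
      exact ⟨(s, y), rfl⟩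
  have hcl : ∀ ε hε, IsClosed (Set.range (e ε hε)) := fun ε hε => by
    rw [hrange]
    have c1 : Continuous fun q : attachSp φ × Circle => attachRad φ q.1 := by fun_prop
    have c2 : Continuous fun q : attachSp φ × Circle => ε * (q.2 : ℂ).re := by fun_prop
    exact (isClosed_le c1 continuous_const).inter (isClosed_le continuous_const c2)
  have hPc : IsClosed (outerSet φ) := isClosed_le (by fun_prop) (by fun_prop)
  have hPe : ∀ ε hε s y, e ε hε (s, y) ∈ outerSet φ ↔ ‖y.1‖ = 1 := by
    intro ε hε s y
    change 1 / 2 ≤ attachRad φ (halfCell φ y) ↔ _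
    rw [attachRad_halfCell]
    have := hn y
    constructor
    · intro h; linarith
    · intro h; linarith
  have step1 := handle_set_hasEulerChar (P := outerSet φ) (convex_Icc (-1:ℝ) 1) (by simp)
    (hemb (-1) he1) rfl (hPc.preimage continuous_subtype_val)
    ((hcl _ _).preimage continuous_subtype_val) (hPe _ _) hP
  obtain ⟨Θ, hΘ⟩ := exists_ball_prod_homeo d (d + 1) rfl
  let e2 : ↥({0} : Set ℝ) × ↥(cellBall (d + 1)) → attachSp φ × Circle :=
    fun p => e 1 he2 (Θ p.2)
  have hr2 : Set.range e2 = Set.range (e 1 he2) := by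
    ext q
    constructor
    · rintro ⟨p, rfl⟩; exact ⟨_, rfl⟩
    · rintro ⟨p, rfl⟩; exact ⟨(⟨0, rfl⟩, Θ.symm p), by simp [e2]⟩
  have hW : (outerSet φ ∪ Set.range (e (-1) he1)) ∪ Set.range e2 = Set.univ := by
    rw [hr2, hrange, hrange]
    ext ⟨w, z⟩
    simp only [outerSet, Set.mem_union, Set.mem_ofPred_eq, Set.mem_univ, iff_true]
    rcases le_total (1/2) (attachRad φ w) with h | h
    · exact Or.inl (Or.inl h)
    · rcases le_total 0 (z : ℂ).re with h' | h'
      · exact Or.inr ⟨h, by linarith⟩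
      · exact Or.inl (Or.inr ⟨h, by linarith⟩)
  have hemb2 : Topology.IsEmbedding e2 := by
    refine Function.LeftInverse.isEmbedding (f := fun q => (⟨0, rfl⟩, Θ.symm (g q))) ?_ ?_ ?_
    · rintro ⟨⟨x, rfl⟩, z⟩
      simp only [e2, hge, Homeomorph.symm_apply_apply]
    · have := Θ.symm.continuous
      fun_prop
    · have := Θ.continuous
      have := hec 1 he2
      fun_prop
  have step2 := handle_set_hasEulerChar (P := outerSet φ ∪ Set.range (e (-1) he1))
    (convex_singleton (0:ℝ)) (by simp) hemb2 hW
    ((hPc.union (hcl _ _)).preimage continuous_subtype_val)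
    ((hr2 ▸ hcl _ _).preimage continuous_subtype_val) (by
      intro x z
      rw [hΘ z]
      have hs := (Θ z).1.2
      have hs' : (Θ z).1.1 ^ 2 ≤ 1 := by nlinarith [hs.1, hs.2]
      have : e2 (x, z) ∈ outerSet φ ↔ ‖(Θ z).2.1‖ = 1 := hPe _ _ _ _
      rw [Set.mem_union, this, hrange, or_comm]
      refine or_congr ?_ Iff.rfl
      change attachRad φ (halfCell φ (Θ z).2) ≤ 1/2 ∧ 0 ≤ (-1 : ℝ) * (1 * √(1 - (Θ z).1.1 ^ 2)) ↔ _
      rw [attachRad_halfCell]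
      have := hn (Θ z).2
      constructor
      · rintro ⟨-, h⟩
        have h0 : √(1 - (Θ z).1.1 ^ 2) = 0 := le_antisymm (by linarith) (Real.sqrt_nonneg _)
        rw [Real.sqrt_eq_zero (by linarith)] at h0
        rw [← sq_eq_sq₀ (abs_nonneg _) zero_le_one, sq_abs]; linarith
      · intro h
        have : (Θ z).1.1 ^ 2 = 1 := by rw [← sq_abs, h]; norm_num
        refine ⟨by linarith, ?_⟩
        rw [this]; simp) step1
  have hu := (hasEulerChar_congr (Homeomorph.Set.univ (attachSp φ × Circle))).1 step2
  convert hu using 1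
  ring

theorem hasEulerChar_prod_circle {F : Type} [TopologicalSpace F] {c : ℤ} (h : HasEulerChar F c) :
    HasEulerChar (F × Circle) 0 := by
  obtain ⟨Z, L, hL, ⟨e⟩, -⟩ := h
  have key : ∀ (L : List ℕ) (A Z : TopCat.{0}), AttachedCells A Z L →
      HasEulerChar (↥A × Circle) 0 → HasEulerChar (↥Z × Circle) 0 := by
    intro L
    induction L with
    | nil =>
      rintro A Z ⟨e⟩ h
      exact (hasEulerChar_congr (e.prodCongr (Homeomorph.refl _))).1 h
    | cons d L ih =>
      rintro A Z ⟨B, ⟨φ, ⟨e⟩⟩, hL⟩ h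
      exact ih B Z hL ((hasEulerChar_congr (e.prodCongr (Homeomorph.refl _))).2
        (attach_circle_hasEulerChar φ h))
  have hZ : HasEulerChar (↥Z × Circle) 0 := by
    refine key L _ _ hL ?_
    have : IsEmpty (↥(TopCat.of Empty) × Circle) := ⟨fun p => p.1.elim⟩
    exact hasEulerChar_empty
  have he := e.prodCongr (ContinuousMap.HomotopyEquiv.refl Circle)
  exact IsHE.hasEulerChar (f := he.toFun) ⟨he.invFun, he.left_inv, he.right_inv⟩ hZ

end CircleProduct

/-- A continuous flow. -/
structure CFlow (M : Type) [TopologicalSpace M] where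
  toFun : ℝ → M → M
  cont : Continuous fun p : ℝ × M => toFun p.1 p.2
  zero : ∀ x, toFun 0 x = x
  add : ∀ s t x, toFun (s + t) x = toFun s (toFun t x)

/-- Forward invariance of a set under a flow. -/
def CFlow.Fwd {M : Type} [TopologicalSpace M] (Φ : CFlow M) (S : Set M) : Prop :=
  ∀ x ∈ S, ∀ t, 0 ≤ t → Φ.toFun t x ∈ S

section FlowInclusion
variable {M : Type} [MetricSpace M] (Φ : CFlow M)

lemma CFlow.continuous_comp {T : Type} [TopologicalSpace T] {a : T → ℝ} {b : T → M}
    (ha : Continuous a) (hb : Continuous b) : Continuous fun x => Φ.toFun (a x) (b x) :=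
  Φ.cont.comp (ha.prodMk hb)

theorem CFlow.isHE_inclusion {N W : Set M} (hN : Φ.Fwd N) (hW : Φ.Fwd W) (hWN : W ⊆ N)
    (hop : ∃ O, IsOpen O ∧ O ∩ N = W)
    (habs : ∀ x ∈ N, ∃ t, 0 ≤ t ∧ Φ.toFun t x ∈ W) :
    IsHE (⟨Set.inclusion hWN, continuous_inclusion hWN⟩ : C(↥W, ↥N)) := by
  obtain ⟨O, hO, hOW⟩ := hop
  obtain ⟨τ, hτ⟩ := exists_continuous_forall_mem_convex_of_local_const (X := ↥N) (E := ℝ)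
    (t := fun x => {t | 0 ≤ t ∧ Φ.toFun t x.1 ∈ W}) (fun x => by
      refine Set.OrdConnected.convex ⟨?_⟩
      intro a ha b hb s hs
      refine ⟨ha.1.trans hs.1, ?_⟩
      have := hW _ ha.2 (s - a) (sub_nonneg.2 hs.1)
      rwa [← Φ.add, sub_add_cancel] at this) (fun x => by
      obtain ⟨t, ht, hx⟩ := habs x.1 x.2
      refine ⟨t, ?_⟩
      have hc : Continuous fun y : ↥N => Φ.toFun t y.1 :=
        Φ.continuous_comp continuous_const continuous_subtype_val
      have hxO : Φ.toFun t x.1 ∈ O := (hOW ▸ hx : Φ.toFun t x.1 ∈ O ∩ N).1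
      filter_upwards [(hO.preimage hc).mem_nhds hxO] with y hy
      exact ⟨ht, hOW ▸ ⟨hy, hN _ y.2 t ht⟩⟩)
  have hcomp : Continuous fun x : ↥N => Φ.toFun (τ x) x.1 :=
    Φ.continuous_comp τ.continuous continuous_subtype_val
  refine ⟨⟨fun x => ⟨Φ.toFun (τ x) x.1, (hτ x).2⟩, hcomp.subtype_mk _⟩, ?_, ?_⟩
  · refine ContinuousMap.Homotopic.symm ⟨⟨⟨fun p => ⟨Φ.toFun (p.1.1 * τ (Set.inclusion hWN p.2)) p.2.1,
      hW _ p.2.2 _ (mul_nonneg p.1.2.1 (hτ _).1)⟩, ?_⟩, ?_, ?_⟩⟩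
    · refine Continuous.subtype_mk (Φ.continuous_comp ?_ (by fun_prop)) _
      have := continuous_inclusion hWN
      fun_prop
    · intro x; exact Subtype.ext (by simp [Φ.zero])
    · intro x; exact Subtype.ext (by simp)
  · refine ContinuousMap.Homotopic.symm ⟨⟨⟨fun p => ⟨Φ.toFun (p.1.1 * τ p.2) p.2.1,
      hN _ p.2.2 _ (mul_nonneg p.1.2.1 (hτ _).1)⟩, ?_⟩, ?_, ?_⟩⟩
    · exact Continuous.subtype_mk (Φ.continuous_comp (by fun_prop) (by fun_prop)) _
    · intro x; exact Subtype.ext (by simp [Φ.zero])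
    · intro x; exact Subtype.ext (by simp)

theorem CFlow.hasEulerChar_of_absorbing {N W : Set M} (hN : Φ.Fwd N) (hW : Φ.Fwd W) (hWN : W ⊆ N)
    (hop : ∃ O, IsOpen O ∧ O ∩ N = W)
    (habs : ∀ x ∈ N, ∃ t, 0 ≤ t ∧ Φ.toFun t x ∈ W) {c : ℤ} (hc : HasEulerChar ↥W c) :
    HasEulerChar ↥N c :=
  (Φ.isHE_inclusion hN hW hWN hop habs).hasEulerChar' hc

end FlowInclusion

section Handle
variable {M : Type} [MetricSpace M] (Φ : CFlow M)
variable {V F : Type} [NormedAddCommGroup V] [NormedAddCommGroup F]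

/-- The open product box. -/
def obox (V F : Type) [NormedAddCommGroup V] [NormedAddCommGroup F] (a b : ℝ) : Set (V × F) :=
  {u | ‖u.1‖ < a ∧ ‖u.2‖ < b}

lemma isOpen_obox (a b : ℝ) : IsOpen (obox V F a b) :=
  (isOpen_lt (f := fun u : V × F => ‖u.1‖) (by fun_prop) continuous_const).inter
    (isOpen_lt (f := fun u : V × F => ‖u.2‖) (by fun_prop) continuous_const)

lemma obox_mono {a b a' b' : ℝ} (h : a ≤ a') (h' : b ≤ b') : obox V F a b ⊆ obox V F a' b' :=
  fun _ hu => ⟨hu.1.trans_le h, hu.2.trans_le h'⟩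

variable [NormedSpace ℝ V] [NormedSpace ℝ F]

/-- A chart in which the flow is the linear saddle. -/
structure CFlow.SaddleChart (r : ℝ) (ψ : V × F → M) : Prop where
  emb : Topology.IsOpenEmbedding (fun u : ↥(obox V F r r) => ψ u.1)
  flow : ∀ x y t, 0 ≤ t → ‖x‖ < r → Real.exp t * ‖y‖ < r →
    Φ.toFun t (ψ (x, y)) = ψ (Real.exp (-t) • x, Real.exp t • y)

variable {Φ}
variable {r : ℝ} {ψ : V × F → M}

lemma CFlow.SaddleChart.isOpen_image (h : Φ.SaddleChart r ψ) {S : Set (V × F)} (hS : IsOpen S)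
    (hr : S ⊆ obox V F r r) : IsOpen (ψ '' S) := by
  have := h.emb.isOpenMap _ (hS.preimage continuous_subtype_val)
  convert this using 1
  ext z
  constructor
  · rintro ⟨u, hu, rfl⟩; exact ⟨⟨u, hr hu⟩, hu, rfl⟩
  · rintro ⟨u, hu, rfl⟩; exact ⟨u.1, hu, rfl⟩

lemma CFlow.SaddleChart.inj (h : Φ.SaddleChart r ψ) {u v : V × F} (hu : u ∈ obox V F r r)
    (hv : v ∈ obox V F r r) (e : ψ u = ψ v) : u = v :=
  congrArg Subtype.val (@h.emb.injective ⟨u, hu⟩ ⟨v, hv⟩ e)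

/-- Inside a saddle box a point either stays or exits into `W`. -/
lemma CFlow.SaddleChart.stays_or_exits (h : Φ.SaddleChart r ψ) {W : Set M} (hW : Φ.Fwd W)
    {b : ℝ} (hbr : b < r) (hb : 0 < b)
    (hexit : ∀ x y, ‖x‖ < b / 2 → ‖y‖ = b → ψ (x, y) ∈ W) {x : V} {y : F} (hx : ‖x‖ < b / 2)
    (hy : ‖y‖ < b) {t : ℝ} (ht : 0 ≤ t) :
    (Real.exp t * ‖y‖ < b ∧ Φ.toFun t (ψ (x, y)) = ψ (Real.exp (-t) • x, Real.exp t • y) ∧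
      ‖Real.exp (-t) • x‖ < b / 2) ∨ Φ.toFun t (ψ (x, y)) ∈ W := by
  have hc : ∀ t : ℝ, 0 ≤ t → ‖Real.exp (-t) • x‖ < b / 2 := fun t ht => by
    rw [norm_smul, Real.norm_of_nonneg (Real.exp_pos _).le]
    have : Real.exp (-t) ≤ 1 := Real.exp_le_one_iff.2 (by linarith)
    have := norm_nonneg x
    nlinarith
  rcases lt_or_ge (Real.exp t * ‖y‖) b with h1 | h1
  · exact Or.inl ⟨h1, h.flow _ _ _ ht (by linarith) (by linarith), hc t ht⟩
  · right
    have hy0 : 0 < ‖y‖ := by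
      rcases (norm_nonneg y).eq_or_lt with h0 | h0
      · rw [← h0, mul_zero] at h1; linarith
      · exact h0
    set s := Real.log (b / ‖y‖)
    have hes : Real.exp s = b / ‖y‖ := Real.exp_log (by positivity)
    have hs0 : 0 ≤ s := Real.log_nonneg (by rw [le_div_iff₀ hy0]; linarith)
    have hst : s ≤ t := by
      rw [← Real.exp_le_exp, hes, div_le_iff₀ hy0]; exact h1
    have hmul : Real.exp s * ‖y‖ = b := by rw [hes]; field_simp
    have hin : Φ.toFun s (ψ (x, y)) ∈ W := by
      rw [h.flow _ _ _ hs0 (by linarith) (by linarith)]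
      refine hexit _ _ (hc s hs0) ?_
      rw [norm_smul, Real.norm_of_nonneg (Real.exp_pos _).le, hmul]
    have := hW _ hin (t - s) (by linarith)
    rwa [← Φ.add, sub_add_cancel] at this

lemma CFlow.SaddleChart.fwd_union (h : Φ.SaddleChart r ψ) {W : Set M} (hW : Φ.Fwd W)
    {b : ℝ} (hbr : b < r) (hb : 0 < b)
    (hexit : ∀ x y, ‖x‖ < b / 2 → ‖y‖ = b → ψ (x, y) ∈ W) :
    Φ.Fwd (W ∪ ψ '' obox V F (b / 2) b) := by
  rintro _ (hx | ⟨⟨x, y⟩, ⟨hx, hy⟩, rfl⟩) t ht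
  · exact Or.inl (hW _ hx t ht)
  · rcases h.stays_or_exits hW hbr hb hexit hx hy ht with ⟨h1, h2, h3⟩ | h1
    · right
      rw [h2]
      refine ⟨_, ⟨h3, ?_⟩, rfl⟩
      simpa [norm_smul] using h1
    · exact Or.inl h1

theorem CFlow.SaddleChart.hasEulerChar_union {d : ℕ} (L : EuclideanSpace ℝ (Fin d) ≃ₗᵢ[ℝ] F)
    (h : Φ.SaddleChart r ψ) {W : Set M} (hW : Φ.Fwd W) (hWo : IsOpen W)
    {b : ℝ} (hbr : b < r) (hb : 0 < b)
    (hexit : ∀ x y, ‖x‖ < b / 2 → ‖y‖ = b → ψ (x, y) ∈ W)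
    (hcore : ∀ x y, ‖x‖ < b / 2 → ‖y‖ ≤ b / 4 → ψ (x, y) ∉ W) {c : ℤ} (hc : HasEulerChar ↥W c) :
    HasEulerChar ↥(W ∪ ψ '' obox V F (b / 2) b) (c + (-1) ^ d) := by
  have hsub : obox V F (b / 2) b ⊆ obox V F r r := obox_mono (by linarith) hbr.le
  set X := W ∪ ψ '' obox V F (b / 2) b with hX
  have hsub4 : obox V F (b / 2) (b / 4) ⊆ obox V F (b / 2) b := obox_mono le_rfl (by linarith)
  have hX4 : IsOpen (ψ '' obox V F (b / 2) (b / 4)) :=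
    h.isOpen_image (isOpen_obox _ _) (hsub4.trans hsub)
  set P := X \ ψ '' obox V F (b / 2) (b / 4) with hP
  have hWP : W ⊆ P := fun w hw => ⟨Or.inl hw, by
    rintro ⟨⟨x, y⟩, ⟨hx, hy⟩, rfl⟩
    exact hcore x y hx hy.le hw⟩
  have hmemP : ∀ x y, ‖x‖ < b / 2 → ‖y‖ < b → (ψ (x, y) ∈ P ↔ b / 4 ≤ ‖y‖) := by
    intro x y hx hy
    constructor
    · rintro ⟨-, h2⟩
      by_contra hlt
      exact h2 ⟨_, ⟨hx, not_le.1 hlt⟩, rfl⟩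
    · intro hle
      refine ⟨Or.inr ⟨_, ⟨hx, hy⟩, rfl⟩, ?_⟩
      rintro ⟨v, hv, hve⟩
      have := h.inj (hsub (hsub4 hv)) (hsub (show (x, y) ∈ obox V F (b / 2) b from ⟨hx, hy⟩)) hve
      rw [this] at hv
      exact absurd hle (not_le.2 hv.2)
  have hPcases : ∀ z ∈ P, z ∈ W ∨ ∃ x y, ‖x‖ < b / 2 ∧ ‖y‖ < b ∧ b / 4 ≤ ‖y‖ ∧ z = ψ (x, y) := by
    rintro z hz
    rcases hz.1 with hw | ⟨⟨x, y⟩, ⟨hx, hy⟩, rfl⟩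
    · exact Or.inl hw
    · exact Or.inr ⟨x, y, hx, hy, (hmemP x y hx hy).1 hz, rfl⟩
  have hPf : Φ.Fwd P := by
    intro z hz t ht
    rcases hPcases z hz with hw | ⟨x, y, hx, hy, hy4, rfl⟩
    · exact hWP (hW _ hw t ht)
    · rcases h.stays_or_exits hW hbr hb hexit hx hy ht with ⟨h1, h2, h3⟩ | h1
      · rw [h2]
        have hn : ‖Real.exp t • y‖ = Real.exp t * ‖y‖ := by
          rw [norm_smul, Real.norm_of_nonneg (Real.exp_pos _).le]
        rw [hmemP _ _ h3 (hn ▸ h1), hn]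
        have := Real.one_le_exp ht
        nlinarith
      · exact hWP h1
  have hPc : HasEulerChar ↥P c := by
    refine Φ.hasEulerChar_of_absorbing hPf hW hWP
      ⟨W, hWo, Set.inter_eq_left.2 hWP⟩ (fun z hz => ?_) hc
    rcases hPcases z hz with hw | ⟨x, y, hx, hy, hy4, rfl⟩
    · exact ⟨0, le_rfl, by rwa [Φ.zero]⟩
    · refine ⟨Real.log 4, Real.log_nonneg (by norm_num), ?_⟩
      rcases h.stays_or_exits hW hbr hb hexit hx hy
        (Real.log_nonneg (by norm_num : (1:ℝ) ≤ 4)) with ⟨h1, -⟩ | h1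
      · rw [Real.exp_log (by norm_num)] at h1; linarith
      · exact h1
  let B : Set V := Metric.ball 0 (b / 2)
  have hBn : ∀ x : ↥B, ‖x.1‖ < b / 2 := fun x => mem_ball_zero_iff.1 x.2
  have hyn : ∀ y : ↥(cellBall d), ‖y.1‖ ≤ 1 := fun y => by simpa [cellBall] using y.2
  have hn : ∀ y : ↥(cellBall d), ‖(b / 4) • L y.1‖ = b / 4 * ‖y.1‖ := fun y => by
    rw [norm_smul, L.norm_map, Real.norm_of_nonneg (by linarith)]
  have hbox : ∀ p : ↥B × ↥(cellBall d), (p.1.1, (b / 4) • L p.2.1) ∈ obox V F r r := fun p =>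
    ⟨by linarith [hBn p.1], by
      change ‖(b / 4) • L p.2.1‖ < r
      rw [hn]; nlinarith [hyn p.2]⟩
  let e : ↥B × ↥(cellBall d) → M := fun p => ψ (p.1.1, (b / 4) • L p.2.1)
  have he : Topology.IsEmbedding e := by
    let g : ↥B × ↥(cellBall d) → ↥(obox V F r r) := fun p => ⟨_, hbox p⟩
    have hg : Topology.IsEmbedding g := by
      have h1 : Topology.IsEmbedding (fun p : ↥B × ↥(cellBall d) => (p.1.1, (b / 4) • L p.2.1)) := by
        have h2 : Topology.IsEmbedding (fun p : ↥(cellBall d) => (b / 4) • L p.1) :=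
          (Homeomorph.smulOfNeZero (b / 4) (by linarith : b / 4 ≠ 0)).isEmbedding.comp
            (L.toHomeomorph.isEmbedding.comp .subtypeVal)
        exact Topology.IsEmbedding.subtypeVal.prodMap h2
      exact h1.codRestrict _ hbox
    exact h.emb.isEmbedding.comp hg
  have hrange : Set.range e = {z | ∃ x y, ‖x‖ < b / 2 ∧ ‖y‖ ≤ b / 4 ∧ z = ψ (x, y)} := by
    ext z
    constructor
    · rintro ⟨p, rfl⟩
      exact ⟨_, _, hBn p.1, by rw [hn]; nlinarith [hyn p.2], rfl⟩
    · rintro ⟨x, y, hx, hy, rfl⟩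
      refine ⟨(⟨x, by simpa [B] using hx⟩, ⟨L.symm ((b / 4)⁻¹ • y), ?_⟩), ?_⟩
      · rw [cellBall, mem_closedBall_zero_iff, L.symm.norm_map, norm_smul, Real.norm_of_nonneg (by positivity),
          inv_mul_le_iff₀ (by positivity)]
        linarith
      · change ψ (x, (b / 4) • L (L.symm ((b / 4)⁻¹ • y))) = _
        rw [L.apply_symm_apply, smul_inv_smul₀ (by linarith)]
  refine handle_set_hasEulerChar (P := P) (convex_ball (0:V) (b / 2)) (by simpa using hb) he ?_
    ?_ ?_ (fun x y => ?_) hPc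
  · rw [hrange]
    ext z
    constructor
    · rintro (hz | ⟨x, y, hx, hy, rfl⟩)
      · exact hz.1
      · exact Or.inr ⟨_, ⟨hx, by change ‖y‖ < b; linarith⟩, rfl⟩
    · intro hz
      by_cases h4 : z ∈ ψ '' obox V F (b / 2) (b / 4)
      · obtain ⟨⟨x, y⟩, ⟨hx, hy⟩, rfl⟩ := h4
        exact Or.inr ⟨x, y, hx, hy.le, rfl⟩
      · exact Or.inl ⟨hz, h4⟩
  · have : (Subtype.val ⁻¹' P : Set ↥X) = (Subtype.val ⁻¹' (ψ '' obox V F (b / 2) (b / 4)))ᶜ := by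
      ext z; simp [hP]
    rw [this]
    exact (hX4.preimage continuous_subtype_val).isClosed_compl
  · set S : Set (V × F) := {u | (‖u.1‖ < b / 2 ∧ ‖u.2‖ < b) ∧ b / 4 < ‖u.2‖}
    have hS : IsOpen S := (isOpen_obox (b / 2) b).inter
      (isOpen_lt (g := fun u : V × F => ‖u.2‖) continuous_const (by fun_prop))
    have hSb : S ⊆ obox V F (b / 2) b := fun u hu => hu.1
    have : (Subtype.val ⁻¹' Set.range e : Set ↥X) = (Subtype.val ⁻¹' (W ∪ ψ '' S))ᶜ := by
      rw [hrange]
      ext ⟨z, hz⟩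
      constructor
      · rintro ⟨x, y, hx, hy, rfl : z = _⟩ (hw | ⟨u, hu, hue⟩)
        · exact hcore x y hx hy hw
        · have hm : (x, y) ∈ obox V F (b / 2) b := ⟨hx, by change ‖y‖ < b; linarith⟩
          have := h.inj (hsub (hSb hu)) (hsub hm) hue
          rw [this] at hu
          exact absurd hu.2 (not_lt.2 hy)
      · intro hz'
        rcases hz with hw | ⟨⟨x, y⟩, ⟨hx, hy⟩, rfl⟩
        · exact absurd (Or.inl hw) hz'
        · refine ⟨x, y, hx, ?_, rfl⟩
          by_contra hlt
          exact hz' (Or.inr ⟨_, ⟨⟨hx, hy⟩, not_le.1 hlt⟩, rfl⟩)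
    rw [this]
    exact ((hWo.union (h.isOpen_image hS (hSb.trans hsub))).preimage
      continuous_subtype_val).isClosed_compl
  · have hlt : ‖(b / 4) • L y.1‖ < b := by rw [hn]; nlinarith [hyn y]
    change ψ (x.1, (b / 4) • L y.1) ∈ P ↔ _
    rw [hmemP _ _ (hBn x) hlt, hn]
    have := hyn y
    constructor
    · intro hh
      nlinarith
    · intro hh
      rw [hh, mul_one]

end Handle

section Morse
variable {M : Type} [MetricSpace M] {Φ : CFlow M}
variable {V F : Type} [NormedAddCommGroup V] [NormedSpace ℝ V]
  [NormedAddCommGroup F] [NormedSpace ℝ F]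

variable (Φ) in
/-- A flow decreasing `h` on the open set `N`, whose rest points of interest are linear saddles. -/
structure CFlow.MorseData (N : Set M) (h : M → ℝ) {ι : Type} (r : ℝ)
    (ψ : ι → V × F → M) (c : ι → ℝ) (e₀ : ℝ) : Prop where
  cont : Continuous h
  isOpen : IsOpen N
  fwd : Φ.Fwd N
  le : ∀ x, ∀ t, 0 ≤ t → h (Φ.toFun t x) ≤ h x
  pos : 0 < r
  chart : ∀ p, Φ.SaddleChart r (ψ p)
  sub : ∀ p, ψ p '' obox V F r r ⊆ N
  disj : ∀ p q, p ≠ q → Disjoint (ψ p '' obox V F r r) (ψ q '' obox V F r r)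
  lt : ∀ p, e₀ < c p
  est : ∀ p x y, ‖x‖ < r → ‖y‖ < r →
    |h (ψ p (x, y)) - c p - ‖x‖ ^ 2 + ‖y‖ ^ 2| ≤ (‖x‖ ^ 2 + ‖y‖ ^ 2) / 4
  absorb : ∀ s, 0 < s → s < r → ∀ x ∈ N, ∃ t, 0 ≤ t ∧
    (h (Φ.toFun t x) < e₀ ∨ ∃ p, Φ.toFun t x ∈ ψ p '' obox V F s s)

variable {N : Set M} {h : M → ℝ} {ι : Type} {r : ℝ} {ψ : ι → V × F → M} {c : ι → ℝ} {e₀ : ℝ}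

lemma CFlow.MorseData.fwd_sublevel (D : Φ.MorseData N h r ψ c e₀) (e : ℝ) :
    Φ.Fwd (N ∩ {x | h x < e}) := fun x hx t ht =>
  ⟨D.fwd x hx.1 t ht, (D.le x t ht).trans_lt hx.2⟩

lemma CFlow.MorseData.isOpen_sublevel (D : Φ.MorseData N h r ψ c e₀) (e : ℝ) :
    IsOpen (N ∩ {x | h x < e}) := D.isOpen.inter (isOpen_lt D.cont continuous_const)

lemma exists_small_pos [Finite ι] {r : ℝ} (hr : 0 < r) (u v : ι → ℝ) :
    ∃ b, 0 < b ∧ b < r ∧ ∀ p, u p < v p → u p + 5 * b ^ 2 < v p := by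
  have h1 : ∀ᶠ b : ℝ in 𝓝[>] 0, ∀ p, u p < v p → u p + 5 * b ^ 2 < v p := by
    rw [eventually_all]
    intro p
    by_cases hp : u p < v p
    · have : Tendsto (fun b : ℝ => u p + 5 * b ^ 2) (𝓝[>] 0) (𝓝 (u p)) := by
        have : Continuous fun b : ℝ => u p + 5 * b ^ 2 := by fun_prop
        have h2 := this.tendsto 0
        simp only [ne_eq, OfNat.ofNat_ne_zero, not_false_eq_true, zero_pow, mul_zero,
          add_zero] at h2
        exact h2.mono_left nhdsWithin_le_nhds
      filter_upwards [this.eventually_lt_const hp] with b hb _ using hb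
    · exact Eventually.of_forall fun b h => absurd h hp
  have h2 : ∀ᶠ b : ℝ in 𝓝[>] 0, b < r := mem_nhdsWithin_of_mem_nhds (Iio_mem_nhds hr)
  obtain ⟨b, ⟨hb1, hb2⟩, hb3⟩ := ((h1.and h2).and self_mem_nhdsWithin).exists
  exact ⟨b, hb3, hb2, hb1⟩

theorem CFlow.MorseData.hasEulerChar_sublevel (D : Φ.MorseData N h r ψ c e₀) [Fintype ι]
    {d : ℕ} (L : EuclideanSpace ℝ (Fin d) ≃ₗᵢ[ℝ] F) {a : ℤ}
    (ha : HasEulerChar ↥(N ∩ {x | h x < e₀}) a) (k : ℕ) :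
    ∀ e, e₀ ≤ e → (∀ p, c p ≠ e) → ({p | c p < e} : Set ι).ncard = k →
      HasEulerChar ↥(N ∩ {x | h x < e}) (a + (-1) ^ d * k) := by
  classical
  induction k using Nat.strong_induction_on with
  | _ k ih =>
  intro e he hne hk
  have hsq : ∀ {z b : ℝ}, 0 ≤ z → z < b → z ^ 2 < b ^ 2 := fun h1 h2 => by nlinarith
  by_cases hex : ∃ p, c p < e
  · obtain ⟨p₀, hp₀e, hp₀max⟩ : ∃ p₀, c p₀ < e ∧ ∀ q, c q < e → c q ≤ c p₀ := by
      obtain ⟨p, hp, hmax⟩ := (Finset.univ.filter fun p => c p < e).exists_max_image c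
        (by obtain ⟨p, hp⟩ := hex; exact ⟨p, by simpa using hp⟩)
      exact ⟨p, by simpa using hp, fun q hq => hmax q (by simpa using hq)⟩
    set C := c p₀ with hC
    obtain ⟨b, hb0, hbr, hb⟩ := exists_small_pos (ι := ι ⊕ ι ⊕ ι ⊕ ι) D.pos
      (Sum.elim c (Sum.elim (fun _ => e) (Sum.elim c fun _ => e₀)))
      (Sum.elim (fun _ => C) (Sum.elim c (Sum.elim (fun _ => e) c)))
    have hb1 : ∀ p, c p < C → c p + 5 * b ^ 2 < C := fun p => hb (.inl p)
    have hb2 : ∀ p, e < c p → e + 5 * b ^ 2 < c p := fun p => hb (.inr (.inl p))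
    have hb3 : ∀ p, c p < e → c p + 5 * b ^ 2 < e := fun p => hb (.inr (.inr (.inl p)))
    have hb4 : ∀ p, e₀ + 5 * b ^ 2 < c p := fun p => hb (.inr (.inr (.inr p))) (D.lt p)
    have hbb : 0 < b ^ 2 := by positivity
    set e' := C - b ^ 2 / 4 with he'
    have hCe : C + 5 * b ^ 2 < e := hb3 p₀ hp₀e
    have he0' : e₀ < e' := by have := hb4 p₀; linarith
    have hlt_iff : ∀ p, c p < e' ↔ c p < C := fun p =>
      ⟨fun hp => by linarith, fun hp => by have := hb1 p hp; linarith⟩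
    have hne' : ∀ p, c p ≠ e' := fun p hp => by
      have h1 : c p < C := by linarith
      have := hb1 p h1
      linarith
    set S : Finset ι := Finset.univ.filter fun p => c p = C
    have hcard : ({p | c p < e} : Set ι).ncard = ({p | c p < e'} : Set ι).ncard + S.card := by
      rw [← Set.ncard_coe_finset S, ← Set.ncard_union_eq]
      · congr 1
        ext p
        simp only [Set.mem_union, Set.mem_ofPred_eq, hlt_iff, S, Finset.coe_filter,
          Finset.mem_univ, true_and]
        constructor
        · intro hp; exact (hp₀max p hp).lt_or_eq
        · rintro (hp | hp) <;> linarith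
      · rw [Set.disjoint_left]
        intro p hp hp'
        simp only [Set.mem_ofPred_eq, hlt_iff, S, Finset.coe_filter, Finset.mem_univ,
          true_and] at hp hp'
        linarith
    have hScard : 0 < S.card := Finset.card_pos.2 ⟨p₀, by simp [S, hC]⟩
    have hA := ih _ (by omega) e' he0'.le hne' rfl
    set A := N ∩ {x | h x < e'} with hAdef
    let Wt : Finset ι → Set M := fun T => A ∪ ⋃ p ∈ T, ψ p '' obox V F (b / 2) b
    have hbox : ∀ p x y, ‖x‖ < b → ‖y‖ ≤ b → |h (ψ p (x, y)) - c p - ‖x‖ ^ 2 + ‖y‖ ^ 2| ≤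
        (‖x‖ ^ 2 + ‖y‖ ^ 2) / 4 := fun p x y hx hy => D.est p x y (by linarith) (by linarith)
    have hsubr : obox V F (b / 2) b ⊆ obox V F r r := obox_mono (by linarith) hbr.le
    have hWt : ∀ T ⊆ S, IsOpen (Wt T) ∧ Φ.Fwd (Wt T) ∧ HasEulerChar ↥(Wt T)
        (a + (-1) ^ d * ({p | c p < e'} : Set ι).ncard + (-1) ^ d * T.card) := by
      intro T
      induction T using Finset.induction_on with
      | empty =>
        intro _
        have : Wt ∅ = A := by simp [Wt]
        rw [this]
        exact ⟨D.isOpen_sublevel _, D.fwd_sublevel _, by simpa using hA⟩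
      | insert p T hpT hT =>
        intro hTS
        obtain ⟨h1, h2, h3⟩ := hT ((Finset.subset_insert _ _).trans hTS)
        have hpC : c p = C := by
          have := hTS (Finset.mem_insert_self p T)
          simpa [S] using this
        have hW : Wt (insert p T) = Wt T ∪ ψ p '' obox V F (b / 2) b := by
          simp only [Wt, Finset.set_biUnion_insert]
          rw [Set.union_assoc, Set.union_comm (ψ p '' _)]
        have hexit : ∀ x y, ‖x‖ < b / 2 → ‖y‖ = b → ψ p (x, y) ∈ Wt T := by
          intro x y hx hy
          refine Or.inl ⟨D.sub p ⟨(x, y), ⟨by change ‖x‖ < r; linarith, by change ‖y‖ < r; linarith⟩, rfl⟩, ?_⟩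
          have h4 := (abs_le.1 (hbox p x y (by linarith) hy.le)).2
          have h5 := hsq (norm_nonneg x) hx
          rw [hy, hpC] at h4
          change h (ψ p (x, y)) < e'
          nlinarith
        have hcore : ∀ x y, ‖x‖ < b / 2 → ‖y‖ ≤ b / 4 → ψ p (x, y) ∉ Wt T := by
          rintro x y hx hy (hz | hz)
          · have h4 := (abs_le.1 (hbox p x y (by linarith) (by linarith))).1
            have h5 : ‖y‖ ^ 2 ≤ (b / 4) ^ 2 := by have := norm_nonneg y; nlinarith
            have h6 : h (ψ p (x, y)) < e' := hz.2
            have h7 := sq_nonneg ‖x‖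
            rw [hpC] at h4
            nlinarith
          · simp only [Set.mem_iUnion] at hz
            obtain ⟨q, hq, hz⟩ := hz
            have hqp : p ≠ q := fun hh => hpT (hh ▸ hq)
            exact Set.disjoint_left.1 (D.disj p q hqp)
              ⟨(x, y), ⟨by change ‖x‖ < r; linarith, by change ‖y‖ < r; linarith⟩, rfl⟩
              (Set.image_mono hsubr hz)
        rw [hW]
        refine ⟨h1.union ((D.chart p).isOpen_image (isOpen_obox _ _) hsubr),
          (D.chart p).fwd_union h2 hbr hb0 hexit, ?_⟩
        have := (D.chart p).hasEulerChar_union L h2 h1 hbr hb0 hexit hcore h3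
        rw [Finset.card_insert_of_notMem hpT]
        convert this using 1
        push_cast
        ring
    obtain ⟨h1, h2, h3⟩ := hWt S subset_rfl
    have hWsub : Wt S ⊆ N ∩ {x | h x < e} := by
      rintro z (hz | hz)
      · exact ⟨hz.1, by have : h z < e' := hz.2; change h z < e; linarith⟩
      · simp only [Set.mem_iUnion] at hz
        obtain ⟨q, hq, ⟨x, y⟩, ⟨hx, hy⟩, rfl⟩ := hz
        have hqC : c q = C := by simpa [S] using hq
        refine ⟨D.sub q ⟨(x, y), hsubr ⟨hx, hy⟩, rfl⟩, ?_⟩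
        change ‖x‖ < b / 2 at hx
        change ‖y‖ < b at hy
        have h4 := (abs_le.1 (hbox q x y (by linarith) hy.le)).2
        have h5 := hsq (norm_nonneg x) hx
        have h6 := sq_nonneg ‖y‖
        rw [hqC] at h4
        change h (ψ q (x, y)) < e
        nlinarith
    have := Φ.hasEulerChar_of_absorbing (D.fwd_sublevel e) h2 hWsub
      ⟨Wt S, h1, Set.inter_eq_left.2 hWsub⟩ (fun x hx => ?_) h3
    · convert this using 1
      rw [← hk, hcard]
      push_cast
      ring
    · obtain ⟨t, ht, hh⟩ := D.absorb (b / 2) (by linarith) (by linarith) x hx.1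
      refine ⟨t, ht, ?_⟩
      rcases hh with hh | ⟨p, ⟨u, w⟩, ⟨hu, hw⟩, hp⟩
      · exact Or.inl ⟨D.fwd x hx.1 t ht, hh.trans he0'⟩
      · change ‖u‖ < b / 2 at hu
        change ‖w‖ < b / 2 at hw
        have h4 := abs_le.1 (hbox p u w (by linarith) (by linarith))
        rw [hp] at h4
        have h5 := hsq (norm_nonneg u) hu
        have h6 := hsq (norm_nonneg w) hw
        have h7 := sq_nonneg ‖u‖
        have h8 := sq_nonneg ‖w‖
        rcases lt_trichotomy (c p) C with h9 | h9 | h9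
        · refine Or.inl ⟨D.fwd x hx.1 t ht, ?_⟩
          have := hb1 p h9
          change h (Φ.toFun t x) < e'
          nlinarith
        · refine Or.inr (Set.mem_biUnion (x := p) (by simp [S, h9]) ?_)
          exact ⟨(u, w), ⟨hu, by change ‖w‖ < b; linarith⟩, hp⟩
        · exfalso
          have h10 : e < c p := by
            rcases lt_trichotomy (c p) e with h11 | h11 | h11
            · exact absurd (hp₀max p h11) (not_le.2 h9)
            · exact absurd h11 (hne p)
            · exact h11
          have h11 := hb2 p h10
          have h12 := D.le x t ht
          have h13 : h x < e := hx.2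
          nlinarith
  · have hk0 : k = 0 := by
      rw [← hk]
      have : ({p | c p < e} : Set ι) = ∅ := by
        ext p; simp only [Set.mem_ofPred_eq, Set.mem_empty_iff_false, iff_false]
        exact fun hp => hex ⟨p, hp⟩
      rw [this, Set.ncard_empty]
    obtain ⟨b, hb0, hbr, hb⟩ := exists_small_pos D.pos (fun _ => e) c
    have hsub : N ∩ {x | h x < e₀} ⊆ N ∩ {x | h x < e} := fun x hx =>
      ⟨hx.1, lt_of_lt_of_le (show h x < e₀ from hx.2) he⟩
    have := Φ.hasEulerChar_of_absorbing (D.fwd_sublevel e) (D.fwd_sublevel e₀) hsub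
      ⟨_, D.isOpen_sublevel e₀, Set.inter_eq_left.2 hsub⟩ (fun x hx => ?_) ha
    · simpa [hk0] using this
    · obtain ⟨t, ht, hh⟩ := D.absorb b hb0 hbr x hx.1
      refine ⟨t, ht, D.fwd x hx.1 t ht, ?_⟩
      rcases hh with hh | ⟨p, ⟨u, w⟩, ⟨hu, hw⟩, hp⟩
      · exact hh
      · exfalso
        change ‖u‖ < b at hu
        change ‖w‖ < b at hw
        have h4 := (abs_le.1 (D.est p u w (by linarith) (by linarith))).1
        rw [hp] at h4
        have h6 := hsq (norm_nonneg w) hw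
        have h7 := sq_nonneg ‖u‖
        have h8 := D.le x t ht
        have h9 : h x < e := hx.2
        have h10 : e < c p := lt_of_le_of_ne (not_lt.1 fun hp => hex ⟨p, hp⟩) (hne p).symm
        have := hb p h10
        nlinarith

theorem CFlow.MorseData.hasEulerChar (D : Φ.MorseData N h r ψ c e₀) [Fintype ι]
    {d : ℕ} (L : EuclideanSpace ℝ (Fin d) ≃ₗᵢ[ℝ] F) {a : ℤ}
    (ha : HasEulerChar ↥(N ∩ {x | h x < e₀}) a) :
    HasEulerChar ↥N (a + (-1) ^ d * Fintype.card ι) := by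
  have hr := D.pos
  obtain ⟨B, hB⟩ := (Set.finite_range c).bddAbove
  have hB' : ∀ p, c p ≤ B := fun p => hB ⟨p, rfl⟩
  set e := max e₀ (B + 5 * r ^ 2) with he
  have hce : ∀ p, c p + 5 * r ^ 2 ≤ e := fun p =>
    le_trans (by linarith [hB' p]) (le_max_right _ _)
  have hr2 : 0 < r ^ 2 := by positivity
  have hlt : ∀ p, c p < e := fun p => by linarith [hce p]
  have h1 := D.hasEulerChar_sublevel L ha _ e (le_max_left _ _) (fun p => (hlt p).ne) rfl
  have hcard : ({p | c p < e} : Set ι).ncard = Fintype.card ι := by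
    have : ({p | c p < e} : Set ι) = Set.univ := by
      ext p; simpa using hlt p
    rw [this, Set.ncard_univ, Nat.card_eq_fintype_card]
  rw [hcard] at h1
  refine Φ.hasEulerChar_of_absorbing D.fwd (D.fwd_sublevel e) Set.inter_subset_left
    ⟨_, D.isOpen_sublevel e, Set.inter_eq_left.2 Set.inter_subset_left⟩ (fun x hx => ?_) h1
  obtain ⟨t, ht, hh⟩ := D.absorb (r / 2) (by linarith) (by linarith) x hx
  refine ⟨t, ht, D.fwd x hx t ht, ?_⟩
  rcases hh with hh | ⟨p, ⟨u, w⟩, ⟨hu, hw⟩, hp⟩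
  · exact lt_of_lt_of_le hh (le_max_left _ _)
  · change ‖u‖ < r / 2 at hu
    change ‖w‖ < r / 2 at hw
    have h4 := (abs_le.1 (D.est p u w (by linarith) (by linarith))).2
    rw [hp] at h4
    have h6 := norm_nonneg u
    have h8 := sq_nonneg ‖w‖
    have := hce p
    change h (Φ.toFun t x) < e
    nlinarith

end Morse

section

open scoped ContDiff

section PolyCalculus
variable {n : ℕ}

/-- The differential of a polynomial as a continuous linear functional. -/
def pd (p : MvPolynomial (Fin n) ℂ) (x : Fin n → ℂ) : (Fin n → ℂ) →L[ℂ] ℂ :=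
  ∑ i, MvPolynomial.eval x (MvPolynomial.pderiv i p) • ContinuousLinearMap.proj i

lemma pd_apply (p : MvPolynomial (Fin n) ℂ) (x w : Fin n → ℂ) :
    pd p x w = ∑ i, MvPolynomial.eval x (MvPolynomial.pderiv i p) * w i := by
  simp [pd]

lemma diffAt_apply (p : MvPolynomial (Fin n) ℂ) (x w : Fin n → ℂ) :
    diffAt p x w = pd p x w := by
  simp [pd, diffAt]

lemma mem_zTangent {Y : Set (Fin n → ℂ)} {x w : Fin n → ℂ} :
    w ∈ zTangent Y x ↔ ∀ p : MvPolynomial (Fin n) ℂ,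
      (∀ y ∈ Y, MvPolynomial.eval y p = 0) → pd p x w = 0 := by
  simp [zTangent, Submodule.mem_iInf, LinearMap.mem_ker, diffAt_apply]

lemma contDiff_eval (p : MvPolynomial (Fin n) ℂ) {N : WithTop ℕ∞} :
    ContDiff ℂ N fun x : Fin n → ℂ => MvPolynomial.eval x p := by
  have h : AnalyticOnNhd ℂ (fun x : Fin n → ℂ => MvPolynomial.eval x p) Set.univ :=
    AnalyticOnNhd.eval_mvPolynomial p
  exact h.contDiff

lemma hasFDerivAt_eval (p : MvPolynomial (Fin n) ℂ) (x : Fin n → ℂ) :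
    HasFDerivAt (fun x : Fin n → ℂ => MvPolynomial.eval x p) (pd p x) x := by
  induction p using MvPolynomial.induction_on with
  | C a =>
    have : pd (MvPolynomial.C a) x = 0 := by ext; simp [pd_apply]
    rw [this]
    simpa using hasFDerivAt_const (𝕜 := ℂ) a x
  | add p q hp hq =>
    have : pd (p + q) x = pd p x + pd q x := by
      ext; simp [pd_apply, add_mul, Finset.sum_add_distrib]
    rw [this]
    exact (hp.add hq).congr_of_eventuallyEq (Eventually.of_forall fun y => by simp)
  | mul_X p i hp =>
    have h2 : HasFDerivAt (fun x : Fin n → ℂ => x i)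
        (ContinuousLinearMap.proj i : (Fin n → ℂ) →L[ℂ] ℂ) x := by
      exact (ContinuousLinearMap.proj i : (Fin n → ℂ) →L[ℂ] ℂ).hasFDerivAt
    have h3 : pd (p * MvPolynomial.X i) x = MvPolynomial.eval x p •
        (ContinuousLinearMap.proj i : (Fin n → ℂ) →L[ℂ] ℂ) + x i • pd p x := by
      refine ContinuousLinearMap.ext fun w => ?_
      simp only [pd_apply, Derivation.leibniz, MvPolynomial.pderiv_X, add_apply,
        smul_apply, smul_eq_mul, map_add, map_mul, MvPolynomial.eval_X,
        ContinuousLinearMap.proj_apply, add_mul, Finset.sum_add_distrib, Finset.mul_sum]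
      congr 1
      · rw [Finset.sum_eq_single i]
        · simp
        · intro j _ hj; simp [hj.symm]
        · simp
      · exact Finset.sum_congr rfl fun j _ => by ring
    rw [h3]
    exact (hp.mul h2).congr_of_eventuallyEq (Eventually.of_forall fun y => by simp)

lemma fderiv_eval (p : MvPolynomial (Fin n) ℂ) (x : Fin n → ℂ) :
    fderiv ℂ (fun x : Fin n → ℂ => MvPolynomial.eval x p) x = pd p x :=
  (hasFDerivAt_eval p x).fderiv

lemma contDiff_pd (p : MvPolynomial (Fin n) ℂ) {N : WithTop ℕ∞} : ContDiff ℂ N (pd p) := by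
  unfold pd
  exact ContDiff.sum fun i _ => (contDiff_eval _).smul contDiff_const

end PolyCalculus

/-- Algebraic sets which are locally regular zero loci of `m` polynomials vanishing on the set. -/
def Sm {n : ℕ} (Y : Set (Fin n → ℂ)) (m : ℕ) : Prop :=
  IsAlgSet Y ∧ ∀ p ∈ Y, ∃ G : Fin m → MvPolynomial (Fin n) ℂ,
    (∀ j, ∀ y ∈ Y, MvPolynomial.eval y (G j) = 0) ∧ LinearIndependent ℂ (fun j => pd (G j) p) ∧
    ∃ O ∈ 𝓝 p, ∀ y ∈ O, (∀ j, MvPolynomial.eval y (G j) = 0) → y ∈ Y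

/-- A smooth holomorphic chart of `Y` around `p`. -/
structure Chart {n : ℕ} (Y : Set (Fin n → ℂ)) (d : ℕ) (p : Fin n → ℂ) where
  ψ : (Fin d → ℂ) → (Fin n → ℂ)
  L : (Fin n → ℂ) →L[ℂ] (Fin d → ℂ)
  U : Set (Fin d → ℂ)
  O : Set (Fin n → ℂ)
  isOpen_U : IsOpen U
  isOpen_O : IsOpen O
  zero_mem : 0 ∈ U
  base_mem : p ∈ O
  map_zero : ψ 0 = p
  smooth : ContDiffOn ℂ ω ψ U
  mem : ∀ u ∈ U, ψ u ∈ Y ∩ O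
  left : ∀ u ∈ U, L (ψ u - p) = u
  right : ∀ y ∈ Y ∩ O, L (y - p) ∈ U ∧ ψ (L (y - p)) = y
  tan : ∀ u ∈ U, ∀ a, fderiv ℂ ψ u a ∈ zTangent Y (ψ u)
  tan' : ∀ u ∈ U, ∀ w ∈ zTangent Y (ψ u), fderiv ℂ ψ u (L w) = w

lemma exists_complement_coordinates {E : Type} [NormedAddCommGroup E] [NormedSpace ℂ E]
    [FiniteDimensional ℂ E] {m d : ℕ} (D : E →L[ℂ] (Fin m → ℂ)) (hD : Function.Surjective D)
    (hd : d + m = Module.finrank ℂ E) :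
    ∃ (L : E →L[ℂ] (Fin d → ℂ)) (A : E ≃L[ℂ] (Fin d → ℂ) × (Fin m → ℂ)),
      (A : E →L[ℂ] (Fin d → ℂ) × (Fin m → ℂ)) = L.prod D := by
  have hk : Module.finrank ℂ (LinearMap.ker (D : E →ₗ[ℂ] (Fin m → ℂ))) = d := by
    have h1 := LinearMap.finrank_range_add_finrank_ker (D : E →ₗ[ℂ] (Fin m → ℂ))
    have h2 : LinearMap.range (D : E →ₗ[ℂ] (Fin m → ℂ)) = ⊤ := LinearMap.range_eq_top.2 hD
    rw [h2, finrank_top, Module.finrank_fin_fun] at h1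
    omega
  let e : LinearMap.ker (D : E →ₗ[ℂ] (Fin m → ℂ)) ≃ₗ[ℂ] (Fin d → ℂ) :=
    LinearEquiv.ofFinrankEq _ _ (by rw [hk, Module.finrank_fin_fun])
  obtain ⟨L, hL⟩ := LinearMap.exists_extend e.toLinearMap
  have hinj : Function.Injective (L.prod (D : E →ₗ[ℂ] (Fin m → ℂ))) := by
    rw [← LinearMap.ker_eq_bot, LinearMap.ker_eq_bot']
    intro w hw
    have h1 : L w = 0 := congrArg Prod.fst hw
    have h2 : D w = 0 := congrArg Prod.snd hw
    have h3 : e ⟨w, h2⟩ = 0 := by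
      rw [← h1]; exact (LinearMap.congr_fun hL ⟨w, h2⟩).symm
    have := e.map_eq_zero_iff.1 h3
    exact congrArg Subtype.val this
  let A₀ := LinearMap.linearEquivOfInjective _ hinj (by
    rw [Module.finrank_prod, Module.finrank_fin_fun, Module.finrank_fin_fun, hd])
  refine ⟨LinearMap.toContinuousLinearMap L, A₀.toContinuousLinearEquiv, ?_⟩
  ext w <;> rfl

lemma surjective_pi_of_linearIndependent {E : Type} [NormedAddCommGroup E] [NormedSpace ℂ E]
    {m : ℕ} {f : Fin m → E →L[ℂ] ℂ} (hLI : LinearIndependent ℂ f) :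
    Function.Surjective (ContinuousLinearMap.pi f) := by
  have : LinearMap.range (ContinuousLinearMap.pi f : E →ₗ[ℂ] (Fin m → ℂ)) = ⊤ := by
    by_contra hne
    obtain ⟨φ, hφ0, hφ⟩ := Submodule.exists_le_ker_of_lt_top _ (lt_top_iff_ne_top.2 hne)
    apply hφ0
    have h1 : ∑ j, φ (Pi.single j 1) • f j = 0 := by
      ext w
      have h2 : φ (ContinuousLinearMap.pi f w) = 0 := hφ ⟨w, rfl⟩
      rw [LinearMap.pi_apply_eq_sum_univ φ] at h2
      simp only [sum_apply, smul_apply, smul_eq_mul,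
        zero_apply]
      rw [← h2]
      refine Finset.sum_congr rfl fun j _ => ?_
      rw [smul_eq_mul, mul_comm]
      congr 1
      congr 1
      ext k
      simp [Pi.single_apply, eq_comm]
    have h2 := Fintype.linearIndependent_iff.1 hLI _ h1
    refine LinearMap.pi_ext' fun j => ?_
    ext
    simpa using h2 j
  exact LinearMap.range_eq_top.1 this

theorem Sm.nonempty_chart {n m d : ℕ} {Y : Set (Fin n → ℂ)} (hY : Sm Y m) (hd : d + m = n)
    {p : Fin n → ℂ} (hp : p ∈ Y) : Nonempty (Chart Y d p) := by
  obtain ⟨G, hG, hLI, O₀, hO₀, hGY⟩ := hY.2 p hp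
  obtain ⟨O₁, hO₁sub, hO₁, hpO₁⟩ := mem_nhds_iff.1 hO₀
  let D : (Fin n → ℂ) → (Fin n → ℂ) →L[ℂ] (Fin m → ℂ) := fun x =>
    ContinuousLinearMap.pi fun j => pd (G j) x
  have hDs : Function.Surjective (D p) := surjective_pi_of_linearIndependent hLI
  obtain ⟨L, A, hA⟩ := exists_complement_coordinates (d := d) (D p) hDs (by
    rw [Module.finrank_fin_fun, hd])
  let Ψ : (Fin n → ℂ) → (Fin d → ℂ) × (Fin m → ℂ) := fun x =>
    (L (x - p), fun j => MvPolynomial.eval x (G j))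
  have hΨd : ∀ x, HasFDerivAt Ψ (L.prod (D x)) x := fun x => by
    refine HasFDerivAt.prodMk ?_ (hasFDerivAt_pi.2 fun j => hasFDerivAt_eval _ _)
    exact L.hasFDerivAt.comp x ((hasFDerivAt_id x).sub_const p)
  have hΨs : ContDiff ℂ ω Ψ :=
    ContDiff.prodMk (L.contDiff.comp (contDiff_id.sub contDiff_const))
      (contDiff_pi.2 fun j => contDiff_eval _)
  have hΨp : HasFDerivAt Ψ (A : (Fin n → ℂ) →L[ℂ] (Fin d → ℂ) × (Fin m → ℂ)) p := hA ▸ hΨd p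
  have hω : (ω : WithTop ℕ∞) ≠ 0 := by simp
  let H := hΨs.contDiffAt.toOpenPartialHomeomorph Ψ hΨp hω
  have hHp : p ∈ H.source := hΨs.contDiffAt.mem_toOpenPartialHomeomorph_source hΨp hω
  have hHcoe : ∀ x, H x = Ψ x := fun x => rfl
  have hΨp0 : Ψ p = (0, 0) := by
    refine Prod.ext ?_ ?_
    · simp [Ψ]
    · ext j; exact hG j p hp
  have hsymm0 : H.symm (0, 0) = p := by rw [← hΨp0]; exact H.left_inv hHp
  have hsm : ContDiffAt ℂ ω H.symm (0, 0) := by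
    have := hΨs.contDiffAt.to_localInverse hΨp hω
    rw [hΨp0] at this
    exact this
  have h00 : (0, 0) ∈ H.target := by rw [← hΨp0]; exact H.map_source hHp
  obtain ⟨T, hTsub, hTo, hT0⟩ := mem_nhds_iff.1
    ((hsm.eventually (by simp)).and (H.open_target.mem_nhds h00))
  have hT1 : ∀ q ∈ T, ContDiffAt ℂ ω H.symm q := fun q hq => (hTsub hq).1
  have hT2 : T ⊆ H.target := fun q hq => (hTsub hq).2
  let O : Set (Fin n → ℂ) := (H.source ∩ H ⁻¹' T) ∩ O₁
  have hOo : IsOpen O := (H.isOpen_inter_preimage hTo).inter hO₁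
  let ι : (Fin d → ℂ) → (Fin d → ℂ) × (Fin m → ℂ) := fun u => (u, 0)
  have hι : ContDiff ℂ ω ι := contDiff_id.prodMk contDiff_const
  let T' : Set ((Fin d → ℂ) × (Fin m → ℂ)) := T ∩ H.symm ⁻¹' O₁
  have hT'o : IsOpen T' := by
    rw [isOpen_iff_mem_nhds]
    intro q hq
    exact inter_mem (hTo.mem_nhds hq.1) ((hT1 q hq.1).continuousAt (hO₁.mem_nhds hq.2))
  let U := ι ⁻¹' T'
  have hUo : IsOpen U := hT'o.preimage hι.continuous
  have hinv : ∀ u ∈ U, Ψ (H.symm (ι u)) = ι u := fun u hu => H.right_inv (hT2 hu.1)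
  have hmem : ∀ u ∈ U, H.symm (ι u) ∈ Y ∩ O := by
    intro u hu
    refine ⟨hGY _ (hO₁sub hu.2) fun j => congrFun (congrArg Prod.snd (hinv u hu)) j,
      ⟨H.map_target (hT2 hu.1), ?_⟩, hu.2⟩
    change Ψ (H.symm (ι u)) ∈ T
    rw [hinv u hu]; exact hu.1
  have hψs : ∀ u ∈ U, ContDiffAt ℂ ω (fun u => H.symm (ι u)) u := fun u hu =>
    (hT1 _ hu.1).comp u hι.contDiffAt
  refine ⟨{ ψ := fun u => H.symm (ι u), L := L, U := U, O := O, isOpen_U := hUo, isOpen_O := hOo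
            zero_mem := ⟨hT0, by change H.symm (0, 0) ∈ O₁; rwa [hsymm0]⟩
            base_mem := ⟨⟨hHp, by change Ψ p ∈ T; rwa [hΨp0]⟩, hpO₁⟩
            map_zero := hsymm0
            smooth := fun u hu => (hψs u hu).contDiffWithinAt
            mem := hmem
            left := fun u hu => congrArg Prod.fst (hinv u hu)
            right := ?_
            tan := ?_
            tan' := ?_ }⟩
  · rintro y ⟨hyY, ⟨hyS, hyT⟩, hyO⟩
    have h1 : Ψ y = ι (L (y - p)) := Prod.ext rfl (funext fun j => hG j y hyY)
    have h2 : H.symm (ι (L (y - p))) = y := by rw [← h1]; exact H.left_inv hyS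
    refine ⟨⟨?_, ?_⟩, h2⟩
    · rw [← h1]; exact hyT
    · change H.symm _ ∈ O₁
      rwa [h2]
  · intro u hu a
    rw [mem_zTangent]
    intro q hq
    have h1 := (hasFDerivAt_eval q (H.symm (ι u))).comp u
      ((hψs u hu).differentiableAt hω).hasFDerivAt
    have h2 : (fun x : Fin n → ℂ => MvPolynomial.eval x q) ∘ (fun u => H.symm (ι u)) =ᶠ[𝓝 u]
        fun _ => 0 := by
      filter_upwards [hUo.mem_nhds hu] with v hv using hq _ (hmem v hv).1
    have h3 := (h1.congr_of_eventuallyEq h2.symm).unique (hasFDerivAt_const (0:ℂ) u)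
    exact DFunLike.congr_fun h3 a
  · intro u hu w hw
    rw [mem_zTangent] at hw
    set x := H.symm (ι u) with hx
    have hxS : x ∈ H.source := H.map_target (hT2 hu.1)
    have hHx : H x = ι u := hinv u hu
    have h1 : HasFDerivAt H.symm (fderiv ℂ H.symm (ι u)) (ι u) :=
      ((hT1 _ hu.1).differentiableAt hω).hasFDerivAt
    have h2 : HasFDerivAt (H.symm ∘ Ψ) ((fderiv ℂ H.symm (ι u)).comp (L.prod (D x))) x := by
      refine HasFDerivAt.comp x ?_ (hΨd x)
      rw [← hHcoe, hHx]; exact h1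
    have h3 : H.symm ∘ Ψ =ᶠ[𝓝 x] id := by
      filter_upwards [H.open_source.mem_nhds hxS] with y hy using H.left_inv hy
    have h4 := (h2.congr_of_eventuallyEq h3.symm).unique (hasFDerivAt_id x)
    have h5 := DFunLike.congr_fun h4 w
    have h6 : D x w = 0 := funext fun j => hw (G j) (hG j)
    have h7 : (L.prod (D x)) w = ι (L w) := Prod.ext rfl h6
    have h8 : HasFDerivAt ι (ContinuousLinearMap.inl ℂ (Fin d → ℂ) (Fin m → ℂ)) u :=
      (ContinuousLinearMap.inl ℂ (Fin d → ℂ) (Fin m → ℂ)).hasFDerivAt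
    have h9 : HasFDerivAt (fun u => H.symm (ι u)) _ u := h1.comp u h8
    rw [h9.fderiv]
    change fderiv ℂ H.symm (ι u) (ι (L w)) = w
    rw [← h7]
    exact h5

end

section

open scoped ContDiff

section Flow
variable {E : Type} [NormedAddCommGroup E] [NormedSpace ℝ E] [ProperSpace E]

lemma exists_lipschitzOnWith_closedBall {v : E → E} (hv : ContDiff ℝ 1 v) (R : ℝ) :
    ∃ K, LipschitzOnWith K v (Metric.closedBall 0 R) :=
  hv.contDiffOn.exists_lipschitzOnWith one_ne_zero (convex_closedBall _ _)
    (isCompact_closedBall _ _)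

lemma integralCurve_unique {v : E → E} (hv : ContDiff ℝ 1 v) {a b t₀ : ℝ} (ht₀ : t₀ ∈ Set.Ioo a b)
    {γ γ' : ℝ → E} (h : ∀ t ∈ Set.Ioo a b, HasDerivAt γ (v (γ t)) t)
    (h' : ∀ t ∈ Set.Ioo a b, HasDerivAt γ' (v (γ' t)) t) (e : γ t₀ = γ' t₀) :
    Set.EqOn γ γ' (Set.Ioo a b) := by
  intro t ht
  obtain ⟨a', ha', ha''⟩ := exists_between (lt_min ht.1 ht₀.1)
  obtain ⟨b', hb', hb''⟩ := exists_between (max_lt ht.2 ht₀.2)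
  have hsub : Set.Icc a' b' ⊆ Set.Ioo a b := fun s hs => ⟨ha'.trans_le hs.1, hs.2.trans_lt hb''⟩
  have hc : ContinuousOn γ (Set.Icc a' b') := fun s hs =>
    (h s (hsub hs)).continuousAt.continuousWithinAt
  have hc' : ContinuousOn γ' (Set.Icc a' b') := fun s hs =>
    (h' s (hsub hs)).continuousAt.continuousWithinAt
  obtain ⟨R, hR⟩ := (((isCompact_Icc.image_of_continuousOn hc).union
    (isCompact_Icc.image_of_continuousOn hc')).isBounded).subset_closedBall (0 : E)
  obtain ⟨K, hK⟩ := exists_lipschitzOnWith_closedBall hv R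
  refine ODE_solution_unique_of_mem_Ioo (v := fun _ => v) (s := fun _ => Metric.closedBall 0 R)
    (fun _ _ => hK) (t₀ := t₀) (a := a') (b := b')
    ⟨ha''.trans_le (min_le_right _ _), (le_max_right _ _).trans_lt hb'⟩
    (fun s hs => ⟨h s (hsub (Set.Ioo_subset_Icc_self hs)), hR (Or.inl ⟨s, Set.Ioo_subset_Icc_self hs, rfl⟩)⟩)
    (fun s hs => ⟨h' s (hsub (Set.Ioo_subset_Icc_self hs)), hR (Or.inr ⟨s, Set.Ioo_subset_Icc_self hs, rfl⟩)⟩)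
    e ⟨ha''.trans_le (min_le_left _ _), (le_max_left _ _).trans_lt hb'⟩

/-- The flow of a vector field. -/
def CFlow.IsFlowOf (Φ : CFlow E) (v : E → E) : Prop :=
  ∀ x t, HasDerivAt (fun t => Φ.toFun t x) (v (Φ.toFun t x)) t

theorem exists_flow {v : E → E} (hv : ContDiff ℝ 1 v) {C : ℝ} (hC : ∀ x, ‖v x‖ ≤ C) :
    ∃ Φ : CFlow E, Φ.IsFlowOf v := by
  have hC0 : 0 ≤ C := (norm_nonneg _).trans (hC 0)
  have key : ∀ N : ℕ, ∃ α : E × ℝ → E, (∀ x ∈ Metric.ball (0:E) (N + 1), α (x, 0) = x ∧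
      ∀ t ∈ Set.Ioo (-(N + 1) : ℝ) (N + 1), HasDerivAt (fun t => α (x, t)) (v (α (x, t))) t) ∧
      ContinuousOn α (Metric.ball (0:E) (N + 1) ×ˢ Set.Ioo (-(N + 1) : ℝ) (N + 1)) := by
    intro N
    have hN : (0:ℝ) ≤ N + 1 := by positivity
    obtain ⟨K, hK⟩ := exists_lipschitzOnWith_closedBall hv ((N + 1) + C * (N + 1))
    have hpl : IsPicardLindelof (fun _ => v) (tmin := -(N + 1)) (tmax := N + 1)
        ⟨0, by constructor <;> linarith⟩ (0 : E) ⟨(N + 1) + C * (N + 1), by positivity⟩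
        ⟨N + 1, hN⟩ ⟨C, hC0⟩ K := by
      refine IsPicardLindelof.of_time_independent (fun x _ => hC x) hK ?_
      change C * max ((N + 1 : ℝ) - 0) (0 - -(N + 1 : ℝ)) ≤ (N + 1 + C * (N + 1)) - (N + 1 : ℝ)
      simp
    obtain ⟨α, h1, h2⟩ := hpl.exists_forall_mem_closedBall_eq_hasDerivWithinAt_continuousOn
    refine ⟨α, fun x hx => ?_, h2.mono (Set.prod_mono Metric.ball_subset_closedBall
      Set.Ioo_subset_Icc_self)⟩
    obtain ⟨h3, h4⟩ := h1 x (Metric.ball_subset_closedBall hx)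
    exact ⟨h3, fun t ht => (h4 t (Set.Ioo_subset_Icc_self ht)).hasDerivAt (Icc_mem_nhds ht.1 ht.2)⟩
  choose α hα hαc using key
  have hcons : ∀ (M N : ℕ) (x : E) (t : ℝ), M ≤ N → ‖x‖ < M + 1 → |t| < M + 1 → α M (x, t) = α N (x, t) := by
    intro M N x t hMN hx ht
    have hMN' : (M:ℝ) ≤ N := by exact_mod_cast hMN
    have hM : (0:ℝ) < M + 1 := by positivity
    have h1 := hα M x (by simpa using hx)
    have h2 := hα N x (by simp; linarith)
    refine integralCurve_unique hv (t₀ := 0) (a := -(M + 1)) (b := M + 1) ⟨by linarith, hM⟩ h1.2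
      (fun t ht => h2.2 t ⟨by linarith [ht.1], by linarith [ht.2]⟩) (h1.1.trans h2.1.symm)
      (abs_lt.1 ht)
  let N : E → ℝ → ℕ := fun x t => ⌈max ‖x‖ |t|⌉₊
  have hNx : ∀ x t, ‖x‖ < N x t + 1 := fun x t =>
    ((le_max_left _ _).trans (Nat.le_ceil _)).trans_lt (lt_add_one _)
  have hNt : ∀ x t, |t| < N x t + 1 := fun x t =>
    ((le_max_right _ _).trans (Nat.le_ceil _)).trans_lt (lt_add_one _)
  let φ : ℝ → E → E := fun t x => α (N x t) (x, t)
  have hφ : ∀ (M : ℕ) (x : E) (t : ℝ), ‖x‖ < M + 1 → |t| < M + 1 → φ t x = α M (x, t) := by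
    intro M x t hx ht
    rcases le_total M (N x t) with h | h
    · exact (hcons M _ x t h hx ht).symm
    · exact hcons _ M x t h (hNx x t) (hNt x t)
  have hφ0 : ∀ x, φ 0 x = x := fun x => (hα _ x (by simpa using hNx x 0)).1
  have hφd : ∀ x t, HasDerivAt (fun t => φ t x) (v (φ t x)) t := by
    intro x t
    have h1 := (hα (N x t) x (by simpa using hNx x t)).2 t (abs_lt.1 (hNt x t))
    refine h1.congr_of_eventuallyEq ?_
    filter_upwards [isOpen_Ioo.mem_nhds (abs_lt.1 (hNt x t))] with s hs
    exact hφ _ x s (hNx x t) (abs_lt.2 hs)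
  refine ⟨⟨φ, ?_, hφ0, ?_⟩, hφd⟩
  · rw [continuous_iff_continuousAt]
    rintro ⟨t, x⟩
    have h1 : ContinuousAt (α (N x t)) (x, t) := (hαc (N x t)).continuousAt
      (prod_mem_nhds (Metric.isOpen_ball.mem_nhds (by simpa using hNx x t))
        (isOpen_Ioo.mem_nhds (abs_lt.1 (hNt x t))))
    have h2 : ContinuousAt (fun p : ℝ × E => α (N x t) (p.2, p.1)) (t, x) :=
      ContinuousAt.comp (f := fun p : ℝ × E => (p.2, p.1)) h1 (by fun_prop)
    refine h2.congr ?_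
    have h3 : {p : ℝ × E | ‖p.2‖ < N x t + 1 ∧ |p.1| < N x t + 1} ∈ 𝓝 (t, x) := by
      refine IsOpen.mem_nhds ?_ ⟨hNx x t, hNt x t⟩
      exact (isOpen_lt (f := fun p : ℝ × E => ‖p.2‖) (by fun_prop) continuous_const).inter
        (isOpen_lt (f := fun p : ℝ × E => |p.1|) (by fun_prop) continuous_const)
    filter_upwards [h3] with p hp
    exact (hφ _ _ _ hp.1 hp.2).symm
  · intro s t x
    have h1 : ∀ s, HasDerivAt (fun s => φ (s + t) x) (v (φ (s + t) x)) s := fun s =>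
      (hφd x (s + t)).comp_add_const s t
    refine integralCurve_unique hv (t₀ := 0) (a := -(|s| + 1)) (b := |s| + 1)
      ⟨by linarith [abs_nonneg s], by linarith [abs_nonneg s]⟩ (fun s _ => h1 s)
      (fun s _ => hφd (φ t x) s) (by simp [hφ0]) ?_
    exact abs_lt.1 (lt_add_one _)

/-- If integral curves through points of a closed set locally stay in the set, the set is
invariant. -/
theorem CFlow.IsFlowOf.invariant {Φ : CFlow E} {v : E → E} (hΦ : Φ.IsFlowOf v)
    (hv : ContDiff ℝ 1 v) {Y : Set E} (hY : IsClosed Y)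
    (hloc : ∀ y ∈ Y, ∃ ε > 0, ∃ γ : ℝ → E, γ 0 = y ∧
      ∀ t ∈ Set.Ioo (-ε) ε, γ t ∈ Y ∧ HasDerivAt γ (v (γ t)) t) :
    ∀ y ∈ Y, ∀ t, Φ.toFun t y ∈ Y := by
  intro y hy
  have hc : Continuous fun t => Φ.toFun t y := Φ.cont.comp (continuous_id.prodMk continuous_const)
  have hclopen : IsClopen ((fun t => Φ.toFun t y) ⁻¹' Y) := by
    refine ⟨hY.preimage hc, ?_⟩
    rw [isOpen_iff_mem_nhds]
    intro t ht
    obtain ⟨ε, hε, γ, hγ0, hγ⟩ := hloc _ ht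
    have h1 : ∀ s, HasDerivAt (fun s => Φ.toFun (s + t) y) (v (Φ.toFun (s + t) y)) s := fun s =>
      (hΦ y (s + t)).comp_add_const s t
    have h2 := integralCurve_unique hv (t₀ := 0) (a := -ε) (b := ε) ⟨by linarith, hε⟩
      (fun s _ => h1 s) (fun s hs => (hγ s hs).2) (by simp [hγ0])
    have h3 : Set.Ioo (t - ε) (t + ε) ∈ 𝓝 t := Ioo_mem_nhds (by linarith) (by linarith)
    filter_upwards [h3] with s hs
    have h4 : s - t ∈ Set.Ioo (-ε) ε := ⟨by linarith [hs.1], by linarith [hs.2]⟩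
    have h5 := h2 h4
    simp only [sub_add_cancel] at h5
    change Φ.toFun s y ∈ Y
    rw [h5]
    exact (hγ _ h4).1
  intro t
  have := hclopen.eq_univ ⟨0, by simpa [Φ.zero] using hy⟩
  exact Set.eq_univ_iff_forall.1 this t

/-- Restriction of a flow to an invariant set. -/
def CFlow.restrict {M : Type} [TopologicalSpace M] (Φ : CFlow M) (Y : Set M)
    (h : ∀ y ∈ Y, ∀ t, Φ.toFun t y ∈ Y) : CFlow ↥Y where
  toFun t y := ⟨Φ.toFun t y.1, h y.1 y.2 t⟩
  cont := (Φ.cont.comp (continuous_fst.prodMk (continuous_subtype_val.comp continuous_snd))).subtype_mk _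
  zero _ := Subtype.ext (Φ.zero _)
  add s t _ := Subtype.ext (Φ.add s t _)

end Flow

theorem Chart.exists_integralCurve {n d : ℕ} {Y : Set (Fin n → ℂ)} {p : Fin n → ℂ}
    (χ : Chart Y d p) {v : (Fin n → ℂ) → (Fin n → ℂ)} (hv : ContDiff ℝ 1 v)
    (hT : ∀ y ∈ Y, v y ∈ zTangent Y y) :
    ∃ ε > 0, ∃ γ : ℝ → (Fin n → ℂ), γ 0 = p ∧
      ∀ t ∈ Set.Ioo (-ε) ε, γ t ∈ Y ∧ HasDerivAt γ (v (γ t)) t := by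
  have hψ : ∀ u ∈ χ.U, ContDiffAt ℂ ω χ.ψ u := fun u hu =>
    χ.smooth.contDiffAt (χ.isOpen_U.mem_nhds hu)
  have hL : ContDiff ℝ 1 χ.L := (χ.L.restrictScalars ℝ).contDiff
  have h1 : ContDiffAt ℝ 1 (fun u => χ.L (v (χ.ψ u))) 0 :=
    hL.contDiffAt.comp _ (hv.contDiffAt.comp _
      (((hψ 0 χ.zero_mem).restrict_scalars ℝ).of_le (by simp)))
  obtain ⟨γ, hγ0, ε, hε, hγ⟩ := h1.exists_forall_mem_closedBall_exists_eq_forall_mem_Ioo_hasDerivAt₀ 0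
  have hγc : ContinuousAt γ 0 := (hγ 0 (by simpa using hε)).continuousAt
  have hU : ∀ᶠ t in 𝓝 0, γ t ∈ χ.U := hγc (χ.isOpen_U.mem_nhds (by rw [hγ0]; exact χ.zero_mem))
  obtain ⟨δ, hδ, hδU⟩ := Metric.eventually_nhds_iff.1 hU
  refine ⟨min ε δ, lt_min hε hδ, fun t => χ.ψ (γ t), by simp [hγ0, χ.map_zero], fun t ht => ?_⟩
  have ht1 : t ∈ Set.Ioo (0 - ε) (0 + ε) :=
    ⟨by have := min_le_left ε δ; linarith [ht.1], by have := min_le_left ε δ; linarith [ht.2]⟩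
  have ht2 : γ t ∈ χ.U := hδU (by
    rw [Real.dist_eq, sub_zero, abs_lt]
    exact ⟨by have := min_le_right ε δ; linarith [ht.1], by have := min_le_right ε δ; linarith [ht.2]⟩)
  refine ⟨(χ.mem _ ht2).1, ?_⟩
  have h2 : HasFDerivAt χ.ψ ((fderiv ℂ χ.ψ (γ t)).restrictScalars ℝ) (γ t) :=
    (((hψ _ ht2).differentiableAt (by simp)).hasFDerivAt).restrictScalars ℝ
  have h3 := h2.comp_hasDerivAt t (hγ t ht1)
  have h4 := χ.tan' _ ht2 _ (hT _ (χ.mem _ ht2).1)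
  have h5 : ((fderiv ℂ χ.ψ (γ t)).restrictScalars ℝ) (χ.L (v (χ.ψ (γ t)))) = v (χ.ψ (γ t)) := h4
  rw [h5] at h3
  exact h3

lemma IsAlgSet.isClosed {n : ℕ} {Y : Set (Fin n → ℂ)} (hY : IsAlgSet Y) : IsClosed Y := by
  obtain ⟨S, rfl⟩ := hY
  have : {x : Fin n → ℂ | ∀ p ∈ S, MvPolynomial.eval x p = 0} =
      ⋂ p ∈ S, {x | MvPolynomial.eval x p = 0} := by ext; simp
  rw [this]
  exact isClosed_biInter fun p _ => isClosed_eq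
    ((contDiff_eval p (N := 1)).continuous) continuous_const

theorem Sm.exists_flow {n m d : ℕ} {Y : Set (Fin n → ℂ)} (hY : Sm Y m) (hd : d + m = n)
    {v : (Fin n → ℂ) → (Fin n → ℂ)} (hv : ContDiff ℝ 1 v) {C : ℝ} (hC : ∀ x, ‖v x‖ ≤ C)
    (hT : ∀ y ∈ Y, v y ∈ zTangent Y y) :
    ∃ Φ : CFlow ↥Y, ∀ y t, HasDerivAt (fun t => (Φ.toFun t y).1) (v (Φ.toFun t y).1) t := by
  obtain ⟨Φ, hΦ⟩ := PaperED.exists_flow hv hC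
  have hinv := hΦ.invariant hv hY.1.isClosed fun y hy =>
    (hY.nonempty_chart hd hy).some.exists_integralCurve hv hT
  exact ⟨Φ.restrict Y hinv, fun y t => hΦ y.1 t⟩

end

section

open scoped ContDiff

lemma exists_linearEquiv_dot {d : ℕ} (B : LinearMap.BilinForm ℂ (Fin d → ℂ))
    (hs : ∀ a b, B a b = B b a) (hn : ∀ a, (∀ b, B a b = 0) → a = 0) {θ : ℂ} (hθ : θ ≠ 0) :
    ∃ A : (Fin d → ℂ) ≃ₗ[ℂ] (Fin d → ℂ), ∀ a b, B (A a) (A b) = θ * ∑ i, a i * b i := by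
  let B' : LinearMap.BilinForm ℂ (Fin d → ℂ) := θ⁻¹ • B
  have hB' : B'.IsSymm := ⟨fun a b => by simp [B', hs a b]⟩
  have hassoc : QuadraticMap.associated (R := ℂ) (B'.toQuadraticMap) = B' :=
    QuadraticMap.associated_left_inverse ℂ hB'.eq
  obtain ⟨e⟩ := QuadraticForm.equivalent_weightedSumSquares_of_isAlgClosed B'.toQuadraticMap (by
    rw [hassoc]
    intro a ha
    refine hn a fun b => ?_
    have := ha b
    simpa [B', hθ] using this)
  have hd : Module.finrank ℂ (Fin d → ℂ) = d := Module.finrank_fin_fun ℂ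
  let ρ : (Fin (Module.finrank ℂ (Fin d → ℂ)) → ℂ) ≃ₗ[ℂ] (Fin d → ℂ) :=
    LinearEquiv.funCongrLeft ℂ ℂ (finCongr hd.symm)
  let A := (e.toLinearEquiv.trans ρ).symm
  have h1 : ∀ a, B (A a) (A a) = θ * ∑ i, a i * a i := by
    intro a
    have h2 := e.map_app (A a)
    have h3 : ρ (e (A a)) = a := (e.toLinearEquiv.trans ρ).apply_symm_apply a
    have h4 : ∑ i, a i * a i = ∑ i, e (A a) i * e (A a) i := by
      rw [← Equiv.sum_comp (finCongr hd.symm)]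
      refine Finset.sum_congr rfl fun i _ => ?_
      conv_lhs => rw [← h3]
      rfl
    rw [h4]
    rw [QuadraticMap.weightedSumSquares_apply] at h2
    simp only [Pi.one_apply, one_smul] at h2
    rw [h2]
    simp [B', hθ]
  refine ⟨A, fun a b => ?_⟩
  have h2 := h1 (a + b)
  simp only [map_add, LinearMap.add_apply, h1 a, h1 b, hs (A b) (A a), Pi.add_apply, mul_add,
    add_mul, Finset.sum_add_distrib] at h2
  have h3 : ∑ i, b i * a i = ∑ i, a i * b i := Finset.sum_congr rfl fun i _ => mul_comm _ _
  rw [h3] at h2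
  linear_combination h2 / 2

/-- Hermitian square norm on `ℂ^d`. -/
def sqn {d : ℕ} (u : Fin d → ℂ) : ℝ := ∑ i, Complex.normSq (u i)

lemma sqn_nonneg {d : ℕ} (u : Fin d → ℂ) : 0 ≤ sqn u :=
  Finset.sum_nonneg fun _ _ => Complex.normSq_nonneg _

lemma norm_sq_le_sqn {d : ℕ} (u : Fin d → ℂ) : ‖u‖ ^ 2 ≤ sqn u := by
  have h : ‖u‖ ≤ Real.sqrt (sqn u) := by
    refine (pi_norm_le_iff_of_nonneg (Real.sqrt_nonneg _)).2 fun i => ?_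
    refine Real.le_sqrt_of_sq_le ?_
    rw [← Complex.normSq_eq_norm_sq]
    exact Finset.single_le_sum (f := fun i => Complex.normSq (u i))
      (fun _ _ => Complex.normSq_nonneg _) (Finset.mem_univ i)
  calc ‖u‖ ^ 2 ≤ Real.sqrt (sqn u) ^ 2 := by gcongr
    _ = sqn u := Real.sq_sqrt (sqn_nonneg u)

lemma sqn_le {d : ℕ} (u : Fin d → ℂ) : sqn u ≤ d * ‖u‖ ^ 2 := by
  calc sqn u ≤ ∑ _i : Fin d, ‖u‖ ^ 2 := Finset.sum_le_sum fun i _ => by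
        rw [Complex.normSq_eq_norm_sq]; gcongr; exact norm_le_pi_norm u i
    _ = d * ‖u‖ ^ 2 := by simp

lemma sum_mul_star {d : ℕ} (u : Fin d → ℂ) : ∑ i, u i * star u i = (sqn u : ℂ) := by
  simp [sqn, Complex.mul_conj]

lemma norm_dot_self_le {d : ℕ} (u : Fin d → ℂ) : ‖∑ i, u i * u i‖ ≤ sqn u := by
  refine (norm_sum_le _ _).trans (Finset.sum_le_sum fun i _ => ?_)
  rw [norm_mul, Complex.normSq_eq_norm_sq, sq]

/-- The second-order behaviour of a function at a nondegenerate critical point in normal form. -/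
structure MorseEst {d : ℕ} (g : (Fin d → ℂ) → ℂ) (ρ : ℝ) : Prop where
  pos : 0 < ρ
  est : ∀ u, ‖u‖ < ρ → |‖g u‖ - ‖g 0‖ - (∑ i, u i * u i).re| ≤ sqn u / 4
  est' : ∀ u, ‖u‖ < ρ → ‖g 0‖ * sqn u ≤ ((starRingEnd ℂ) (g u) * fderiv ℂ g u (star u)).re

lemma abs_norm_add_sub_le {r : ℝ} (hr : 0 < r) (w : ℂ) :
    |‖(r : ℂ) + w‖ - r - w.re| ≤ ‖w‖ ^ 2 / r := by
  have h0 : ‖(r : ℂ) + w‖ ^ 2 = r ^ 2 + 2 * r * w.re + ‖w‖ ^ 2 := by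
    rw [← Complex.normSq_eq_norm_sq, ← Complex.normSq_eq_norm_sq, Complex.normSq_apply,
      Complex.normSq_apply]
    simp; ring
  have h1 : r + w.re ≤ ‖(r : ℂ) + w‖ := by
    simpa using Complex.re_le_norm ((r : ℂ) + w)
  have hw := Complex.abs_re_le_norm w
  rw [abs_of_nonneg (by linarith)]
  have h2 : w.re ^ 2 ≤ ‖w‖ ^ 2 := by rw [← sq_abs]; gcongr
  have h3 : 0 ≤ ‖w‖ ^ 2 / r := by positivity
  have h4 : ‖w‖ ^ 2 / r * r = ‖w‖ ^ 2 := by field_simp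
  rw [sub_sub, sub_le_iff_le_add]
  by_cases h5 : 0 ≤ ‖w‖ ^ 2 / r + (r + w.re)
  · refine abs_le_of_sq_le_sq' ?_ h5 |>.2
    rw [h0]
    nlinarith [mul_nonneg h3 h3, sq_nonneg (‖w‖ ^ 2 / r + w.re), hw]
  · exfalso
    push Not at h5
    have : ‖w‖ > r + ‖w‖^2/r := by linarith [neg_abs_le w.re]
    have : ‖w‖ * r > r * r + ‖w‖^2 := by nlinarith
    nlinarith [sq_nonneg (‖w‖ - r), norm_nonneg w, mul_pos hr hr]

lemma le_re_mul_of_small {c S : ℝ} (hc : 0 ≤ c) (hS : S ≤ c / 32) {w e : ℂ}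
    (hw : ‖w‖ ≤ 2 * S) (he : ‖e‖ ≤ S / 8) :
    c * S ≤ (((c : ℂ) + (starRingEnd ℂ) w) * (2 * S + e)).re := by
  have h9 : (((c : ℂ) + (starRingEnd ℂ) w) * (2 * S + e)).re =
      2 * c * S + 2 * S * w.re + c * e.re + ((starRingEnd ℂ) w * e).re := by
    simp [Complex.mul_re]; ring
  rw [h9]
  have hS0 : 0 ≤ S := by linarith [norm_nonneg w]
  have h10 := Complex.abs_re_le_norm w
  have h11 := Complex.abs_re_le_norm e
  have h12 := Complex.abs_re_le_norm ((starRingEnd ℂ) w * e)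
  rw [norm_mul, RCLike.norm_conj] at h12
  have h13 : ‖w‖ * ‖e‖ ≤ (2 * S) * (S / 8) := by gcongr
  rw [abs_le] at h10 h11 h12
  have h14 : c * (S / 8 + e.re) ≥ 0 := mul_nonneg hc (by linarith)
  have h15 : 2 * S * (2 * S + w.re) ≥ 0 := mul_nonneg (by linarith) (by linarith)
  have h16 : S * (c / 32 - S) ≥ 0 := mul_nonneg hS0 (by linarith)
  nlinarith

set_option maxHeartbeats 1000000 in
theorem exists_morseEst {d : ℕ} {g : (Fin d → ℂ) → ℂ} (hg : ContDiffAt ℂ 2 g 0)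
    (hc : g 0 ≠ 0) (h1 : fderiv ℂ g 0 = 0)
    (h2 : ∀ a b, fderiv ℂ (fderiv ℂ g) 0 a b = 2 * (g 0 / ‖g 0‖) * ∑ i, a i * b i) :
    ∃ ρ, MorseEst g ρ := by
  set c := g 0 with hcdef
  set θ : ℂ := c / ‖c‖ with hθ
  have hcn : 0 < ‖c‖ := norm_pos_iff.2 hc
  have hθn : ‖θ‖ = 1 := by
    rw [hθ, norm_div, Complex.norm_real, norm_norm, div_self hcn.ne']
  have hθc : (starRingEnd ℂ) θ * θ = 1 := by
    rw [mul_comm, Complex.mul_conj, Complex.normSq_eq_norm_sq, hθn]; simp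
  have hcθ : c = ‖c‖ * θ := by
    have : (‖c‖ : ℂ) ≠ 0 := by exact_mod_cast hcn.ne'
    rw [hθ, mul_div_cancel₀ _ this]
  let l : (Fin d → ℂ) → (Fin d → ℂ) →L[ℂ] ℂ := fun u => fderiv ℂ (fderiv ℂ g) 0 u
  have hd2 : HasFDerivAt (fderiv ℂ g) (fderiv ℂ (fderiv ℂ g) 0) 0 :=
    ((hg.fderiv_right (m := 1) (by norm_num)).differentiableAt one_ne_zero).hasFDerivAt
  have hdiff : ∀ᶠ u in 𝓝 (0 : Fin d → ℂ), DifferentiableAt ℂ g u :=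
    (hg.eventually (by simp)).mono fun u hu => hu.differentiableAt (by norm_num)
  -- choose the error bound
  obtain ⟨ε, hε0, hε1⟩ : ∃ ε : ℝ, 0 < ε ∧ ε ≤ 1 / 8 := ⟨1 / 8, by norm_num, le_rfl⟩
  have hE : ∀ᶠ u in 𝓝 (0 : Fin d → ℂ), ‖fderiv ℂ g u - l u‖ ≤ ε * ‖u‖ := by
    have := hd2.isLittleO.def hε0
    filter_upwards [this] with u hu
    simpa [h1, l] using hu
  obtain ⟨ρ₀, hρ₀, hball⟩ := Metric.eventually_nhds_iff_ball.1 (hE.and hdiff)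
  have hq : ∀ u : Fin d → ℂ, HasFDerivAt (fun u : Fin d → ℂ => θ * ∑ i, u i * u i) (l u) u := by
    intro u
    have h3 : HasFDerivAt (fun u : Fin d → ℂ => ∑ i, u i * u i)
        (∑ i, (u i • (ContinuousLinearMap.proj i : (Fin d → ℂ) →L[ℂ] ℂ) +
          u i • (ContinuousLinearMap.proj i : (Fin d → ℂ) →L[ℂ] ℂ))) u := by
      refine HasFDerivAt.fun_sum fun i _ => ?_
      have h4 : HasFDerivAt (fun u : Fin d → ℂ => u i)
        (ContinuousLinearMap.proj i : (Fin d → ℂ) →L[ℂ] ℂ) u :=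
        (ContinuousLinearMap.proj i : (Fin d → ℂ) →L[ℂ] ℂ).hasFDerivAt
      exact h4.mul h4
    refine (h3.const_mul θ).congr_fderiv ?_
    refine ContinuousLinearMap.ext fun b => ?_
    simp only [l, h2, smul_apply, sum_apply, add_apply, ContinuousLinearMap.proj_apply, smul_eq_mul,
      Finset.mul_sum]
    refine Finset.sum_congr rfl fun i _ => ?_
    ring
  have hexp : ∀ u, ‖u‖ < ρ₀ → ‖g u - c - θ * ∑ i, u i * u i‖ ≤ ε * ‖u‖ * ‖u‖ := by
    intro u hu
    have h5 := (convex_closedBall (0 : Fin d → ℂ) ‖u‖).norm_image_sub_le_of_norm_hasFDerivWithin_le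
      (𝕜 := ℂ) (f := fun u => g u - θ * ∑ i, u i * u i) (f' := fun u => fderiv ℂ g u - l u)
      (C := ε * ‖u‖) (x := 0) (y := u) (fun v hv => ?_) (fun v hv => ?_) (by simp) (by simp)
    · rw [sub_zero] at h5
      refine le_trans (le_of_eq ?_) h5
      congr 1
      simp [hcdef]; ring
    · have hv' : v ∈ Metric.ball (0 : Fin d → ℂ) ρ₀ := by
        simp at hv ⊢; linarith
      exact (((hball v hv').2.hasFDerivAt).sub (hq v)).hasFDerivWithinAt
    · have hv' : v ∈ Metric.ball (0 : Fin d → ℂ) ρ₀ := by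
        simp at hv ⊢; linarith
      refine (hball v hv').1.trans ?_
      gcongr
      simpa using hv
  obtain ⟨ρ, hρ, hρ1, hρ2, hρ3⟩ : ∃ ρ : ℝ, 0 < ρ ∧ ρ ≤ ρ₀ ∧ ρ ≤ 1 ∧ (d + 1) ^ 2 * ρ ^ 2 ≤ ‖c‖ / 32 := by
    have : Tendsto (fun ρ : ℝ => (d + 1 : ℝ) ^ 2 * ρ ^ 2) (𝓝[>] 0) (𝓝 ((d + 1 : ℝ) ^ 2 * 0 ^ 2)) :=
      Tendsto.mono_left (Continuous.tendsto (by fun_prop) 0) nhdsWithin_le_nhds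
    have h6 := this.eventually (Iio_mem_nhds (show (d + 1 : ℝ) ^ 2 * 0 ^ 2 < ‖c‖ / 32 by simp; exact hc))
    obtain ⟨ρ, hρ', hρ, hρ''⟩ := (h6.and (Ioo_mem_nhdsGT (lt_min hρ₀ one_pos))).exists
    exact ⟨ρ, hρ, hρ''.le.trans (min_le_left _ _), hρ''.le.trans (min_le_right _ _), le_of_lt hρ'⟩
  refine ⟨ρ, hρ, fun u hu => ?_, fun u hu => ?_⟩
  all_goals
    have hS := norm_sq_le_sqn u
    have hS' := sqn_le u
    have hS0 := sqn_nonneg u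
    have hu0 := norm_nonneg u
    have hd0 : (0:ℝ) ≤ d := by positivity
    set q := ∑ i, u i * u i with hqdef
    have hq1 : ‖q‖ ≤ sqn u := norm_dot_self_le u
    obtain ⟨e, he⟩ : ∃ e : ℂ, g u = θ * (‖c‖ + (q + e)) := ⟨(starRingEnd ℂ) θ * g u - ‖c‖ - q, by
      linear_combination (-g u) * hθc⟩
    have hen : ‖e‖ ≤ ε * sqn u := by
      have h7 := hexp u (hu.trans_le hρ1)
      have h8 : g u - c - θ * q = θ * e := by rw [he]; linear_combination -hcθ
      rw [h8, norm_mul, hθn, one_mul] at h7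
      nlinarith
    have hw : ‖q + e‖ ≤ 2 * sqn u := by
      refine (norm_add_le _ _).trans ?_
      nlinarith
    have hSc : sqn u ≤ ‖c‖ / 32 := by
      have : ‖u‖ ^ 2 ≤ ρ ^ 2 := by gcongr
      nlinarith [sq_nonneg ρ]
  · rw [he, norm_mul, hθn, one_mul]
    have h9 := abs_norm_add_sub_le hcn (q + e)
    have h10 : ‖q + e‖ ^ 2 / ‖c‖ ≤ sqn u / 8 := by
      rw [div_le_iff₀ hcn]
      have hd4 : 4 * sqn u ≤ ‖c‖ / 8 := by linarith
      calc ‖q + e‖ ^ 2 ≤ (2 * sqn u) ^ 2 := by gcongr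
        _ ≤ sqn u / 8 * ‖c‖ := by nlinarith
    have h11 := Complex.abs_re_le_norm e
    rw [Complex.add_re] at h9
    rw [abs_le] at h9 h11 ⊢
    constructor <;> nlinarith
  · have h7 : ‖fderiv ℂ g u (star u) - 2 * θ * sqn u‖ ≤ ε * ‖u‖ * ‖u‖ := by
      have h8 := (hball u (by simpa using hu.trans_le hρ1)).1
      have h9 : l u (star u) = 2 * θ * sqn u := by
        simp only [l, h2, ← sum_mul_star]
      rw [← h9, ← sub_apply]
      refine (ContinuousLinearMap.le_opNorm _ _).trans ?_
      rw [norm_star]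
      gcongr
    obtain ⟨e', he'⟩ : ∃ e', fderiv ℂ g u (star u) = 2 * θ * sqn u + θ * e' :=
      ⟨(starRingEnd ℂ) θ * (fderiv ℂ g u (star u) - 2 * θ * sqn u), by
        linear_combination (2 * θ * sqn u - fderiv ℂ g u (star u)) * hθc⟩
    have hen' : ‖e'‖ ≤ ε * sqn u := by
      rw [he', add_sub_cancel_left, norm_mul, hθn, one_mul] at h7
      nlinarith
    have h8 : (starRingEnd ℂ) (g u) * fderiv ℂ g u (star u) =
        (‖c‖ + (starRingEnd ℂ) (q + e)) * (2 * sqn u + e') := by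
      rw [he, he', map_mul, map_add, Complex.conj_ofReal]
      generalize (starRingEnd ℂ) (q + e) = w
      linear_combination ((‖c‖ + w) * (2 * sqn u + e')) * hθc
    rw [h8]
    exact le_re_mul_of_small hcn.le hSc hw (by nlinarith)

end

section

open scoped ContDiff

variable {n d : ℕ} {Y : Set (Fin n → ℂ)} {p : Fin n → ℂ}

/-- A polynomial function read in a chart. -/
def Chart.pull (χ : Chart Y d p) (f : MvPolynomial (Fin n) ℂ) (u : Fin d → ℂ) : ℂ :=
  MvPolynomial.eval (χ.ψ u) f

lemma Chart.contDiffAt (χ : Chart Y d p) {u : Fin d → ℂ} (hu : u ∈ χ.U) :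
    ContDiffAt ℂ ω χ.ψ u :=
  χ.smooth.contDiffAt (χ.isOpen_U.mem_nhds hu)

lemma Chart.hasFDerivAt (χ : Chart Y d p) {u : Fin d → ℂ} (hu : u ∈ χ.U) :
    HasFDerivAt χ.ψ (fderiv ℂ χ.ψ u) u :=
  ((χ.contDiffAt hu).differentiableAt (by simp)).hasFDerivAt

lemma Chart.contDiffAt_pull (χ : Chart Y d p) (f : MvPolynomial (Fin n) ℂ) {u : Fin d → ℂ}
    (hu : u ∈ χ.U) : ContDiffAt ℂ ω (χ.pull f) u :=
  (contDiff_eval f).contDiffAt.comp u (χ.contDiffAt hu)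

lemma Chart.fderiv_pull (χ : Chart Y d p) (f : MvPolynomial (Fin n) ℂ) {u : Fin d → ℂ}
    (hu : u ∈ χ.U) : fderiv ℂ (χ.pull f) u = (pd f (χ.ψ u)).comp (fderiv ℂ χ.ψ u) :=
  ((hasFDerivAt_eval f (χ.ψ u)).comp u (χ.hasFDerivAt hu)).fderiv

/-- Linear change of coordinates in a chart. -/
def Chart.changeCoord (χ : Chart Y d p) (A : (Fin d → ℂ) ≃L[ℂ] (Fin d → ℂ)) : Chart Y d p where
  ψ := χ.ψ ∘ A
  L := (A.symm : (Fin d → ℂ) →L[ℂ] (Fin d → ℂ)).comp χ.L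
  U := A ⁻¹' χ.U
  O := χ.O
  isOpen_U := χ.isOpen_U.preimage A.continuous
  isOpen_O := χ.isOpen_O
  zero_mem := by simpa using χ.zero_mem
  base_mem := χ.base_mem
  map_zero := by simp [χ.map_zero]
  smooth := χ.smooth.comp A.contDiff.contDiffOn fun _ h => h
  mem u hu := χ.mem _ hu
  left u hu := by
    change A.symm (χ.L (χ.ψ (A u) - p)) = u
    rw [χ.left _ hu, A.symm_apply_apply]
  right y hy := by
    have h := χ.right y hy
    change A (A.symm (χ.L (y - p))) ∈ χ.U ∧ χ.ψ (A (A.symm (χ.L (y - p)))) = y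
    rwa [A.apply_symm_apply]
  tan u hu a := by
    rw [A.comp_right_fderiv]
    exact χ.tan _ hu _
  tan' u hu w hw := by
    rw [A.comp_right_fderiv]
    change fderiv ℂ χ.ψ (A u) (A (A.symm (χ.L w))) = w
    rw [A.apply_symm_apply]
    exact χ.tan' _ hu w hw

/-- Nondegeneracy of the Hessian at the centre of a chart. -/
def Chart.Nondeg (χ : Chart Y d p) (f : MvPolynomial (Fin n) ℂ) : Prop :=
  ∀ a, (∀ b, fderiv ℂ (fderiv ℂ (χ.pull f)) 0 a b = 0) → a = 0

lemma fderiv_fderiv_comp_equiv {g : (Fin d → ℂ) → ℂ} (A : (Fin d → ℂ) ≃L[ℂ] (Fin d → ℂ))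
    (hg : DifferentiableAt ℂ (fderiv ℂ g) 0) (a b : Fin d → ℂ) :
    fderiv ℂ (fderiv ℂ (g ∘ A)) 0 a b = fderiv ℂ (fderiv ℂ g) 0 (A a) (A b) := by
  have h1 : fderiv ℂ (g ∘ A) = fun u => ((ContinuousLinearMap.compL ℂ (Fin d → ℂ) (Fin d → ℂ) ℂ).flip
      (A : (Fin d → ℂ) →L[ℂ] (Fin d → ℂ))) (fderiv ℂ g (A u)) := by
    funext u
    rw [A.comp_right_fderiv]
    rfl
  have h2 : HasFDerivAt (fderiv ℂ g) (fderiv ℂ (fderiv ℂ g) 0) (A 0) := by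
    rw [map_zero]; exact hg.hasFDerivAt
  have h3 : HasFDerivAt (fun u => fderiv ℂ g (A u)) _ 0 := h2.comp 0 A.hasFDerivAt
  have h4 := (((ContinuousLinearMap.compL ℂ (Fin d → ℂ) (Fin d → ℂ) ℂ).flip
      (A : (Fin d → ℂ) →L[ℂ] (Fin d → ℂ))).hasFDerivAt).comp 0 h3
  rw [h1]
  exact congrArg (fun T => T a b) h4.fderiv

theorem Chart.exists_morse (χ : Chart Y d p) {f : MvPolynomial (Fin n) ℂ}
    (hc : MvPolynomial.eval p f ≠ 0) (hcrit : ∀ w ∈ zTangent Y p, pd f p w = 0)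
    (hnd : χ.Nondeg f) : ∃ (χ' : Chart Y d p) (ρ : ℝ), MorseEst (χ'.pull f) ρ := by
  have hs := χ.contDiffAt_pull f χ.zero_mem
  have hs1 : DifferentiableAt ℂ (fderiv ℂ (χ.pull f)) 0 :=
    (hs.fderiv_right (m := 1) (by simp)).differentiableAt one_ne_zero
  have hg0 : χ.pull f 0 = MvPolynomial.eval p f := by simp [Chart.pull, χ.map_zero]
  have hθ : 2 * (χ.pull f 0 / ‖χ.pull f 0‖) ≠ 0 := by
    rw [hg0]
    have : (‖MvPolynomial.eval p f‖ : ℂ) ≠ 0 := by exact_mod_cast norm_ne_zero_iff.2 hc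
    exact mul_ne_zero two_ne_zero (div_ne_zero hc this)
  let B : LinearMap.BilinForm ℂ (Fin d → ℂ) :=
    (ContinuousLinearMap.coeLM ℂ).comp (fderiv ℂ (fderiv ℂ (χ.pull f)) 0 : (Fin d → ℂ) →ₗ[ℂ] _)
  have hB : ∀ a b, B a b = fderiv ℂ (fderiv ℂ (χ.pull f)) 0 a b := fun a b => rfl
  obtain ⟨A, hA⟩ := exists_linearEquiv_dot B (fun a b => hs.isSymmSndFDerivAt_of_omega a b)
    (fun a ha => hnd a ha) hθ
  refine ⟨χ.changeCoord A.toContinuousLinearEquiv, exists_morseEst ?_ ?_ ?_ ?_⟩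
  · exact ((χ.changeCoord _).contDiffAt_pull f (χ.changeCoord _).zero_mem).of_le (by simp)
  · simpa [Chart.pull, (χ.changeCoord _).map_zero] using hc
  · rw [Chart.fderiv_pull _ _ (χ.changeCoord _).zero_mem, (χ.changeCoord _).map_zero]
    refine ContinuousLinearMap.ext fun a => ?_
    refine hcrit _ ?_
    have := (χ.changeCoord A.toContinuousLinearEquiv).tan _
      (χ.changeCoord A.toContinuousLinearEquiv).zero_mem a
    rwa [(χ.changeCoord _).map_zero] at this
  · intro a b
    have h1 : (χ.changeCoord A.toContinuousLinearEquiv).pull f 0 = χ.pull f 0 := by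
      rw [hg0]; simp [Chart.pull, (χ.changeCoord _).map_zero]
    rw [h1, ← hA a b, hB]
    exact fderiv_fderiv_comp_equiv A.toContinuousLinearEquiv hs1 a b

end

section

open scoped ContDiff

section MorseField

variable {n d : ℕ} {Y : Set (Fin n → ℂ)} {f : MvPolynomial (Fin n) ℂ}

/-- The critical points of a polynomial on `Y`. -/
def critSet (Y : Set (Fin n → ℂ)) (f : MvPolynomial (Fin n) ℂ) : Set (Fin n → ℂ) :=
  {x | x ∈ Y ∧ ∀ w ∈ zTangent Y x, pd f x w = 0}

/-- The properties of a polynomial which make Morse theory of its absolute value work on `Y`. -/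
structure GoodFn (Y : Set (Fin n → ℂ)) (d : ℕ) (f : MvPolynomial (Fin n) ℂ) : Prop where
  fin : (critSet Y f).Finite
  ne : ∀ p ∈ critSet Y f, MvPolynomial.eval p f ≠ 0
  nondeg : ∀ p ∈ critSet Y f, ∃ χ : Chart Y d p, χ.Nondeg f
  tame : ∃ R C : ℝ, ∀ x ∈ Y, R < ‖x‖ → ∃ w ∈ zTangent Y x, ‖w‖ ≤ C ∧ pd f x w = 1

/-- Disjoint Morse charts of a common size around all critical points. -/
structure MorseSetup (Y : Set (Fin n → ℂ)) (d : ℕ) (f : MvPolynomial (Fin n) ℂ) where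
  χ : ∀ p : critSet Y f, Chart Y d p.1
  ρ : ℝ
  e₀ : ℝ
  pos : 0 < e₀
  est : ∀ p, MorseEst ((χ p).pull f) ρ
  sub : ∀ p, Metric.ball 0 ρ ⊆ (χ p).U
  disj : ∀ p q, p ≠ q → Disjoint ((χ p).ψ '' Metric.ball 0 ρ) ((χ q).ψ '' Metric.ball 0 ρ)
  lt : ∀ p : critSet Y f, 3 * e₀ < ‖MvPolynomial.eval p.1 f‖
  fin : (critSet Y f).Finite
  ρpos : 0 < ρ

lemma MorseEst.mono {g : (Fin d → ℂ) → ℂ} {ρ ρ' : ℝ} (h : MorseEst g ρ) (h0 : 0 < ρ')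
    (hle : ρ' ≤ ρ) : MorseEst g ρ' :=
  ⟨h0, fun u hu => h.est u (hu.trans_le hle), fun u hu => h.est' u (hu.trans_le hle)⟩

lemma GoodFn.nonempty_setup (h : GoodFn Y d f) : Nonempty (MorseSetup Y d f) := by
  classical
  have hfin : Finite (critSet Y f) := h.fin
  have h1 : ∀ p : critSet Y f, ∃ (χ : Chart Y d p.1) (ρ : ℝ), MorseEst (χ.pull f) ρ := fun p => by
    obtain ⟨χ, hχ⟩ := h.nondeg p.1 p.2
    exact χ.exists_morse (h.ne _ p.2) p.2.2 hχ
  choose χ ρ hρ using h1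
  obtain ⟨V, hV, hdis⟩ := h.fin.t2_separation
  have e1 : ∀ᶠ s : ℝ in 𝓝[>] 0, ∀ p : critSet Y f, s ≤ ρ p ∧ Metric.ball 0 s ⊆ (χ p).U ∧
      ∀ u ∈ Metric.ball 0 s, (χ p).ψ u ∈ V p.1 := by
    rw [eventually_all]
    intro p
    have hUV : (χ p).U ∩ (χ p).ψ ⁻¹' (V p.1) ∈ 𝓝 (0 : Fin d → ℂ) := by
      refine inter_mem ((χ p).isOpen_U.mem_nhds (χ p).zero_mem) ?_
      refine ((χ p).contDiffAt (χ p).zero_mem).continuousAt ?_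
      rw [(χ p).map_zero]
      exact (hV p.1).2.mem_nhds (hV p.1).1
    obtain ⟨s, hs, hsub⟩ := Metric.mem_nhds_iff.1 hUV
    filter_upwards [Ioo_mem_nhdsGT (lt_min (hρ p).pos hs)] with t ht
    have hts : t ≤ s := ht.2.le.trans (min_le_right _ _)
    exact ⟨ht.2.le.trans (min_le_left _ _),
      fun u hu => (hsub (Metric.ball_subset_ball hts hu)).1,
      fun u hu => (hsub (Metric.ball_subset_ball hts hu)).2⟩
  have e2 : ∀ᶠ s : ℝ in 𝓝[>] 0, ∀ p : critSet Y f, 3 * s < ‖MvPolynomial.eval p.1 f‖ := by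
    rw [eventually_all]
    intro p
    filter_upwards [Ioo_mem_nhdsGT (show 0 < ‖MvPolynomial.eval p.1 f‖ / 3 by
      have := norm_pos_iff.2 (h.ne _ p.2); positivity)] with t ht
    linarith [ht.2]
  obtain ⟨s, hs, hs0⟩ := (e1.and self_mem_nhdsWithin).exists
  obtain ⟨t, ht, ht0⟩ := (e2.and self_mem_nhdsWithin).exists
  refine ⟨⟨χ, s, t, ht0, fun p => (hρ p).mono hs0 (hs p).1, fun p => (hs p).2.1,
    fun p q hpq => ?_, ht, h.fin, hs0⟩⟩
  refine (hdis p.2 q.2 fun e => hpq (Subtype.ext e)).mono ?_ ?_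
  · rintro _ ⟨u, hu, rfl⟩; exact (hs p).2.2 u hu
  · rintro _ ⟨u, hu, rfl⟩; exact (hs q).2.2 u hu

/-- The vector field on the ambient space given in chart coordinates by `A`. -/
def Chart.field {p : Fin n → ℂ} (χ : Chart Y d p) (A : (Fin d → ℂ) → (Fin d → ℂ))
    (x : Fin n → ℂ) : Fin n → ℂ :=
  fderiv ℂ χ.ψ (χ.L (x - p)) (A (χ.L (x - p)))

lemma Chart.isOpen_preimage {p : Fin n → ℂ} (χ : Chart Y d p) {U : Set (Fin d → ℂ)}
    (hU : IsOpen U) : IsOpen {x | χ.L (x - p) ∈ U} :=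
  hU.preimage (χ.L.continuous.comp (continuous_id.sub continuous_const))

lemma Chart.contDiffOn_field {p : Fin n → ℂ} (χ : Chart Y d p) {A : (Fin d → ℂ) → (Fin d → ℂ)}
    (hA : ContDiff ℝ ∞ A) : ContDiffOn ℝ ∞ (χ.field A) {x | χ.L (x - p) ∈ χ.U} := by
  intro x hx
  apply ContDiffAt.contDiffWithinAt
  have h1 : ContDiffAt ℂ ∞ (fderiv ℂ χ.ψ) (χ.L (x - p)) :=
    (χ.contDiffAt hx).fderiv_right (m := ∞) (by simp)
  have h2 : ContDiffAt ℝ ∞ (fun x => χ.L (x - p)) x :=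
    (χ.L.restrictScalars ℝ).contDiff.contDiffAt.comp x (contDiffAt_id.sub contDiffAt_const)
  have h3 := (h1.restrict_scalars ℝ).comp x h2
  let B := ContinuousLinearMap.restrictScalarsL ℂ (Fin d → ℂ) (Fin n → ℂ) ℝ ℝ
  have h4 : ContDiffAt ℝ ∞ (fun x => B (fderiv ℂ χ.ψ (χ.L (x - p)))) x :=
    B.contDiff.contDiffAt.comp x h3
  exact h4.clm_apply (hA.contDiffAt.comp x h2)

lemma Chart.field_mem {p : Fin n → ℂ} (χ : Chart Y d p) (A : (Fin d → ℂ) → (Fin d → ℂ))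
    {x : Fin n → ℂ} (hx : x ∈ Y) (hO : x ∈ χ.O) : χ.field A x ∈ zTangent Y x := by
  obtain ⟨h1, h2⟩ := χ.right x ⟨hx, hO⟩
  have := χ.tan _ h1 (A (χ.L (x - p)))
  rwa [h2] at this

lemma Chart.field_map {p : Fin n → ℂ} (χ : Chart Y d p) (A : (Fin d → ℂ) → (Fin d → ℂ))
    {u : Fin d → ℂ} (hu : u ∈ χ.U) : χ.field A (χ.ψ u) = fderiv ℂ χ.ψ u (A u) := by
  rw [Chart.field, χ.left u hu]

lemma Chart.field_base {p : Fin n → ℂ} (χ : Chart Y d p) {w : Fin n → ℂ} (hw : w ∈ zTangent Y p) :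
    χ.field (fun _ => χ.L w) p = w := by
  have := χ.tan' 0 χ.zero_mem w (by rwa [χ.map_zero])
  rw [Chart.field, sub_self, _root_.map_zero χ.L, this]

end MorseField

end

section

open scoped ContDiff

section MorseField

variable {n d : ℕ} {Y : Set (Fin n → ℂ)} {f : MvPolynomial (Fin n) ℂ}

/-- Half of the derivative of `‖f‖ ^ 2` at `x` in the direction `v`. -/
def slope (f : MvPolynomial (Fin n) ℂ) (x v : Fin n → ℂ) : ℝ :=
  ((starRingEnd ℂ) (MvPolynomial.eval x f) * pd f x v).re

lemma continuous_eval_poly (f : MvPolynomial (Fin n) ℂ) :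
    Continuous fun x : Fin n → ℂ => MvPolynomial.eval x f :=
  (contDiff_eval f (N := 1)).continuous

lemma slope_comb (f : MvPolynomial (Fin n) ℂ) (x v w : Fin n → ℂ) (a b : ℝ) :
    slope f x (a • v + b • w) = a * slope f x v + b * slope f x w := by
  simp only [slope]
  rw [map_add, ← Complex.coe_smul, ← Complex.coe_smul, map_smul, map_smul, smul_eq_mul,
    smul_eq_mul]
  simp only [Complex.add_re, Complex.mul_re, Complex.mul_im, Complex.ofReal_re, Complex.ofReal_im,
    Complex.add_im]
  ring

lemma slope_zero (f : MvPolynomial (Fin n) ℂ) (x : Fin n → ℂ) : slope f x 0 = 0 := by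
  simp [slope]

lemma ContinuousAt.slope (f : MvPolynomial (Fin n) ℂ) {v : (Fin n → ℂ) → (Fin n → ℂ)}
    {x : Fin n → ℂ} (hv : ContinuousAt v x) : ContinuousAt (fun x => PaperED.slope f x (v x)) x := by
  have h1 : ContinuousAt (fun x => pd f x (v x)) x :=
    ((contDiff_pd f (N := 1)).continuous.continuousAt).clm_apply hv
  exact Complex.continuous_re.continuousAt.comp
    ((Complex.continuous_conj.comp (continuous_eval_poly f)).continuousAt.mul h1)

/-- The requirements on the Morse vector field at a point. -/
structure FieldCond (D : MorseSetup Y d f) (B : Set (Fin d → ℂ)) (δ R C : ℝ)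
    (x v : Fin n → ℂ) : Prop where
  tan : x ∈ Y → v ∈ zTangent Y x
  slope_nonpos : x ∈ Y → slope f x v ≤ 0
  zero : ‖MvPolynomial.eval x f‖ ≤ D.e₀ / 2 → v = 0
  slope_le : x ∈ Y → D.e₀ ≤ ‖MvPolynomial.eval x f‖ → (∀ p, x ∉ (D.χ p).ψ '' B) →
    slope f x v ≤ -δ
  chart : ∀ p, ∀ u ∈ B, x = (D.χ p).ψ u → v = fderiv ℂ (D.χ p).ψ u (-star u)
  bound : R ≤ ‖x‖ → ‖v‖ ≤ C

lemma FieldCond.convex (D : MorseSetup Y d f) (B : Set (Fin d → ℂ)) (δ R C : ℝ)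
    (x : Fin n → ℂ) : Convex ℝ {v | FieldCond D B δ R C x v} := by
  intro v hv w hw a b ha hb hab
  have hab' : b = 1 - a := by linarith
  refine ⟨fun hx => ?_, fun hx => ?_, fun h => ?_, fun hx h1 h2 => ?_, fun p u hu e => ?_,
    fun h => ?_⟩
  · exact add_mem (((zTangent Y x).restrictScalars ℝ).smul_mem a (hv.tan hx))
      (((zTangent Y x).restrictScalars ℝ).smul_mem b (hw.tan hx))
  · rw [slope_comb]
    have := hv.slope_nonpos hx
    have := hw.slope_nonpos hx
    nlinarith
  · rw [hv.zero h, hw.zero h]; simp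
  · rw [slope_comb]
    have := hv.slope_le hx h1 h2
    have := hw.slope_le hx h1 h2
    subst hab'
    nlinarith
  · rw [hv.chart p u hu e, hw.chart p u hu e, ← add_smul, hab, one_smul]
  · have h1 := hv.bound h
    have h2 := hw.bound h
    refine (norm_add_le _ _).trans ?_
    rw [norm_smul, norm_smul, Real.norm_of_nonneg ha, Real.norm_of_nonneg hb]
    subst hab'
    nlinarith

lemma MorseSetup.map_mem (D : MorseSetup Y d f) (p : critSet Y f) {u : Fin d → ℂ}
    (hu : u ∈ Metric.ball 0 D.ρ) : (D.χ p).ψ u ∈ Y :=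
  ((D.χ p).mem u (D.sub p hu)).1

lemma MorseSetup.slope_le (D : MorseSetup Y d f) (p : critSet Y f) {u : Fin d → ℂ}
    (hu : ‖u‖ < D.ρ) :
    slope f ((D.χ p).ψ u) (fderiv ℂ (D.χ p).ψ u (-star u)) ≤
      -(‖MvPolynomial.eval p.1 f‖ * sqn u) := by
  have h1 := (D.est p).est' u hu
  have h2 : u ∈ (D.χ p).U := D.sub p (by simpa using hu)
  rw [Chart.fderiv_pull _ _ h2] at h1
  have h3 : (D.χ p).pull f 0 = MvPolynomial.eval p.1 f := by simp [Chart.pull, (D.χ p).map_zero]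
  rw [h3] at h1
  simp only [slope, map_neg, mul_neg, Complex.neg_re]
  exact neg_le_neg h1

theorem MorseSetup.exists_field (D : MorseSetup Y d f) (hY : IsClosed Y)
    (hch : ∀ p ∈ Y, Nonempty (Chart Y d p))
    (htame : ∃ R C : ℝ, ∀ x ∈ Y, R < ‖x‖ → ∃ w ∈ zTangent Y x, ‖w‖ ≤ C ∧ pd f x w = 1)
    {B : Set (Fin d → ℂ)} (hB : IsCompact B) (hBρ : B ⊆ Metric.ball 0 D.ρ) (h0 : 0 ∈ B)
    (hB2 : ∀ p, ∀ u ∈ B, 2 * D.e₀ ≤ ‖MvPolynomial.eval ((D.χ p).ψ u) f‖)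
    {σ : ℝ} (hσ : 0 < σ) (hBσ : ∀ u ∉ B, σ ≤ sqn u) :
    ∃ δ > 0, ∃ C : ℝ, ∃ v : (Fin n → ℂ) → (Fin n → ℂ), ContDiff ℝ 1 v ∧ (∀ x, ‖v x‖ ≤ C) ∧
      ∃ R' C', ∀ x, FieldCond D B δ R' C' x (v x) := by
  classical
  have hfinc : Finite (critSet Y f) := D.fin
  obtain ⟨R, C, htame⟩ := htame
  have he := D.pos
  set δ : ℝ := min (1 / 2) (3 * D.e₀ * σ) with hδ
  have hδ0 : 0 < δ := lt_min (by norm_num) (by positivity)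
  -- the compact chart pieces
  have hψc : ∀ p, ContinuousOn (D.χ p).ψ B := fun p u hu =>
    ((D.χ p).contDiffAt (D.sub p (hBρ hu))).continuousAt.continuousWithinAt
  have hKc : IsCompact (⋃ p, (D.χ p).ψ '' B) :=
    isCompact_iUnion fun p => hB.image_of_continuousOn (hψc p)
  obtain ⟨R₁, hR₁⟩ := hKc.isBounded.subset_ball 0
  set R' : ℝ := max R R₁ + 1 with hR'
  set C' : ℝ := |C| / D.e₀ + 1 with hC'
  have hC'0 : 0 ≤ C' := by positivity
  have hcont := continuous_eval_poly f
  have hloc : ∀ x₀ : Fin n → ℂ, ∃ U ∈ 𝓝 x₀, ∃ g : (Fin n → ℂ) → (Fin n → ℂ),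
      ContMDiffOn 𝓘(ℝ, Fin n → ℂ) 𝓘(ℝ, Fin n → ℂ) ∞ g U ∧
        ∀ y ∈ U, g y ∈ {v | FieldCond D B δ R' C' y v} := by
    intro x₀
    by_cases hx₀ : x₀ ∈ Y
    swap
    · refine ⟨Yᶜ, hY.isOpen_compl.mem_nhds hx₀, fun _ => 0, contMDiffOn_const, fun y hy => ?_⟩
      refine ⟨fun h => absurd h hy, fun h => absurd h hy, fun _ => rfl, fun h => absurd h hy,
        fun p u hu e => ?_, fun _ => by simpa using hC'0⟩
      exact absurd (e ▸ D.map_mem p (hBρ hu)) hy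
    rcases lt_or_ge ‖MvPolynomial.eval x₀ f‖ D.e₀ with hlt | hge
    · refine ⟨{y | ‖MvPolynomial.eval y f‖ < D.e₀},
        (isOpen_lt (f := fun y : Fin n → ℂ => ‖MvPolynomial.eval y f‖) hcont.norm
          continuous_const).mem_nhds hlt, fun _ => 0, contMDiffOn_const, fun y hy => ?_⟩
      refine ⟨fun _ => zero_mem _, fun _ => (slope_zero f y).le, fun _ => rfl,
        fun _ h => absurd h (not_le.2 hy), fun p u hu e => ?_, fun _ => by simpa using hC'0⟩
      have h2 := hB2 p u hu
      rw [← e] at h2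
      have h3 : ‖MvPolynomial.eval y f‖ < D.e₀ := hy
      linarith
    have hf0 : ∀ᶠ y in 𝓝 x₀, D.e₀ / 2 < ‖MvPolynomial.eval y f‖ :=
      hcont.norm.continuousAt.eventually (lt_mem_nhds (by linarith))
    by_cases hK : x₀ ∈ ⋃ p, (D.χ p).ψ '' B
    · obtain ⟨p, u₀, hu₀, rfl⟩ := Set.mem_iUnion.1 hK
      set χ := D.χ p with hχ
      have hu₀U := D.sub p (hBρ hu₀)
      have hL0 : χ.L (χ.ψ u₀ - p.1) = u₀ := χ.left u₀ hu₀U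
      have e1 : ∀ᶠ y in 𝓝 (χ.ψ u₀), χ.L (y - p.1) ∈ Metric.ball 0 D.ρ :=
        (χ.isOpen_preimage Metric.isOpen_ball).mem_nhds (by
          show χ.L (χ.ψ u₀ - p.1) ∈ Metric.ball 0 D.ρ
          rw [hL0]; exact hBρ hu₀)
      have e2 : ∀ᶠ y in 𝓝 (χ.ψ u₀), y ∈ χ.O := χ.isOpen_O.mem_nhds (χ.mem u₀ hu₀U).2
      have e3 : ∀ᶠ y in 𝓝 (χ.ψ u₀), ‖y‖ < R' := by
        refine continuous_norm.continuousAt.eventually (gt_mem_nhds ?_)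
        have := hR₁ hK
        rw [mem_ball_zero_iff] at this
        have := le_max_right R R₁
        linarith
      refine ⟨{y | (D.e₀ / 2 < ‖MvPolynomial.eval y f‖ ∧ χ.L (y - p.1) ∈ Metric.ball 0 D.ρ) ∧
        y ∈ χ.O ∧ ‖y‖ < R'}, (hf0.and e1).and (e2.and e3), χ.field (fun u => -star u), ?_, ?_⟩
      · have hA : ContDiff ℝ ∞ (fun u : Fin d → ℂ => -star u) :=
          ((starL' ℝ : (Fin d → ℂ) ≃L[ℝ] (Fin d → ℂ)).contDiff).neg
        exact ((χ.contDiffOn_field hA).mono fun y hy => D.sub p hy.1.2).contMDiffOn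
      · rintro y ⟨⟨hy1, hy2⟩, hy3, hy4⟩
        have key : ∀ h : y ∈ Y, ∃ u ∈ Metric.ball 0 D.ρ, y = χ.ψ u := fun h =>
          ⟨χ.L (y - p.1), hy2, (χ.right y ⟨h, hy3⟩).2.symm⟩
        refine ⟨fun h => χ.field_mem _ h hy3, fun h => ?_, fun h => absurd h (not_le.2 hy1),
          fun h _ hnK => ?_, fun q u hu e => ?_, fun h => absurd h (not_le.2 hy4)⟩
        · obtain ⟨u, hu, rfl⟩ := key h
          rw [χ.field_map _ (D.sub p hu)]
          refine (D.slope_le p (by simpa using hu)).trans ?_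
          have := sqn_nonneg u
          have := norm_nonneg (MvPolynomial.eval p.1 f)
          simp only [Left.neg_nonpos_iff]
          positivity
        · obtain ⟨u, hu, rfl⟩ := key h
          rw [χ.field_map _ (D.sub p hu)]
          refine (D.slope_le p (by simpa using hu)).trans (neg_le_neg ?_)
          have huB : u ∉ B := fun huB => hnK p ⟨u, huB, rfl⟩
          refine (min_le_right _ _).trans ?_
          exact mul_le_mul (D.lt p).le (hBσ u huB) hσ.le (norm_nonneg _)
        · have hyY : y ∈ Y := e ▸ D.map_mem q (hBρ hu)
          obtain ⟨u', hu', e'⟩ := key hyY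
          have hqp : q = p := by
            by_contra hne
            exact Set.disjoint_left.1 (D.disj q p hne) ⟨u, hBρ hu, rfl⟩
              ⟨u', hu', by rw [← e, e']⟩
          subst hqp
          rw [e, χ.field_map _ (D.sub q (hBρ hu))]
    · -- a regular point
      have hcrit : x₀ ∉ critSet Y f := fun h => hK (Set.mem_iUnion.2
        ⟨⟨x₀, h⟩, 0, h0, (D.χ ⟨x₀, h⟩).map_zero⟩)
      have hw : ∃ w ∈ zTangent Y x₀, pd f x₀ w = 1 ∧ (R' ≤ ‖x₀‖ → ‖w‖ ≤ C) := by
        by_cases hR : R' ≤ ‖x₀‖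
        · obtain ⟨w, hw1, hw2, hw3⟩ := htame x₀ hx₀ (by
            have := le_max_left R R₁; linarith)
          exact ⟨w, hw1, hw3, fun _ => hw2⟩
        · have : ∃ w ∈ zTangent Y x₀, pd f x₀ w ≠ 0 := by
            by_contra! h
            exact hcrit ⟨hx₀, h⟩
          obtain ⟨w, hw1, hw2⟩ := this
          exact ⟨(pd f x₀ w)⁻¹ • w, Submodule.smul_mem _ _ hw1, by
            rw [map_smul, smul_eq_mul, inv_mul_cancel₀ hw2], fun h => absurd h hR⟩
      obtain ⟨w, hwT, hw1, hwC⟩ := hw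
      obtain ⟨χ⟩ := hch x₀ hx₀
      have hfn : 0 < ‖MvPolynomial.eval x₀ f‖ := he.trans_le hge
      set c : ℂ := -(MvPolynomial.eval x₀ f / (‖MvPolynomial.eval x₀ f‖ : ℂ) ^ 2) with hc
      have hcw : c • w ∈ zTangent Y x₀ := Submodule.smul_mem _ _ hwT
      have hv0 := χ.field_base hcw
      set g := χ.field (fun _ => χ.L (c • w)) with hg
      have hU0 : χ.L (x₀ - x₀) ∈ χ.U := by rw [sub_self, _root_.map_zero χ.L]; exact χ.zero_mem
      have hUo := χ.isOpen_preimage χ.isOpen_U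
      have hgs : ContDiffOn ℝ ∞ g {x | χ.L (x - x₀) ∈ χ.U} := χ.contDiffOn_field contDiff_const
      have hgc : ContinuousAt g x₀ := (hgs.continuousOn).continuousAt (hUo.mem_nhds hU0)
      have hcn : ‖c‖ = ‖MvPolynomial.eval x₀ f‖⁻¹ := by
        rw [hc, norm_neg, norm_div, norm_pow, Complex.norm_real, norm_norm]
        field_simp
      have hs0 : slope f x₀ (g x₀) = -1 := by
        rw [hv0, slope, map_smul, hw1, smul_eq_mul, mul_one, hc, mul_neg, ← mul_div_assoc,
          mul_comm _ (MvPolynomial.eval x₀ f), Complex.mul_conj, Complex.normSq_eq_norm_sq]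
        have : ((‖MvPolynomial.eval x₀ f‖ : ℂ)) ≠ 0 := by exact_mod_cast hfn.ne'
        push_cast
        rw [div_self (pow_ne_zero 2 this)]
        simp
      have e1 : ∀ᶠ y in 𝓝 x₀, slope f y (g y) < -(1 / 2) :=
        (ContinuousAt.slope f hgc).eventually (gt_mem_nhds (by
          show slope f x₀ (g x₀) < _
          rw [hs0]; norm_num))
      have e2 : ∀ᶠ y in 𝓝 x₀, R' ≤ ‖y‖ → ‖g y‖ ≤ C' := by
        by_cases hR : R' ≤ ‖x₀‖
        · have h5 : ‖g x₀‖ < C' := by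
            rw [hv0, norm_smul, hcn]
            have h6 := (hwC hR).trans (le_abs_self C)
            have h7 : ‖MvPolynomial.eval x₀ f‖⁻¹ ≤ D.e₀⁻¹ := inv_anti₀ he hge
            have h8 : ‖MvPolynomial.eval x₀ f‖⁻¹ * ‖w‖ ≤ D.e₀⁻¹ * |C| :=
              mul_le_mul h7 h6 (norm_nonneg _) (by positivity)
            rw [hC', div_eq_inv_mul]
            linarith
          filter_upwards [hgc.norm.eventually (gt_mem_nhds h5)] with y hy _ using le_of_lt hy
        · filter_upwards [continuous_norm.continuousAt.eventually (gt_mem_nhds (not_le.1 hR))]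
            with y hy h using absurd h (not_le.2 hy)
      have e3 : ∀ᶠ y in 𝓝 x₀, y ∉ ⋃ p, (D.χ p).ψ '' B :=
        hKc.isClosed.isOpen_compl.mem_nhds hK
      have e4 : ∀ᶠ y in 𝓝 x₀, y ∈ χ.O := χ.isOpen_O.mem_nhds χ.base_mem
      have e5 : ∀ᶠ y in 𝓝 x₀, χ.L (y - x₀) ∈ χ.U := hUo.mem_nhds hU0
      refine ⟨{y | ((D.e₀ / 2 < ‖MvPolynomial.eval y f‖ ∧ slope f y (g y) < -(1 / 2)) ∧
        (R' ≤ ‖y‖ → ‖g y‖ ≤ C') ∧ y ∉ ⋃ p, (D.χ p).ψ '' B) ∧ y ∈ χ.O ∧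
          χ.L (y - x₀) ∈ χ.U}, ((hf0.and e1).and (e2.and e3)).and
          (e4.and e5), g,
          (hgs.mono fun y hy => hy.2.2).contMDiffOn, ?_⟩
      rintro y ⟨⟨⟨hy1, hy2⟩, hy3, hy4⟩, hy5, hy6⟩
      refine ⟨fun h => χ.field_mem _ h hy5, fun _ => by linarith, fun h => absurd h (not_le.2 hy1),
        fun _ _ _ => hy2.le.trans (neg_le_neg (min_le_left _ _)), fun q u hu e => ?_, hy3⟩
      exact (hy4 (Set.mem_iUnion_of_mem q ⟨u, hu, e.symm⟩)).elim
  obtain ⟨v, hv⟩ := exists_contMDiffMap_forall_mem_convex_of_local 𝓘(ℝ, Fin n → ℂ)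
    (FieldCond.convex D B δ R' C') hloc
  have hvs : ContDiff ℝ ∞ v := contMDiff_iff_contDiff.1 v.contMDiff
  obtain ⟨M, hM⟩ := (isCompact_closedBall (0 : Fin n → ℂ) R').exists_bound_of_continuousOn
    hvs.continuous.continuousOn
  refine ⟨δ, hδ0, max M C', v, hvs.of_le (by simp), fun x => ?_, R', C', hv⟩
  rcases le_total R' ‖x‖ with h | h
  · exact ((hv x).bound h).trans (le_max_right _ _)
  · exact (hM x (by simpa using h)).trans (le_max_left _ _)

end MorseField

end

section

open scoped ContDiff

section MorseCount

variable {n d : ℕ} {Y : Set (Fin n → ℂ)} {f : MvPolynomial (Fin n) ℂ}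

/-- A splitting of `ℂ^d` into real and imaginary parts. -/
structure RealCoord (F : Type) [NormedAddCommGroup F] [NormedSpace ℝ F]
    (J : (F × F) ≃L[ℝ] (Fin d → ℂ)) : Prop where
  sqn : ∀ x y, PaperED.sqn (J (x, y)) = ‖x‖ ^ 2 + ‖y‖ ^ 2
  re : ∀ x y, (∑ i, J (x, y) i * J (x, y) i).re = ‖x‖ ^ 2 - ‖y‖ ^ 2
  star : ∀ x y, Star.star (J (x, y)) = J (x, -y)

lemma exists_realCoord (d : ℕ) :
    ∃ J : (EuclideanSpace ℝ (Fin d) × EuclideanSpace ℝ (Fin d)) ≃L[ℝ] (Fin d → ℂ),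
      RealCoord (EuclideanSpace ℝ (Fin d)) J := by
  let J₀ : (EuclideanSpace ℝ (Fin d) × EuclideanSpace ℝ (Fin d)) ≃ₗ[ℝ] (Fin d → ℂ) :=
    { toFun := fun z i => ⟨z.1 i, z.2 i⟩
      invFun := fun u => (WithLp.toLp 2 fun i => (u i).re, WithLp.toLp 2 fun i => (u i).im)
      map_add' := fun z w => by ext i; apply Complex.ext <;> simp
      map_smul' := fun a z => by ext i; apply Complex.ext <;> simp
      left_inv := fun z => by rfl
      right_inv := fun u => by rfl }
  refine ⟨J₀.toContinuousLinearEquiv, ⟨fun x y => ?_, fun x y => ?_, fun x y => ?_⟩⟩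
  · rw [EuclideanSpace.norm_sq_eq, EuclideanSpace.norm_sq_eq, ← Finset.sum_add_distrib]
    refine Finset.sum_congr rfl fun i _ => ?_
    show Complex.normSq ⟨x i, y i⟩ = _
    rw [Complex.normSq_mk, Real.norm_eq_abs, Real.norm_eq_abs, sq_abs, sq_abs]; ring
  · rw [EuclideanSpace.norm_sq_eq, EuclideanSpace.norm_sq_eq, ← Finset.sum_sub_distrib,
      Complex.re_sum]
    refine Finset.sum_congr rfl fun i _ => ?_
    show ((⟨x i, y i⟩ : ℂ) * ⟨x i, y i⟩).re = _
    rw [Complex.mul_re, Real.norm_eq_abs, Real.norm_eq_abs, sq_abs, sq_abs]; ring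
  · rfl

lemma hasDerivAt_norm_sq_eval {γ : ℝ → (Fin n → ℂ)} {w : Fin n → ℂ} {t : ℝ}
    (h : HasDerivAt γ w t) :
    HasDerivAt (fun t => ‖MvPolynomial.eval (γ t) f‖ ^ 2) (2 * slope f (γ t) w) t := by
  have h1 : HasFDerivAt (fun x => MvPolynomial.eval x f) ((pd f (γ t)).restrictScalars ℝ) (γ t) :=
    (hasFDerivAt_eval f (γ t)).restrictScalars ℝ
  have h2 := (h1.comp_hasDerivAt t h).norm_sq
  have e : inner ℝ (MvPolynomial.eval (γ t) f) (pd f (γ t) w) = slope f (γ t) w := by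
    rw [Complex.inner, slope, mul_comm]
  rw [← e]
  exact h2

lemma le_sub_mul_of_hasDerivAt {S S' : ℝ → ℝ} {c : ℝ} (h : ∀ t, HasDerivAt S (S' t) t)
    (hc : ∀ t, 0 ≤ t → S' t ≤ -c) {t : ℝ} (ht : 0 ≤ t) : S t ≤ S 0 - c * t := by
  have := (convex_Ici (0 : ℝ)).image_sub_le_mul_sub_of_deriv_le (f := S) (C := -c)
    (fun t _ => (h t).continuousAt.continuousWithinAt)
    (fun t _ => (h t).differentiableAt.differentiableWithinAt)
    (fun t ht => by
      rw [interior_Ici] at ht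
      rw [(h t).deriv]; exact hc t (le_of_lt ht)) 0 (by simp) t ht ht
  linarith

section Charts
variable {F : Type} [NormedAddCommGroup F] [NormedSpace ℝ F]

lemma RealCoord.norm_lt {J : (F × F) ≃L[ℝ] (Fin d → ℂ)} (hJ : RealCoord F J) {r ρ : ℝ}
    (hρ : 0 < ρ) (hr : 2 * r ^ 2 < ρ ^ 2) {x y : F} (hx : ‖x‖ ≤ r) (hy : ‖y‖ ≤ r) :
    ‖J (x, y)‖ < ρ := by
  have h1 := norm_sq_le_sqn (J (x, y))
  rw [hJ.sqn] at h1
  have := norm_nonneg x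
  have := norm_nonneg y
  refine lt_of_pow_lt_pow_left₀ 2 hρ.le ?_
  nlinarith

/-- A Morse chart with values in `Y`, in real coordinates. -/
def MorseSetup.ψ (D : MorseSetup Y d f) (J : (F × F) ≃L[ℝ] (Fin d → ℂ)) (p : critSet Y f)
    (u : F × F) : ↥Y :=
  open Classical in
  if h : J u ∈ Metric.ball 0 D.ρ then ⟨(D.χ p).ψ (J u), D.map_mem p h⟩ else ⟨p.1, p.2.1⟩

lemma MorseSetup.ψ_val (D : MorseSetup Y d f) (J : (F × F) ≃L[ℝ] (Fin d → ℂ)) (p : critSet Y f)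
    {u : F × F} (h : J u ∈ Metric.ball 0 D.ρ) : (D.ψ J p u).1 = (D.χ p).ψ (J u) := by
  rw [MorseSetup.ψ, dif_pos h]

lemma MorseSetup.isOpenEmbedding (D : MorseSetup Y d f) (J : (F × F) ≃L[ℝ] (Fin d → ℂ))
    (p : critSet Y f) {S : Set (F × F)} (hS : IsOpen S)
    (hSρ : ∀ u ∈ S, J u ∈ Metric.ball 0 D.ρ) :
    Topology.IsOpenEmbedding (fun u : ↥S => D.ψ J p u.1) := by
  have hU : ∀ u ∈ S, J u ∈ (D.χ p).U := fun u hu => D.sub p (hSρ u hu)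
  have hval : ∀ u : ↥S, (D.ψ J p u.1).1 = (D.χ p).ψ (J u.1) := fun u => D.ψ_val J p (hSρ _ u.2)
  refine Topology.IsOpenEmbedding.of_continuous_injective_isOpenMap ?_ ?_ ?_
  · refine continuous_induced_rng.2 (continuous_iff_continuousAt.2 fun u => ?_)
    have h1 : ContinuousAt (fun u : ↥S => (D.χ p).ψ (J u.1)) u :=
      ContinuousAt.comp (f := fun u : ↥S => J u.1) ((D.χ p).contDiffAt (hU _ u.2)).continuousAt
        (J.continuous.comp continuous_subtype_val).continuousAt
    exact h1.congr (Eventually.of_forall fun u => (hval u).symm)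
  · intro u v e
    have e1 : (D.χ p).ψ (J u.1) = (D.χ p).ψ (J v.1) := by
      rw [← hval, ← hval]; exact congrArg Subtype.val e
    have e2 : J u.1 = J v.1 := by
      rw [← (D.χ p).left _ (hU _ u.2), ← (D.χ p).left _ (hU _ v.2), e1]
    exact Subtype.ext (J.injective e2)
  · intro V hV
    obtain ⟨V', hV', rfl⟩ := isOpen_induced_iff.1 hV
    have hWo : IsOpen ((D.χ p).O ∩ {x | (D.χ p).L (x - p.1) ∈ J.symm ⁻¹' (S ∩ V')}) :=
      (D.χ p).isOpen_O.inter
        ((D.χ p).isOpen_preimage ((hS.inter hV').preimage J.symm.continuous))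
    refine isOpen_induced_iff.2 ⟨_, hWo, ?_⟩
    ext y
    constructor
    · rintro ⟨hy1, hy2, hy3⟩
      refine ⟨⟨_, hy2⟩, hy3, Subtype.ext ?_⟩
      rw [hval]
      simp only [ContinuousLinearEquiv.apply_symm_apply]
      exact ((D.χ p).right _ ⟨y.2, hy1⟩).2
    · rintro ⟨u, hu, rfl⟩
      refine ⟨?_, ?_⟩
      · rw [hval]; exact ((D.χ p).mem _ (hU _ u.2)).2
      · show J.symm ((D.χ p).L ((D.ψ J p u.1).1 - p.1)) ∈ S ∩ V'
        rw [hval, (D.χ p).left _ (hU _ u.2), J.symm_apply_apply]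
        exact ⟨u.2, hu⟩

end Charts

end MorseCount

end

section

open scoped ContDiff

section MorseCount

variable {n d : ℕ} {Y : Set (Fin n → ℂ)} {f : MvPolynomial (Fin n) ℂ}
variable {F : Type} [NormedAddCommGroup F] [NormedSpace ℝ F]

lemma MorseSetup.saddleChart (D : MorseSetup Y d f) {J : (F × F) ≃L[ℝ] (Fin d → ℂ)}
    (hJ : RealCoord F J) {r : ℝ} (hr : 2 * r ^ 2 < D.ρ ^ 2)
    {v : (Fin n → ℂ) → (Fin n → ℂ)} (hv : ContDiff ℝ 1 v) {Φ : CFlow ↥Y}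
    (hΦ : ∀ y t, HasDerivAt (fun t => (Φ.toFun t y).1) (v (Φ.toFun t y).1) t)
    (p : critSet Y f)
    (hvp : ∀ x y, ‖x‖ < r → ‖y‖ < r → v ((D.χ p).ψ (J (x, y))) =
      fderiv ℂ (D.χ p).ψ (J (x, y)) (-star (J (x, y)))) :
    Φ.SaddleChart r (D.ψ J p) := by
  have hball : ∀ u ∈ obox F F r r, J u ∈ Metric.ball 0 D.ρ := fun u hu => by
    rw [mem_ball_zero_iff]; exact hJ.norm_lt D.ρpos hr hu.1.le hu.2.le
  refine ⟨D.isOpenEmbedding J p (isOpen_obox r r) hball, fun x y t ht hx hy => ?_⟩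
  have hc1 : Continuous fun s : ℝ => Real.exp (-s) * ‖x‖ := by fun_prop
  have hc2 : Continuous fun s : ℝ => Real.exp s * ‖y‖ := by fun_prop
  have hx0 : ∀ s, 0 ≤ s → Real.exp (-s) * ‖x‖ < r := fun s hs => lt_of_le_of_lt
    (mul_le_of_le_one_left (norm_nonneg _) (Real.exp_le_one_iff.2 (by linarith))) hx
  have hev1 : ∀ᶠ s in 𝓝 (0 : ℝ), Real.exp (-s) * ‖x‖ < r :=
    hc1.continuousAt.eventually (gt_mem_nhds (hx0 0 le_rfl))
  have hev2 : ∀ᶠ s in 𝓝 t, Real.exp s * ‖y‖ < r :=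
    hc2.continuousAt.eventually (gt_mem_nhds hy)
  obtain ⟨ε, hε, h1⟩ := Metric.eventually_nhds_iff.1 hev1
  obtain ⟨ε', hε', h2⟩ := Metric.eventually_nhds_iff.1 hev2
  have k1 : ∀ s, -ε < s → Real.exp (-s) * ‖x‖ < r := fun s hs => by
    rcases le_total 0 s with h | h
    · exact hx0 s h
    · exact h1 (by rw [Real.dist_eq, sub_zero, abs_of_nonpos h]; linarith)
  have k2 : ∀ s, s < t + ε' → Real.exp s * ‖y‖ < r := fun s hs => by
    rcases le_total s t with h | h
    · refine lt_of_le_of_lt ?_ hy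
      have := Real.exp_le_exp.2 h
      gcongr
    · exact h2 (by rw [Real.dist_eq, abs_of_nonneg (by linarith)]; linarith)
  have hn1 : ∀ s, -ε < s → ‖Real.exp (-s) • x‖ < r := fun s hs => by
    rw [norm_smul, Real.norm_of_nonneg (Real.exp_pos _).le]; exact k1 s hs
  have hn2 : ∀ s, s < t + ε' → ‖Real.exp s • y‖ < r := fun s hs => by
    rw [norm_smul, Real.norm_of_nonneg (Real.exp_pos _).le]; exact k2 s hs
  have hb : ∀ s ∈ Set.Ioo (-ε) (t + ε'),
      J (Real.exp (-s) • x, Real.exp s • y) ∈ Metric.ball 0 D.ρ := fun s hs =>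
    hball (Real.exp (-s) • x, Real.exp s • y) ⟨hn1 s hs.1, hn2 s hs.2⟩
  have key := integralCurve_unique hv (a := -ε) (b := t + ε') (t₀ := 0)
    (γ := fun s => (Φ.toFun s (D.ψ J p (x, y))).1)
    (γ' := fun s => (D.χ p).ψ (J (Real.exp (-s) • x, Real.exp s • y)))
    ⟨by linarith, by linarith⟩ (fun s _ => hΦ _ s) (fun s hs => by
      have e1 : HasDerivAt (fun s : ℝ => Real.exp (-s) • x) (-(Real.exp (-s) • x)) s := by
        have := ((hasDerivAt_neg s).exp).smul_const x
        convert this using 1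
        simp
      have e2 : HasDerivAt (fun s : ℝ => Real.exp s • y) (Real.exp s • y) s :=
        (Real.hasDerivAt_exp s).smul_const y
      have e3 := (J : (F × F) →L[ℝ] (Fin d → ℂ)).hasFDerivAt.comp_hasDerivAt s (e1.prodMk e2)
      have e4 := (((D.χ p).hasFDerivAt (D.sub p (hb s hs))).restrictScalars ℝ).comp_hasDerivAt s e3
      rw [hvp _ _ (hn1 s hs.1) (hn2 s hs.2)]
      have e5 : -star (J (Real.exp (-s) • x, Real.exp s • y)) =
          J (-(Real.exp (-s) • x), Real.exp s • y) := by
        rw [hJ.star, ← map_neg]; simp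
      rw [e5]
      exact e4)
    (by
      simp only [Φ.zero, neg_zero, Real.exp_zero, one_smul]
      rw [D.ψ_val]
      have := hb 0 ⟨by linarith, by linarith⟩
      simpa using this)
    (show t ∈ Set.Ioo (-ε) (t + ε') from ⟨by linarith, by linarith⟩)
  refine Subtype.ext ?_
  rw [D.ψ_val J p (hb t ⟨by linarith, by linarith⟩)]
  exact key

lemma MorseSetup.abs_sub_le (D : MorseSetup Y d f) {J : (F × F) ≃L[ℝ] (Fin d → ℂ)}
    (hJ : RealCoord F J) {r : ℝ} (hr : 2 * r ^ 2 < D.ρ ^ 2) (p : critSet Y f) {x y : F}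
    (hx : ‖x‖ ≤ r) (hy : ‖y‖ ≤ r) :
    |‖MvPolynomial.eval ((D.χ p).ψ (J (x, y))) f‖ - ‖MvPolynomial.eval p.1 f‖ -
      ‖x‖ ^ 2 + ‖y‖ ^ 2| ≤ (‖x‖ ^ 2 + ‖y‖ ^ 2) / 4 := by
  have h := (D.est p).est _ (hJ.norm_lt D.ρpos hr hx hy)
  rw [hJ.sqn, hJ.re] at h
  have h3 : (D.χ p).pull f 0 = MvPolynomial.eval p.1 f := by simp [Chart.pull, (D.χ p).map_zero]
  rw [h3, ← sub_add] at h
  exact h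

/-- The Morse flow of `‖f‖` on `Y`. -/
theorem MorseSetup.exists_morseFlow [FiniteDimensional ℝ F] {m : ℕ} (hY : Sm Y m) (hd : d + m = n)
    (D : MorseSetup Y d f)
    (htame : ∃ R C : ℝ, ∀ x ∈ Y, R < ‖x‖ → ∃ w ∈ zTangent Y x, ‖w‖ ≤ C ∧ pd f x w = 1)
    {J : (F × F) ≃L[ℝ] (Fin d → ℂ)} (hJ : RealCoord F J) :
    ∃ (Φ : CFlow ↥Y) (r : ℝ), Φ.Fwd {y : ↥Y | MvPolynomial.eval y.1 f ≠ 0} ∧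
      ∀ N : Set ↥Y, IsOpen N → Φ.Fwd N → {y : ↥Y | MvPolynomial.eval y.1 f ≠ 0} ⊆ N →
        Φ.MorseData N (fun y => ‖MvPolynomial.eval y.1 f‖) r (D.ψ J)
          (fun p => ‖MvPolynomial.eval p.1 f‖) D.e₀ := by
  have he := D.pos
  have hρ := D.ρpos
  obtain ⟨r, hr0, hr1, hr2⟩ : ∃ r : ℝ, 0 < r ∧ 2 * r ^ 2 < D.ρ ^ 2 ∧ 5 / 2 * r ^ 2 ≤ D.e₀ := by
    refine ⟨min 1 (min (D.ρ / 2) (D.e₀ / 5)), by positivity, ?_, ?_⟩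
    · have h1 : min 1 (min (D.ρ / 2) (D.e₀ / 5)) ≤ D.ρ / 2 :=
        (min_le_right _ _).trans (min_le_left _ _)
      have h2 : 0 < min 1 (min (D.ρ / 2) (D.e₀ / 5)) := by positivity
      nlinarith
    · have h1 : min 1 (min (D.ρ / 2) (D.e₀ / 5)) ≤ D.e₀ / 5 :=
        (min_le_right _ _).trans (min_le_right _ _)
      have h2 : 0 < min 1 (min (D.ρ / 2) (D.e₀ / 5)) := by positivity
      have h3 : min 1 (min (D.ρ / 2) (D.e₀ / 5)) ≤ 1 := min_le_left _ _
      nlinarith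
  set B : Set (Fin d → ℂ) := J '' {u | ‖u.1‖ ≤ r ∧ ‖u.2‖ ≤ r} with hB
  have hBc : IsCompact B := by
    have : {u : F × F | ‖u.1‖ ≤ r ∧ ‖u.2‖ ≤ r} =
        Metric.closedBall (0 : F) r ×ˢ Metric.closedBall (0 : F) r := by
      ext u; simp
    rw [hB, this]
    have := FiniteDimensional.proper_real F
    exact ((isCompact_closedBall _ _).prod (isCompact_closedBall _ _)).image J.continuous
  have hlow : ∀ (p : critSet Y f) (x y : F), ‖x‖ ≤ r → ‖y‖ ≤ r →
      2 * D.e₀ ≤ ‖MvPolynomial.eval ((D.χ p).ψ (J (x, y))) f‖ := fun p x y hx hy => by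
    have h1 := (abs_le.1 (D.abs_sub_le hJ hr1 p hx hy)).1
    have h2 := D.lt p
    have h3 := norm_nonneg x
    have h4 := norm_nonneg y
    nlinarith
  obtain ⟨δ, hδ, C, v, hv, hvC, R', C', hvf⟩ := D.exists_field hY.1.isClosed
    (fun p hp => hY.nonempty_chart hd hp) htame hBc
    (by rintro _ ⟨u, ⟨h1, h2⟩, rfl⟩
        rw [mem_ball_zero_iff]; exact hJ.norm_lt hρ hr1 h1 h2)
    ⟨0, by simp [hr0.le], by simp⟩
    (by rintro p _ ⟨u, ⟨h1, h2⟩, rfl⟩; exact hlow p u.1 u.2 h1 h2)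
    (σ := r ^ 2) (by positivity)
    (fun u hu => by
      obtain ⟨⟨x, y⟩, rfl⟩ := J.surjective u
      rw [hJ.sqn]
      by_contra! hlt
      refine hu ⟨(x, y), ⟨?_, ?_⟩, rfl⟩
      · refine le_of_lt (lt_of_pow_lt_pow_left₀ 2 hr0.le ?_)
        nlinarith [norm_nonneg y]
      · refine le_of_lt (lt_of_pow_lt_pow_left₀ 2 hr0.le ?_)
        nlinarith [norm_nonneg x])
  obtain ⟨Φ, hΦ⟩ := hY.exists_flow hd hv hvC fun y hy => (hvf y).tan hy
  have hS : ∀ (x : ↥Y) t, HasDerivAt (fun t => ‖MvPolynomial.eval (Φ.toFun t x).1 f‖ ^ 2)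
      (2 * slope f (Φ.toFun t x).1 (v (Φ.toFun t x).1)) t := fun x t =>
    hasDerivAt_norm_sq_eval (hΦ x t)
  have hfix : ∀ x : ↥Y, MvPolynomial.eval x.1 f = 0 → ∀ t, Φ.toFun t x = x := fun x hx t => by
    have h0 : v x.1 = 0 := (hvf x.1).zero (by rw [hx, norm_zero]; positivity)
    refine Subtype.ext ?_
    exact integralCurve_unique hv (a := -(|t| + 1)) (b := |t| + 1) (t₀ := 0)
      (γ := fun s => (Φ.toFun s x).1) (γ' := fun _ => x.1)
      ⟨by have := abs_nonneg t; linarith, by positivity⟩ (fun s _ => hΦ x s)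
      (fun s _ => by rw [h0]; exact hasDerivAt_const s x.1) (by simp [Φ.zero])
      (abs_lt.1 (lt_add_one _))
  have hball : ∀ u ∈ obox F F r r, J u ∈ Metric.ball 0 D.ρ := fun u hu => by
    rw [mem_ball_zero_iff]; exact hJ.norm_lt D.ρpos hr1 hu.1.le hu.2.le
  have himg : ∀ (p : critSet Y f) (z : ↥Y), z ∈ D.ψ J p '' obox F F r r →
      ∃ u ∈ obox F F r r, z.1 = (D.χ p).ψ (J u) := by
    rintro p _ ⟨u, hu, rfl⟩
    exact ⟨u, hu, D.ψ_val J p (hball u hu)⟩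
  refine ⟨Φ, r, fun x hx t _ h0 => hx ?_, fun N hN hNf hsub => ?_⟩
  · have h1 := hfix _ h0 (-t)
    rw [← Φ.add, neg_add_cancel, Φ.zero] at h1
    rw [h1]; exact h0
  · refine ⟨(continuous_eval_poly f).norm.comp continuous_subtype_val, hN, hNf, fun x t ht => ?_,
      hr0, fun p => D.saddleChart hJ hr1 hv hΦ p fun x y hx hy =>
        (hvf _).chart p _ ⟨(x, y), ⟨hx.le, hy.le⟩, rfl⟩ rfl, fun p z hz => hsub ?_,
      fun p q hpq => ?_, fun p => by have := D.lt p; linarith, fun p x y hx hy => ?_,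
      fun s hs hsr x hx => ?_⟩
    · have h1 := le_sub_mul_of_hasDerivAt (hS x) (c := 0) (fun t _ => by
        have := (hvf (Φ.toFun t x).1).slope_nonpos (Φ.toFun t x).2
        linarith) ht
      simp only [Φ.zero, zero_mul, sub_zero] at h1
      exact le_of_sq_le_sq h1 (norm_nonneg _)
    · obtain ⟨u, hu, e⟩ := himg p z hz
      have := hlow p u.1 u.2 hu.1.le hu.2.le
      show MvPolynomial.eval z.1 f ≠ 0
      rw [e, ← norm_pos_iff]
      exact lt_of_lt_of_le (by positivity) this
    · refine Set.disjoint_left.2 fun z hz hz' => ?_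
      obtain ⟨u, hu, e⟩ := himg p z hz
      obtain ⟨u', hu', e'⟩ := himg q z hz'
      exact Set.disjoint_left.1 (D.disj p q hpq) ⟨_, hball u hu, e.symm⟩ ⟨_, hball u' hu', e'.symm⟩
    · have := D.abs_sub_le hJ hr1 p hx.le hy.le
      rw [← D.ψ_val J p (hball (x, y) ⟨hx, hy⟩)] at this
      exact this
    · by_contra! hcon
      set δ' : ℝ := min δ (3 * D.e₀ * s ^ 2) with hδ'
      have hδ'0 : 0 < δ' := by positivity
      have hsl : ∀ t, 0 ≤ t → slope f (Φ.toFun t x).1 (v (Φ.toFun t x).1) ≤ -δ' := fun t ht => by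
        obtain ⟨h1, h2⟩ := hcon t ht
        by_cases hK : ∃ p, (Φ.toFun t x).1 ∈ (D.χ p).ψ '' B
        · obtain ⟨p, _, ⟨⟨x', y'⟩, ⟨hx', hy'⟩, rfl⟩, e⟩ := hK
          rw [← e, (hvf _).chart p _ ⟨(x', y'), ⟨hx', hy'⟩, rfl⟩ rfl]
          refine (D.slope_le p (hJ.norm_lt hρ hr1 hx' hy')).trans (neg_le_neg ?_)
          refine (min_le_right _ _).trans (mul_le_mul (D.lt p).le ?_ (by positivity)
            (norm_nonneg _))
          rw [hJ.sqn]
          by_contra! hlt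
          refine h2 p ⟨(x', y'), ⟨?_, ?_⟩, Subtype.ext ?_⟩
          · refine lt_of_pow_lt_pow_left₀ 2 hs.le ?_
            nlinarith [norm_nonneg y']
          · refine lt_of_pow_lt_pow_left₀ 2 hs.le ?_
            nlinarith [norm_nonneg x']
          · rw [D.ψ_val J p (by rw [mem_ball_zero_iff]; exact hJ.norm_lt hρ hr1 hx' hy'), e]
        · push Not at hK
          exact ((hvf _).slope_le (Φ.toFun t x).2 h1 hK).trans (neg_le_neg (min_le_left _ _))
      have h3 : ∀ t, 0 ≤ t → ‖MvPolynomial.eval (Φ.toFun t x).1 f‖ ^ 2 ≤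
          ‖MvPolynomial.eval x.1 f‖ ^ 2 - 2 * δ' * t := fun t ht => by
        have h1 := le_sub_mul_of_hasDerivAt (hS x) (c := 2 * δ') (fun t ht => by
          have := hsl t ht
          linarith) ht
        simpa only [Φ.zero] using h1
      have h4 := h3 ((‖MvPolynomial.eval x.1 f‖ ^ 2 + 1) / (2 * δ')) (by positivity)
      rw [mul_div_cancel₀ _ (by positivity)] at h4
      have h5 := sq_nonneg ‖MvPolynomial.eval
        (Φ.toFun ((‖MvPolynomial.eval x.1 f‖ ^ 2 + 1) / (2 * δ')) x).1 f‖
      linarith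

end MorseCount

end

section

open scoped ContDiff

lemma HasEulerChar.of_hequiv {X Y : Type} [TopologicalSpace X] [TopologicalSpace Y]
    (e : ContinuousMap.HomotopyEquiv X Y) {c : ℤ} (h : HasEulerChar Y c) : HasEulerChar X c := by
  obtain ⟨Z, L, hL, ⟨e'⟩, hc⟩ := h
  exact ⟨Z, L, hL, ⟨e.trans e'⟩, hc⟩

lemma HasEulerChar.prod_contractible {X C : Type} [TopologicalSpace X] [TopologicalSpace C]
    [ContractibleSpace C] {c : ℤ} (h : HasEulerChar X c) : HasEulerChar (X × C) c := by
  obtain ⟨e⟩ := ContractibleSpace.hequiv_unit C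
  exact ((hasEulerChar_congr (Homeomorph.prodPUnit X)).2 h).of_hequiv
    ((ContinuousMap.HomotopyEquiv.refl X).prodCongr e)

/-- Polar coordinates on a punctured disc. -/
def puncturedDiscHomeomorph (r : ℝ) :
    {z : ℂ | 0 < ‖z‖ ∧ ‖z‖ < r} ≃ₜ Set.Ioo (0 : ℝ) r × Circle where
  toFun z := (⟨‖z.1‖, z.2⟩, ⟨z.1 / ‖z.1‖, by
    have : ‖z.1‖ ≠ 0 := z.2.1.ne'
    simp [Submonoid.unitSphere, this]⟩)
  invFun w := ⟨w.1.1 * w.2, by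
    have h1 : ‖(w.1.1 : ℂ) * w.2‖ = w.1.1 := by
      rw [norm_mul, Circle.norm_coe, mul_one, Complex.norm_real, Real.norm_of_nonneg w.1.2.1.le]
    exact ⟨by rw [h1]; exact w.1.2.1, by rw [h1]; exact w.1.2.2⟩⟩
  left_inv z := by
    have : (‖z.1‖ : ℂ) ≠ 0 := by exact_mod_cast z.2.1.ne'
    refine Subtype.ext ?_
    simp
    field_simp
  right_inv w := by
    have h1 : ‖(w.1.1 : ℂ) * w.2‖ = w.1.1 := by
      rw [norm_mul, Circle.norm_coe, mul_one, Complex.norm_real, Real.norm_of_nonneg w.1.2.1.le]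
    have h2 : (w.1.1 : ℂ) ≠ 0 := by exact_mod_cast w.1.2.1.ne'
    refine Prod.ext (Subtype.ext h1) (Subtype.ext ?_)
    show (w.1.1 : ℂ) * w.2 / ((‖(w.1.1 : ℂ) * w.2‖ : ℝ) : ℂ) = w.2
    rw [h1, mul_div_cancel_left₀ _ h2]
  continuous_toFun := by
    refine Continuous.prodMk ?_ ?_
    · exact (continuous_norm.comp continuous_subtype_val).subtype_mk _
    · refine Continuous.subtype_mk ?_ _
      refine continuous_subtype_val.div
        (Complex.continuous_ofReal.comp (continuous_norm.comp continuous_subtype_val)) fun z => ?_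
      have : ‖z.1‖ ≠ 0 := z.2.1.ne'
      exact_mod_cast this
  continuous_invFun := by
    refine Continuous.subtype_mk ?_ _
    exact (Complex.continuous_ofReal.comp (continuous_subtype_val.comp continuous_fst)).mul
      ((continuous_subtype_val : Continuous (fun z : Circle => (z : ℂ))).comp continuous_snd)

lemma HasEulerChar.prod_puncturedDisc {X : Type} [TopologicalSpace X] {c : ℤ}
    (h : HasEulerChar X c) {r : ℝ} (hr : 0 < r) :
    HasEulerChar (X × {z : ℂ | 0 < ‖z‖ ∧ ‖z‖ < r}) 0 := by
  have : ContractibleSpace (Set.Ioo (0 : ℝ) r) :=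
    (convex_Ioo 0 r).contractibleSpace ⟨r / 2, by constructor <;> linarith⟩
  have h1 : HasEulerChar ((X × Circle) × Set.Ioo (0 : ℝ) r) 0 :=
    (hasEulerChar_prod_circle h).prod_contractible
  refine (hasEulerChar_congr ?_).1 h1
  exact (Homeomorph.prodAssoc X Circle (Set.Ioo (0 : ℝ) r)).trans
    ((Homeomorph.refl X).prodCongr
      ((Homeomorph.prodComm _ _).trans (puncturedDiscHomeomorph r).symm))

section Collar

variable {n d : ℕ} {Y : Set (Fin n → ℂ)} {f : MvPolynomial (Fin n) ℂ}

/-- The requirements on the collar vector field at a point. -/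
structure CollarCond (Y : Set (Fin n → ℂ)) (f : MvPolynomial (Fin n) ℂ) (β : ContDiffBump (0 : ℂ))
    (R C : ℝ) (x v : Fin n → ℂ) : Prop where
  tan : x ∈ Y → v ∈ zTangent Y x
  deriv : x ∈ Y → pd f x v = (β (MvPolynomial.eval x f) : ℂ)
  bound : R ≤ ‖x‖ → ‖v‖ ≤ C

lemma CollarCond.convex (β : ContDiffBump (0 : ℂ)) (R C : ℝ) (x : Fin n → ℂ) :
    Convex ℝ {v | CollarCond Y f β R C x v} := by
  intro v hv w hw a b ha hb hab
  have hab' : b = 1 - a := by linarith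
  refine ⟨fun hx => ?_, fun hx => ?_, fun h => ?_⟩
  · exact add_mem (((zTangent Y x).restrictScalars ℝ).smul_mem a (hv.tan hx))
      (((zTangent Y x).restrictScalars ℝ).smul_mem b (hw.tan hx))
  · rw [map_add, ← Complex.coe_smul, ← Complex.coe_smul, map_smul, map_smul, hv.deriv hx,
      hw.deriv hx, ← add_smul, ← Complex.ofReal_add, hab]
    simp
  · have h1 := hv.bound h
    have h2 := hw.bound h
    refine (norm_add_le _ _).trans ?_
    rw [norm_smul, norm_smul, Real.norm_of_nonneg ha, Real.norm_of_nonneg hb]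
    subst hab'
    nlinarith

theorem exists_collarField (hY : IsClosed Y)
    (hch : ∀ p ∈ Y, Nonempty (Chart Y d p))
    (htame : ∃ R C : ℝ, ∀ x ∈ Y, R < ‖x‖ → ∃ w ∈ zTangent Y x, ‖w‖ ≤ C ∧ pd f x w = 1)
    (β : ContDiffBump (0 : ℂ)) (hβ : ∀ p ∈ critSet Y f, β.rOut < ‖MvPolynomial.eval p f‖) :
    ∃ C : ℝ, ∃ v : (Fin n → ℂ) → (Fin n → ℂ), ContDiff ℝ 1 v ∧ (∀ x, ‖v x‖ ≤ C) ∧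
      ∀ x ∈ Y, v x ∈ zTangent Y x ∧ pd f x (v x) = (β (MvPolynomial.eval x f) : ℂ) := by
  classical
  obtain ⟨R, C, htame⟩ := htame
  set R' : ℝ := R + 1 with hR'
  set C' : ℝ := |C| + 1 with hC'
  have hC'0 : 0 ≤ C' := by positivity
  have hcont := continuous_eval_poly f
  have hfs : ContDiff ℝ ∞ fun x : Fin n → ℂ => MvPolynomial.eval x f :=
    (contDiff_eval f).restrict_scalars ℝ
  have hβs : ContDiff ℝ ∞ fun x : Fin n → ℂ => (β (MvPolynomial.eval x f) : ℂ) :=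
    Complex.ofRealCLM.contDiff.comp (β.contDiff.comp hfs)
  have hloc : ∀ x₀ : Fin n → ℂ, ∃ U ∈ 𝓝 x₀, ∃ g : (Fin n → ℂ) → (Fin n → ℂ),
      ContMDiffOn 𝓘(ℝ, Fin n → ℂ) 𝓘(ℝ, Fin n → ℂ) ∞ g U ∧
        ∀ y ∈ U, g y ∈ {v | CollarCond Y f β R' C' y v} := by
    intro x₀
    by_cases hx₀ : x₀ ∈ Y
    swap
    · exact ⟨Yᶜ, hY.isOpen_compl.mem_nhds hx₀, fun _ => 0, contMDiffOn_const, fun y hy =>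
        ⟨fun h => absurd h hy, fun h => absurd h hy, fun _ => by simpa using hC'0⟩⟩
    rcases lt_or_ge β.rOut ‖MvPolynomial.eval x₀ f‖ with hlt | hge
    · refine ⟨{y | β.rOut < ‖MvPolynomial.eval y f‖},
        (isOpen_lt (g := fun y : Fin n → ℂ => ‖MvPolynomial.eval y f‖) continuous_const
          hcont.norm).mem_nhds hlt, fun _ => 0, contMDiffOn_const, fun y hy =>
        ⟨fun _ => zero_mem _, fun _ => ?_, fun _ => by simpa using hC'0⟩⟩
      rw [β.zero_of_le_dist (by rw [dist_zero_right]; exact le_of_lt hy)]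
      simp
    have hcrit : x₀ ∉ critSet Y f := fun h => (hβ x₀ h).not_ge hge
    have hw : ∃ w ∈ zTangent Y x₀, pd f x₀ w = 1 ∧ (R' ≤ ‖x₀‖ → ‖w‖ ≤ C) := by
      by_cases hR : R' ≤ ‖x₀‖
      · obtain ⟨w, hw1, hw2, hw3⟩ := htame x₀ hx₀ (by linarith)
        exact ⟨w, hw1, hw3, fun _ => hw2⟩
      · have : ∃ w ∈ zTangent Y x₀, pd f x₀ w ≠ 0 := by
          by_contra! h
          exact hcrit ⟨hx₀, h⟩
        obtain ⟨w, hw1, hw2⟩ := this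
        exact ⟨(pd f x₀ w)⁻¹ • w, Submodule.smul_mem _ _ hw1, by
          rw [map_smul, smul_eq_mul, inv_mul_cancel₀ hw2], fun h => absurd h hR⟩
    obtain ⟨w, hwT, hw1, hwC⟩ := hw
    obtain ⟨χ⟩ := hch x₀ hx₀
    have hv0 := χ.field_base hwT
    set g := χ.field (fun _ => χ.L w) with hg
    have hU0 : χ.L (x₀ - x₀) ∈ χ.U := by rw [sub_self, _root_.map_zero χ.L]; exact χ.zero_mem
    have hUo := χ.isOpen_preimage χ.isOpen_U
    have hgs : ContDiffOn ℝ ∞ g {x | χ.L (x - x₀) ∈ χ.U} := χ.contDiffOn_field contDiff_const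
    have hgc : ContinuousAt g x₀ := (hgs.continuousOn).continuousAt (hUo.mem_nhds hU0)
    have hps : ContDiffOn ℝ ∞ (fun x => pd f x (g x)) {x | χ.L (x - x₀) ∈ χ.U} := by
      let B := ContinuousLinearMap.restrictScalarsL ℂ (Fin n → ℂ) ℂ ℝ ℝ
      have h4 : ContDiff ℝ ∞ (fun x => B (pd f x)) :=
        B.contDiff.comp ((contDiff_pd f).restrict_scalars ℝ)
      exact h4.contDiffOn.clm_apply hgs
    have hp0 : pd f x₀ (g x₀) = 1 := by rw [hv0, hw1]
    have hpc : ContinuousAt (fun x => pd f x (g x)) x₀ :=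
      (hps.continuousOn).continuousAt (hUo.mem_nhds hU0)
    have hp1 : ∀ᶠ y in 𝓝 x₀, pd f y (g y) ≠ 0 :=
      hpc.eventually_ne (by rw [hp0]; exact one_ne_zero)
    set G : (Fin n → ℂ) → (Fin n → ℂ) := fun x =>
      ((β (MvPolynomial.eval x f) : ℂ) * (pd f x (g x))⁻¹) • g x with hG
    have hGc : ContinuousAt G x₀ :=
      (hβs.continuous.continuousAt.mul (hpc.inv₀ (by rw [hp0]; exact one_ne_zero))).smul hgc
    have e2 : ∀ᶠ y in 𝓝 x₀, R' ≤ ‖y‖ → ‖G y‖ ≤ C' := by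
      by_cases hR : R' ≤ ‖x₀‖
      · have h5 : ‖G x₀‖ < C' := by
          simp only [hG]
          rw [hp0, hv0, norm_smul, inv_one, mul_one, Complex.norm_real,
            Real.norm_of_nonneg β.nonneg]
          have h6 := (hwC hR).trans (le_abs_self C)
          have h7 : β (MvPolynomial.eval x₀ f) ≤ 1 := β.le_one
          have h8 : 0 ≤ β (MvPolynomial.eval x₀ f) := β.nonneg
          have := norm_nonneg w
          nlinarith
        filter_upwards [hGc.norm.eventually (gt_mem_nhds h5)] with y hy _ using le_of_lt hy
      · filter_upwards [continuous_norm.continuousAt.eventually (gt_mem_nhds (not_le.1 hR))]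
          with y hy h using absurd h (not_le.2 hy)
    have e4 : ∀ᶠ y in 𝓝 x₀, y ∈ χ.O := χ.isOpen_O.mem_nhds χ.base_mem
    have e5 : ∀ᶠ y in 𝓝 x₀, χ.L (y - x₀) ∈ χ.U := hUo.mem_nhds hU0
    refine ⟨{y | (pd f y (g y) ≠ 0 ∧ (R' ≤ ‖y‖ → ‖G y‖ ≤ C')) ∧ y ∈ χ.O ∧ χ.L (y - x₀) ∈ χ.U},
      (hp1.and e2).and (e4.and e5), G, ?_, ?_⟩
    · refine ContDiffOn.contMDiffOn ?_
      exact ((hβs.contDiffOn.mul ((hps.mono fun y hy => hy.2.2).inv fun y hy => hy.1.1)).smul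
        (hgs.mono fun y hy => hy.2.2))
    · rintro y ⟨⟨hy1, hy2⟩, hy3, hy4⟩
      refine ⟨fun h => Submodule.smul_mem _ _ (χ.field_mem _ h hy3), fun _ => ?_, hy2⟩
      simp only [hG]
      rw [map_smul, smul_eq_mul, mul_assoc, inv_mul_cancel₀ hy1, mul_one]
  obtain ⟨v, hv⟩ := exists_contMDiffMap_forall_mem_convex_of_local 𝓘(ℝ, Fin n → ℂ)
    (CollarCond.convex (Y := Y) (f := f) β R' C') hloc
  have hvs : ContDiff ℝ ∞ v := contMDiff_iff_contDiff.1 v.contMDiff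
  obtain ⟨M, hM⟩ := (isCompact_closedBall (0 : Fin n → ℂ) R').exists_bound_of_continuousOn
    hvs.continuous.continuousOn
  refine ⟨max M C', v, hvs.of_le (by simp), fun x => ?_, fun x hx => ⟨(hv x).tan hx, (hv x).deriv hx⟩⟩
  rcases le_total R' ‖x‖ with h | h
  · exact ((hv x).bound h).trans (le_max_right _ _)
  · exact (hM x (by simpa using h)).trans (le_max_left _ _)

/-- A flow on `Y` moving the value of `f` with constant speed `θ` near zero. -/
theorem exists_collarFlow {m : ℕ} (hY : Sm Y m) (hd : d + m = n)
    (htame : ∃ R C : ℝ, ∀ x ∈ Y, R < ‖x‖ → ∃ w ∈ zTangent Y x, ‖w‖ ≤ C ∧ pd f x w = 1)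
    {e : ℝ} (he : 0 < e) (hcr : ∀ p ∈ critSet Y f, 3 * e < ‖MvPolynomial.eval p f‖)
    {θ : ℂ} (hθ : ‖θ‖ = 1) :
    ∃ Φ : CFlow ↥Y, ∀ y : ↥Y, ‖MvPolynomial.eval y.1 f‖ < e → ∀ t ∈ Set.Ioo (-e) e,
      MvPolynomial.eval (Φ.toFun t y).1 f = MvPolynomial.eval y.1 f + t * θ := by
  let β : ContDiffBump (0 : ℂ) := ⟨2 * e, 3 * e, by linarith, by linarith⟩
  obtain ⟨C, v, hv, hvC, hvY⟩ := exists_collarField hY.1.isClosed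
    (fun p hp => hY.nonempty_chart hd hp) htame β hcr
  have hv' : ContDiff ℝ 1 (fun x => θ • v x) := hv.const_smul θ
  obtain ⟨Φ, hΦ⟩ := hY.exists_flow hd hv' (C := C) (fun x => by
    rw [norm_smul, hθ, one_mul]; exact hvC x) fun y hy => Submodule.smul_mem _ _ (hvY y hy).1
  refine ⟨Φ, fun y hy t ht => ?_⟩
  have hV : ContDiff ℝ 1 (fun z : ℂ => θ * (β z : ℂ)) :=
    contDiff_const.mul (Complex.ofRealCLM.contDiff.comp β.contDiff)
  refine integralCurve_unique hV (t₀ := 0) (a := -e) (b := e)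
    (γ := fun s => MvPolynomial.eval (Φ.toFun s y).1 f)
    (γ' := fun s => MvPolynomial.eval y.1 f + s * θ) ⟨by linarith, he⟩ (fun s _ => ?_)
    (fun s hs => ?_) (by simp [Φ.zero]) ht
  · have h1 := ((hasFDerivAt_eval f (Φ.toFun s y).1).restrictScalars ℝ).comp_hasDerivAt s (hΦ y s)
    have h2 : pd f (Φ.toFun s y).1 (θ • v (Φ.toFun s y).1) =
        θ * (β (MvPolynomial.eval (Φ.toFun s y).1 f) : ℂ) := by
      rw [map_smul, (hvY _ (Φ.toFun s y).2).2, smul_eq_mul]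
    exact h2 ▸ h1
  · have h2 : β (MvPolynomial.eval y.1 f + s * θ) = 1 := by
      refine β.one_of_mem_closedBall ?_
      rw [mem_closedBall_zero_iff]
      refine (norm_add_le _ _).trans ?_
      rw [norm_mul, hθ, mul_one, Complex.norm_real]
      have : |s| < e := abs_lt.2 hs
      show _ ≤ 2 * e
      rw [Real.norm_eq_abs]
      linarith
    rw [h2]
    have h3 : HasDerivAt (fun s : ℝ => (s : ℂ)) 1 s := Complex.ofRealCLM.hasDerivAt
    have := (h3.mul_const θ).const_add (MvPolynomial.eval y.1 f)
    convert this using 1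
    simp

/-- Near the zero fibre, `f` is a trivial fibration. -/
theorem exists_collar {m : ℕ} (hY : Sm Y m) (hd : d + m = n)
    (htame : ∃ R C : ℝ, ∀ x ∈ Y, R < ‖x‖ → ∃ w ∈ zTangent Y x, ‖w‖ ≤ C ∧ pd f x w = 1)
    {e : ℝ} (he : 0 < e) (hcr : ∀ p ∈ critSet Y f, 3 * e < ‖MvPolynomial.eval p f‖)
    {S : Set ℂ} (hS : ∀ z ∈ S, ‖z‖ < e) :
    Nonempty ({y : ↥Y | MvPolynomial.eval y.1 f = 0} × S ≃ₜ
      {y : ↥Y | MvPolynomial.eval y.1 f ∈ S}) := by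
  obtain ⟨Φ, hΦ⟩ := exists_collarFlow hY hd htame he hcr (θ := 1) (by simp)
  obtain ⟨Ψ, hΨ⟩ := exists_collarFlow hY hd htame he hcr (θ := Complex.I) (by simp)
  have hre : ∀ z ∈ S, z.re ∈ Set.Ioo (-e) e := fun z hz =>
    abs_lt.1 ((Complex.abs_re_le_norm z).trans_lt (hS z hz))
  have him : ∀ z ∈ S, z.im ∈ Set.Ioo (-e) e := fun z hz =>
    abs_lt.1 ((Complex.abs_im_le_norm z).trans_lt (hS z hz))
  have hneg : ∀ t : ℝ, t ∈ Set.Ioo (-e) e → -t ∈ Set.Ioo (-e) e := fun t ht =>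
    ⟨by linarith [ht.2], by linarith [ht.1]⟩
  have hfwd : ∀ (y : ↥Y) (z : ℂ), MvPolynomial.eval y.1 f = 0 → z ∈ S →
      MvPolynomial.eval (Φ.toFun z.re (Ψ.toFun z.im y)).1 f = z := fun y z hy hz => by
    have h1 := hΨ y (by rw [hy, norm_zero]; exact he) _ (him z hz)
    rw [hy, zero_add] at h1
    have h2 := hΦ (Ψ.toFun z.im y) (by
      rw [h1, norm_mul, Complex.norm_I, mul_one, Complex.norm_real]
      exact abs_lt.2 (him z hz)) _ (hre z hz)
    rw [h2, h1, mul_one, add_comm]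
    exact Complex.re_add_im z
  have hbwd : ∀ y : ↥Y, MvPolynomial.eval y.1 f ∈ S →
      MvPolynomial.eval (Ψ.toFun (-(MvPolynomial.eval y.1 f).im)
        (Φ.toFun (-(MvPolynomial.eval y.1 f).re) y)).1 f = 0 := fun y hy => by
    have h1 := hΦ y (hS _ hy) _ (hneg _ (hre _ hy))
    have h3 : MvPolynomial.eval y.1 f + ((-(MvPolynomial.eval y.1 f).re : ℝ) : ℂ) * 1 =
        (MvPolynomial.eval y.1 f).im * Complex.I := by
      have := Complex.re_add_im (MvPolynomial.eval y.1 f)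
      rw [mul_one, Complex.ofReal_neg]
      linear_combination -this
    rw [h3] at h1
    have h2 := hΨ (Φ.toFun (-(MvPolynomial.eval y.1 f).re) y) (by
      rw [h1, norm_mul, Complex.norm_I, mul_one, Complex.norm_real]
      exact abs_lt.2 (him _ hy)) _ (hneg _ (him _ hy))
    rw [h2, h1, Complex.ofReal_neg]
    ring
  have hcf : Continuous fun y : ↥Y => MvPolynomial.eval y.1 f :=
    (continuous_eval_poly f).comp continuous_subtype_val
  refine ⟨⟨⟨fun w => ⟨Φ.toFun w.2.1.re (Ψ.toFun w.2.1.im w.1.1), ?_⟩, fun y =>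
    (⟨_, hbwd y.1 y.2⟩, ⟨_, y.2⟩), fun w => ?_, fun y => ?_⟩, ?_, ?_⟩⟩
  · show MvPolynomial.eval _ f ∈ S
    rw [hfwd _ _ w.1.2 w.2.2]; exact w.2.2
  · have h := hfwd _ _ w.1.2 w.2.2
    refine Prod.ext (Subtype.ext ?_) (Subtype.ext h)
    simp only [h]
    rw [← Φ.add, neg_add_cancel, Φ.zero, ← Ψ.add, neg_add_cancel, Ψ.zero]
  · refine Subtype.ext ?_
    simp only
    rw [← Ψ.add, add_neg_cancel, Ψ.zero, ← Φ.add, add_neg_cancel, Φ.zero]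
  · refine Continuous.subtype_mk ?_ _
    have c1 := Ψ.continuous_comp (a := fun w : {y : ↥Y | MvPolynomial.eval y.1 f = 0} × S => w.2.1.im)
      (b := fun w => w.1.1)
      (Complex.continuous_im.comp (continuous_subtype_val.comp continuous_snd))
      (continuous_subtype_val.comp continuous_fst)
    exact Φ.continuous_comp (Complex.continuous_re.comp (continuous_subtype_val.comp continuous_snd))
      c1
  · have c0 : Continuous fun y : {y : ↥Y | MvPolynomial.eval y.1 f ∈ S} =>
        MvPolynomial.eval y.1.1 f := hcf.comp continuous_subtype_val
    refine Continuous.prodMk (Continuous.subtype_mk ?_ _) (Continuous.subtype_mk c0 _)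
    have c1 := Φ.continuous_comp (a := fun y : {y : ↥Y | MvPolynomial.eval y.1 f ∈ S} =>
      -(MvPolynomial.eval y.1.1 f).re) (b := fun y => y.1)
      (Complex.continuous_re.comp c0).neg continuous_subtype_val
    exact Ψ.continuous_comp (Complex.continuous_im.comp c0).neg c1

theorem GoodFn.hasEulerChar {m : ℕ} (hY : Sm Y m) (hd : d + m = n) (hf : GoodFn Y d f) {c : ℤ}
    (hc : HasEulerChar ↥(Y ∩ {y | MvPolynomial.eval y f = 0}) c) :
    HasEulerChar ↥Y (c + (-1) ^ d * (critSet Y f).ncard) ∧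
    HasEulerChar ↥(Y ∩ {y | MvPolynomial.eval y f ≠ 0}) ((-1) ^ d * (critSet Y f).ncard) := by
  classical
  obtain ⟨D⟩ := hf.nonempty_setup
  obtain ⟨J, hJ⟩ := exists_realCoord d
  obtain ⟨Φ, r, hfw, hD⟩ := D.exists_morseFlow hY hd hf.tame hJ
  have := hf.fin.fintype
  have hcard : (Fintype.card (critSet Y f) : ℤ) = (critSet Y f).ncard := by
    rw [Set.ncard_eq_toFinset_card', Set.toFinset_card]
  have hsub : ∀ P : (Fin n → ℂ) → Prop, Nonempty ({y : ↥Y | P y.1} ≃ₜ ↥(Y ∩ {y | P y})) :=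
    fun P => ⟨⟨⟨fun y => ⟨y.1.1, y.1.2, y.2⟩, fun y => ⟨⟨y.1, y.2.1⟩, y.2.2⟩, fun _ => rfl,
      fun _ => rfl⟩, by fun_prop, by fun_prop⟩⟩
  have hc' : HasEulerChar {y : ↥Y | MvPolynomial.eval y.1 f = 0} c := by
    obtain ⟨h⟩ := hsub fun y => MvPolynomial.eval y f = 0
    exact (hasEulerChar_congr h).2 hc
  constructor
  · have M := hD Set.univ isOpen_univ (fun _ _ _ _ => trivial) (Set.subset_univ _)
    rw [← hcard]
    refine (hasEulerChar_congr (Homeomorph.Set.univ _)).1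
      (M.hasEulerChar (LinearIsometryEquiv.refl ℝ _) ?_)
    obtain ⟨e⟩ := exists_collar hY hd hf.tame D.pos (fun p hp => D.lt ⟨p, hp⟩)
      (S := Metric.ball 0 D.e₀) fun z hz => by simpa using hz
    have : ContractibleSpace (Metric.ball (0 : ℂ) D.e₀) :=
      (convex_ball _ _).contractibleSpace ⟨0, by simpa using D.pos⟩
    have h1 := (hasEulerChar_congr e).1 (hc'.prod_contractible)
    have e2 : {y : ↥Y | MvPolynomial.eval y.1 f ∈ Metric.ball 0 D.e₀} =
        Set.univ ∩ {y : ↥Y | ‖MvPolynomial.eval y.1 f‖ < D.e₀} := by ext; simp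
    rw [← e2]; exact h1
  · have hcf : Continuous fun y : ↥Y => MvPolynomial.eval y.1 f :=
      (continuous_eval_poly f).comp continuous_subtype_val
    have M := hD {y : ↥Y | MvPolynomial.eval y.1 f ≠ 0} (isOpen_ne_fun hcf continuous_const) hfw
      subset_rfl
    obtain ⟨h⟩ := hsub fun y => MvPolynomial.eval y f ≠ 0
    rw [← hcard, ← zero_add ((-1) ^ d * _)]
    refine (hasEulerChar_congr h).1 (M.hasEulerChar (LinearIsometryEquiv.refl ℝ _) ?_)
    obtain ⟨e⟩ := exists_collar hY hd hf.tame D.pos (fun p hp => D.lt ⟨p, hp⟩)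
      (S := {z : ℂ | 0 < ‖z‖ ∧ ‖z‖ < D.e₀}) fun z hz => hz.2
    have h1 := (hasEulerChar_congr e).1 (hc'.prod_puncturedDisc D.pos)
    have e2 : {y : ↥Y | MvPolynomial.eval y.1 f ∈ {z : ℂ | 0 < ‖z‖ ∧ ‖z‖ < D.e₀}} =
        {y : ↥Y | MvPolynomial.eval y.1 f ≠ 0} ∩
          {y : ↥Y | ‖MvPolynomial.eval y.1 f‖ < D.e₀} := by ext; simp
    rw [← e2]; exact h1

end Collar

end

section

open TensorProduct in
/-- A dominant morphism of finite type has an étale multisection over the generic point. -/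
theorem exists_formallyEtale_point (R S : Type) [CommRing R] [IsDomain R] [CharZero R]
    [CommRing S] [Algebra R S] [Algebra.FiniteType R S]
    (h : Function.Injective (algebraMap R S)) :
    ∃ (K : Type) (_ : Field K) (_ : Algebra R K) (_ : S →ₐ[R] K),
      Algebra.FormallyEtale R K ∧ Function.Injective (algebraMap R K) := by
  let F := FractionRing R
  let B := F ⊗[R] S
  have : Module.Flat R F := IsLocalization.flat F (nonZeroDivisors R)
  have hB : Function.Injective (algebraMap F B) :=
    Algebra.TensorProduct.includeLeft_injective (S := R) h
  have : Nontrivial B := hB.nontrivial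
  obtain ⟨M, hM⟩ := Ideal.exists_maximal B
  let K := B ⧸ M
  let : Field K := Ideal.Quotient.field M
  have : Algebra.FiniteType F B := inferInstance
  have : Algebra.FiniteType F K := inferInstance
  have : Module.Finite F K := finite_of_finite_type_of_isJacobsonRing F K
  have : CharZero F := IsFractionRing.charZero R
  have : PerfectField F := PerfectField.ofCharZero
  have : Algebra.IsAlgebraic F K := Algebra.IsAlgebraic.of_finite F K
  have : Algebra.IsSeparable F K := Algebra.IsAlgebraic.isSeparable_of_perfectField
  have : Algebra.FormallyEtale R F := Algebra.FormallyEtale.of_isLocalization (nonZeroDivisors R)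
  have : Algebra.FormallyEtale F K := Algebra.FormallyEtale.of_isSeparable F K
  refine ⟨K, inferInstance, inferInstance, (Ideal.Quotient.mkₐ R M).comp
    (Algebra.TensorProduct.includeRight (R := R) (A := F) (B := S)),
    Algebra.FormallyEtale.comp R F K, ?_⟩
  rw [IsScalarTower.algebraMap_eq R F K]
  exact (algebraMap F K).injective.comp (IsFractionRing.injective R F)

open TensorProduct in
lemma exists_derivation_of_formallyEtale (k R K : Type) [CommRing k] [CommRing R] [Field K]
    [Algebra k R] [Algebra R K] [Algebra k K] [IsScalarTower k R K] [Algebra.FormallyEtale R K]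
    (D₀ : Derivation k R K) :
    ∃ D : Derivation k K K, ∀ r : R, D (algebraMap R K r) = D₀ r := by
  let e := KaehlerDifferential.tensorKaehlerEquivOfFormallyEtale k R K
  let ℓ : K ⊗[R] Ω[R⁄k] →ₗ[K] K := D₀.liftKaehlerDifferential.liftBaseChange K
  refine ⟨(ℓ ∘ₗ e.symm.toLinearMap).compDer (KaehlerDifferential.D k K), fun r => ?_⟩
  show ℓ (e.symm (KaehlerDifferential.D k K (algebraMap R K r))) = _
  rw [KaehlerDifferential.tensorKaehlerEquivOfFormallyEtale_symm_D_algebraMap]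
  simp [ℓ]

/-- If the classes of the polynomials `φ t` in `ℂ[σ]/J` are algebraically independent, then `J`
has a zero in a field where they stay independent and can be differentiated with respect to. -/
theorem exists_generic_zero {σ τ : Type} [Finite σ] [DecidableEq τ]
    (J : Ideal (MvPolynomial σ ℂ)) (φ : τ → MvPolynomial σ ℂ)
    (h : ∀ P : MvPolynomial τ ℂ, MvPolynomial.aeval φ P ∈ J → P = 0) :
    ∃ (K : Type) (_ : Field K) (_ : Algebra ℂ K) (ev : MvPolynomial σ ℂ →ₐ[ℂ] K),
      (∀ p ∈ J, ev p = 0) ∧ (∀ P : MvPolynomial τ ℂ, ev (MvPolynomial.aeval φ P) = 0 → P = 0) ∧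
      ∀ s, ∃ D : Derivation ℂ K K, ∀ t, D (ev (φ t)) = if s = t then 1 else 0 := by
  let g : MvPolynomial τ ℂ →ₐ[ℂ] MvPolynomial σ ℂ ⧸ J :=
    (Ideal.Quotient.mkₐ ℂ J).comp (MvPolynomial.aeval φ)
  let : Algebra (MvPolynomial τ ℂ) (MvPolynomial σ ℂ ⧸ J) := g.toRingHom.toAlgebra
  have hg : ∀ P, algebraMap (MvPolynomial τ ℂ) (MvPolynomial σ ℂ ⧸ J) P =
    Ideal.Quotient.mk J (MvPolynomial.aeval φ P) := fun P => rfl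
  have : IsScalarTower ℂ (MvPolynomial τ ℂ) (MvPolynomial σ ℂ ⧸ J) :=
    IsScalarTower.of_algebraMap_eq fun x => (g.commutes x).symm
  have : Algebra.FiniteType (MvPolynomial τ ℂ) (MvPolynomial σ ℂ ⧸ J) :=
    Algebra.FiniteType.of_restrictScalars_finiteType ℂ _ _
  obtain ⟨K, _, _, q, _, hK⟩ := exists_formallyEtale_point (MvPolynomial τ ℂ)
    (MvPolynomial σ ℂ ⧸ J) <| (injective_iff_map_eq_zero _).2 fun P hP => h P <| by
      rwa [hg, Ideal.Quotient.eq_zero_iff_mem] at hP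
  let : Algebra ℂ K := ((algebraMap (MvPolynomial τ ℂ) K).comp MvPolynomial.C).toAlgebra
  have : IsScalarTower ℂ (MvPolynomial τ ℂ) K := IsScalarTower.of_algebraMap_eq fun x => rfl
  let ev : MvPolynomial σ ℂ →ₐ[ℂ] K :=
    (q.restrictScalars ℂ).comp (Ideal.Quotient.mkₐ ℂ J)
  have hev : ∀ P, ev (MvPolynomial.aeval φ P) = algebraMap (MvPolynomial τ ℂ) K P := q.commutes
  refine ⟨K, inferInstance, inferInstance, ev, fun p hp => ?_, fun P hP => ?_, fun s => ?_⟩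
  · have : Ideal.Quotient.mk J p = 0 := Ideal.Quotient.eq_zero_iff_mem.2 hp
    show q (Ideal.Quotient.mk J p) = 0
    rw [this, map_zero]
  · rw [hev] at hP
    exact hK (hP.trans (map_zero _).symm)
  · obtain ⟨D, hD⟩ := exists_derivation_of_formallyEtale ℂ (MvPolynomial τ ℂ) K
      (MvPolynomial.mkDerivation ℂ fun t => if s = t then (1 : K) else 0)
    refine ⟨D, fun t => ?_⟩
    rw [← MvPolynomial.aeval_X (R := ℂ) φ t, hev, hD, MvPolynomial.mkDerivation_X]

end

section

/-- Either the functions `φ t` are algebraically dependent on the common zeros of `eqs`, or there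
is a zero where they are independent and can be differentiated with respect to. -/
theorem dependent_or_exists_generic {σ τ ι : Type} [Finite σ] [DecidableEq τ]
    (eqs : ι → MvPolynomial σ ℂ) (φ : τ → MvPolynomial σ ℂ) :
    (∃ P : MvPolynomial τ ℂ, P ≠ 0 ∧ ∀ (K : Type) [Field K] [Algebra ℂ K] (v : σ → K),
      (∀ i, MvPolynomial.aeval v (eqs i) = 0) →
        MvPolynomial.aeval (fun t => MvPolynomial.aeval v (φ t)) P = 0) ∨
    ∃ (K : Type) (_ : Field K) (_ : Algebra ℂ K) (v : σ → K),
      (∀ i, MvPolynomial.aeval v (eqs i) = 0) ∧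
      (∀ P : MvPolynomial τ ℂ,
        MvPolynomial.aeval (fun t => MvPolynomial.aeval v (φ t)) P = 0 → P = 0) ∧
      ∀ s, ∃ D : Derivation ℂ K K,
        ∀ t, D (MvPolynomial.aeval v (φ t)) = if s = t then 1 else 0 := by
  have hcomp : ∀ (K : Type) [Field K] [Algebra ℂ K] (v : σ → K) (P : MvPolynomial τ ℂ),
      MvPolynomial.aeval v (MvPolynomial.aeval φ P) =
        MvPolynomial.aeval (fun t => MvPolynomial.aeval v (φ t)) P := fun K _ _ v P => by
    rw [← AlgHom.comp_apply, MvPolynomial.comp_aeval]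
  let J := Ideal.span (Set.range eqs)
  by_cases h : ∀ P : MvPolynomial τ ℂ, MvPolynomial.aeval φ P ∈ J → P = 0
  · right
    obtain ⟨K, _, _, ev, h1, h2, h3⟩ := exists_generic_zero J φ h
    have hev : ∀ p, ev p = MvPolynomial.aeval (fun i => ev (MvPolynomial.X i)) p := fun p => by
      conv_lhs => rw [MvPolynomial.aeval_unique ev]
      rfl
    refine ⟨K, inferInstance, inferInstance, fun i => ev (MvPolynomial.X i), fun i => ?_,
      fun P hP => ?_, fun s => ?_⟩
    · rw [← hev]
      exact h1 _ (Ideal.subset_span ⟨i, rfl⟩)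
    · refine h2 P ?_
      rw [hev, hcomp]
      exact hP
    · obtain ⟨D, hD⟩ := h3 s
      exact ⟨D, fun t => by rw [← hev]; exact hD t⟩
  · left
    push Not at h
    obtain ⟨P, hP, hP0⟩ := h
    refine ⟨P, hP0, fun K _ _ v hv => ?_⟩
    rw [← hcomp]
    have : J ≤ RingHom.ker (MvPolynomial.aeval v : MvPolynomial σ ℂ →ₐ[ℂ] K) := by
      rw [Ideal.span_le]
      rintro _ ⟨i, rfl⟩
      exact hv i
    exact this hP

lemma derivation_aeval {σ K : Type} [Fintype σ] [Field K] [Algebra ℂ K] (D : Derivation ℂ K K)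
    (v : σ → K) (p : MvPolynomial σ ℂ) :
    D (MvPolynomial.aeval v p) =
      ∑ i, MvPolynomial.aeval v (MvPolynomial.pderiv i p) * D (v i) := by
  classical
  induction p using MvPolynomial.induction_on with
  | C a => simp
  | add p q hp hq => simp [hp, hq, add_mul, Finset.sum_add_distrib]
  | mul_X p i hp =>
    simp only [map_mul, MvPolynomial.aeval_X, Derivation.leibniz, hp, smul_eq_mul, map_add,
      MvPolynomial.pderiv_X, add_mul, Finset.sum_add_distrib, Finset.mul_sum]
    congr 1
    · rw [Finset.sum_eq_single i]
      · simp
      · intro j _ hj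
        simp [hj.symm]
      · simp
    · exact Finset.sum_congr rfl fun j _ => by ring

lemma pderiv_pderiv_comm {σ : Type} (i j : σ) (p : MvPolynomial σ ℂ) :
    MvPolynomial.pderiv i (MvPolynomial.pderiv j p) =
      MvPolynomial.pderiv j (MvPolynomial.pderiv i p) := by
  classical
  have : ⁅MvPolynomial.pderiv (R := ℂ) i, MvPolynomial.pderiv (R := ℂ) j⁆ = 0 := by
    refine MvPolynomial.derivation_ext fun k => ?_
    rw [Derivation.commutator_apply]
    simp only [MvPolynomial.pderiv_X, Pi.single_apply]
    split_ifs <;> simp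
  have h := congrArg (fun D => D p) this
  simp only [Derivation.commutator_apply] at h
  exact sub_eq_zero.1 h

section Lagrange

variable {n r : ℕ} (G : Fin r → MvPolynomial (Fin n) ℂ) {K : Type} [Field K] [Algebra ℂ K]

/-- The data point for which `x` is critical with Lagrange multipliers `l`. -/
def lagr (x : Fin n → K) (l : Fin r → K) (k : Fin n) : K :=
  x k + ∑ j, l j * MvPolynomial.aeval x (MvPolynomial.pderiv k (G j))

/-- The Hessian of the Lagrange function applied to `w`. -/
def lagrHess (x : Fin n → K) (l : Fin r → K) (w : Fin n → K) (k : Fin n) : K :=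
  w k + ∑ j, l j * ∑ i, MvPolynomial.aeval x
    (MvPolynomial.pderiv k (MvPolynomial.pderiv i (G j))) * w i

lemma derivation_lagr (D : Derivation ℂ K K) (x : Fin n → K) (l : Fin r → K) (k : Fin n) :
    D (lagr G x l k) = lagrHess G x l (fun i => D (x i)) k +
      ∑ j, D (l j) * MvPolynomial.aeval x (MvPolynomial.pderiv k (G j)) := by
  have h : ∀ j, D (l j * MvPolynomial.aeval x (MvPolynomial.pderiv k (G j))) =
      l j * ∑ i, MvPolynomial.aeval x (MvPolynomial.pderiv k (MvPolynomial.pderiv i (G j))) *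
        D (x i) + D (l j) * MvPolynomial.aeval x (MvPolynomial.pderiv k (G j)) := fun j => by
    rw [Derivation.leibniz, derivation_aeval, smul_eq_mul, smul_eq_mul, mul_comm (D (l j))]
    simp only [pderiv_pderiv_comm k]
  unfold lagr lagrHess
  rw [map_add, map_sum, add_assoc, ← Finset.sum_add_distrib]
  simp only [h]

lemma derivation_eq_zero_of_zero (D : Derivation ℂ K K) (x : Fin n → K)
    (hx : ∀ j, MvPolynomial.aeval x (G j) = 0) (j : Fin r) :
    ∑ i, MvPolynomial.aeval x (MvPolynomial.pderiv i (G j)) * D (x i) = 0 := by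
  rw [← derivation_aeval, hx, map_zero]

lemma lagrHess_symm (x : Fin n → K) (l : Fin r → K) (w v : Fin n → K) :
    ∑ k, lagrHess G x l w k * v k = ∑ k, lagrHess G x l v k * w k := by
  simp only [lagrHess, add_mul, Finset.sum_add_distrib, Finset.mul_sum, Finset.sum_mul]
  congr 1
  · exact Finset.sum_congr rfl fun i _ => mul_comm _ _
  · rw [Finset.sum_comm]
    conv_rhs => rw [Finset.sum_comm]
    refine Finset.sum_congr rfl fun j _ => ?_
    rw [Finset.sum_comm]
    refine Finset.sum_congr rfl fun k _ => Finset.sum_congr rfl fun i _ => ?_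
    rw [pderiv_pderiv_comm]
    ring

lemma sum_multiplier_mul (x : Fin n → K) (a : Fin r → K) (w : Fin n → K)
    (hw : ∀ j, ∑ i, MvPolynomial.aeval x (MvPolynomial.pderiv i (G j)) * w i = 0) :
    ∑ k, (∑ j, a j * MvPolynomial.aeval x (MvPolynomial.pderiv k (G j))) * w k = 0 := by
  simp only [Finset.sum_mul]
  rw [Finset.sum_comm]
  refine Finset.sum_eq_zero fun j _ => ?_
  rw [← mul_zero (a j), ← hw j, Finset.mul_sum]
  exact Finset.sum_congr rfl fun i _ => by ring

/-- The conditions on a degenerate critical point `x` with multipliers `l` and null vector `w`. -/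
structure Degenerate (x : Fin n → K) (l : Fin r → K) (w : Fin n → K) (a : Fin r → K) : Prop where
  zero : ∀ j, MvPolynomial.aeval x (G j) = 0
  tangent : ∀ j, ∑ i, MvPolynomial.aeval x (MvPolynomial.pderiv i (G j)) * w i = 0
  null : ∀ k, lagrHess G x l w k =
    ∑ j, a j * MvPolynomial.aeval x (MvPolynomial.pderiv k (G j))

/-- Data points with degenerate critical points are not generic. -/
theorem exists_degenerate_relation (i : Fin n) :
    ∃ P : MvPolynomial (Fin n) ℂ, P ≠ 0 ∧ ∀ (K : Type) [Field K] [Algebra ℂ K] (x : Fin n → K)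
      (l : Fin r → K) (w : Fin n → K) (a : Fin r → K), Degenerate G x l w a → w i = 1 →
        MvPolynomial.aeval (lagr G x l) P = 0 := by
  classical
  let X : Fin n → MvPolynomial ((Fin n ⊕ Fin r) ⊕ (Fin n ⊕ Fin r)) ℂ :=
    fun k => MvPolynomial.X (.inl (.inl k))
  let L : Fin r → MvPolynomial ((Fin n ⊕ Fin r) ⊕ (Fin n ⊕ Fin r)) ℂ :=
    fun k => MvPolynomial.X (.inl (.inr k))
  let W : Fin n → MvPolynomial ((Fin n ⊕ Fin r) ⊕ (Fin n ⊕ Fin r)) ℂ :=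
    fun k => MvPolynomial.X (.inr (.inl k))
  let A : Fin r → MvPolynomial ((Fin n ⊕ Fin r) ⊕ (Fin n ⊕ Fin r)) ℂ :=
    fun k => MvPolynomial.X (.inr (.inr k))
  let eqs : Fin r ⊕ Fin r ⊕ Fin n ⊕ Unit → MvPolynomial ((Fin n ⊕ Fin r) ⊕ (Fin n ⊕ Fin r)) ℂ :=
    Sum.elim (fun j => MvPolynomial.aeval X (G j)) <| Sum.elim
      (fun j => ∑ i, MvPolynomial.aeval X (MvPolynomial.pderiv i (G j)) * W i) <| Sum.elim
      (fun k => W k + ∑ j, L j * ∑ i, MvPolynomial.aeval X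
          (MvPolynomial.pderiv k (MvPolynomial.pderiv i (G j))) * W i -
        ∑ j, A j * MvPolynomial.aeval X (MvPolynomial.pderiv k (G j))) fun _ => W i - 1
  let φ : Fin n → MvPolynomial ((Fin n ⊕ Fin r) ⊕ (Fin n ⊕ Fin r)) ℂ :=
    fun k => X k + ∑ j, L j * MvPolynomial.aeval X (MvPolynomial.pderiv k (G j))
  have hX : ∀ (K : Type) [Field K] [Algebra ℂ K] (v : (Fin n ⊕ Fin r) ⊕ (Fin n ⊕ Fin r) → K)
      (p : MvPolynomial (Fin n) ℂ), MvPolynomial.aeval v (MvPolynomial.aeval X p) =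
        MvPolynomial.aeval (fun k => v (.inl (.inl k))) p := fun K _ _ v p => by
    rw [← AlgHom.comp_apply, MvPolynomial.comp_aeval]
    simp [X]
  have hφ : ∀ (K : Type) [Field K] [Algebra ℂ K] (v : (Fin n ⊕ Fin r) ⊕ (Fin n ⊕ Fin r) → K),
      (fun k => MvPolynomial.aeval v (φ k)) =
        lagr G (fun k => v (.inl (.inl k))) (fun k => v (.inl (.inr k))) := fun K _ _ v => by
    funext k
    simp only [φ, lagr, map_add, map_sum, map_mul, hX]
    simp [X, L]
  have heqs : ∀ (K : Type) [Field K] [Algebra ℂ K] (v : (Fin n ⊕ Fin r) ⊕ (Fin n ⊕ Fin r) → K),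
      (∀ e, MvPolynomial.aeval v (eqs e) = 0) ↔ Degenerate G (fun k => v (.inl (.inl k)))
        (fun k => v (.inl (.inr k))) (fun k => v (.inr (.inl k))) (fun k => v (.inr (.inr k))) ∧
        v (.inr (.inl i)) = 1 := fun K _ _ v => by
    simp only [eqs, Sum.forall, Sum.elim_inl, Sum.elim_inr, map_sub, map_add, map_sum, map_mul, hX]
    simp only [W, L, A, MvPolynomial.aeval_X, map_one, sub_eq_zero, forall_const]
    exact ⟨fun ⟨h1, h2, h3, h4⟩ => ⟨⟨h1, h2, h3⟩, h4⟩,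
      fun ⟨h, h4⟩ => ⟨h.zero, h.tangent, h.null, h4⟩⟩
  rcases dependent_or_exists_generic eqs φ with ⟨P, hP, h⟩ | ⟨K, _, _, v, h0, -, hD⟩
  · refine ⟨P, hP, fun K _ _ x l w a hdeg hw => ?_⟩
    have := h K (Sum.elim (Sum.elim x l) (Sum.elim w a)) ((heqs _ _).2 ⟨hdeg, hw⟩)
    rw [hφ] at this
    exact this
  · exfalso
    obtain ⟨h, hw⟩ := (heqs _ _).1 h0
    obtain ⟨D, hD⟩ := hD i
    have h1 := fun k => (congrFun (hφ K v) k) ▸ hD k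
    simp only [derivation_lagr] at h1
    have h2 : ∑ k, (if i = k then (1 : K) else 0) * v (.inr (.inl k)) = 0 := by
      simp only [← h1, add_mul, Finset.sum_add_distrib]
      rw [sum_multiplier_mul G _ _ _ h.tangent, add_zero, lagrHess_symm]
      simp only [h.null]
      exact sum_multiplier_mul G _ _ _ (derivation_eq_zero_of_zero G D _ h.zero)
    simp [hw] at h2

end Lagrange

end

section

variable {n r : ℕ} (G : Fin r → MvPolynomial (Fin n) ℂ)

lemma lagr_dependent_or_exists_derivation (h : MvPolynomial (Fin n ⊕ Fin r) ℂ) :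
    (∃ Q : MvPolynomial (Option (Fin n)) ℂ, Q ≠ 0 ∧ ∀ (x : Fin n → ℂ) (l : Fin r → ℂ),
      (∀ j, MvPolynomial.aeval x (G j) = 0) → MvPolynomial.aeval (fun o : Option (Fin n) =>
        o.elim (MvPolynomial.aeval (Sum.elim x l) h) (lagr G x l)) Q = 0) ∨
    ∃ (K : Type) (_ : Field K) (_ : Algebra ℂ K) (x : Fin n → K) (l : Fin r → K),
      (∀ j, MvPolynomial.aeval x (G j) = 0) ∧
      (∀ P : MvPolynomial (Fin n) ℂ, MvPolynomial.aeval (lagr G x l) P = 0 → P = 0) ∧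
      ∃ D : Derivation ℂ K K, (∀ k, D (lagr G x l k) = 0) ∧
        D (MvPolynomial.aeval (Sum.elim x l) h) = 1 := by
  classical
  let X : Fin n → MvPolynomial (Fin n ⊕ Fin r) ℂ := fun k => MvPolynomial.X (.inl k)
  let φ : Fin n → MvPolynomial (Fin n ⊕ Fin r) ℂ := fun k =>
    X k + ∑ j, MvPolynomial.X (.inr j) * MvPolynomial.aeval X (MvPolynomial.pderiv k (G j))
  have hX : ∀ (K : Type) [Field K] [Algebra ℂ K] (v : Fin n ⊕ Fin r → K)
      (p : MvPolynomial (Fin n) ℂ), MvPolynomial.aeval v (MvPolynomial.aeval X p) =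
        MvPolynomial.aeval (fun k => v (.inl k)) p := fun K _ _ v p => by
    rw [← AlgHom.comp_apply, MvPolynomial.comp_aeval]
    simp [X]
  have hφ : ∀ (K : Type) [Field K] [Algebra ℂ K] (v : Fin n ⊕ Fin r → K),
      (fun o : Option (Fin n) => MvPolynomial.aeval v (o.elim h φ)) = fun o : Option (Fin n) =>
        o.elim (MvPolynomial.aeval v h) (lagr G (fun k => v (.inl k)) (fun k => v (.inr k))) :=
      fun K _ _ v => by
    funext o
    cases o with
    | none => rfl
    | some k =>
      simp only [φ, lagr, Option.elim_some, map_add, map_sum, map_mul, hX]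
      simp [X]
  rcases dependent_or_exists_generic (fun j => MvPolynomial.aeval X (G j))
    (fun o : Option (Fin n) => o.elim h φ) with ⟨Q, hQ, hd⟩ | ⟨K, _, _, v, h0, hind, hD⟩
  · refine .inl ⟨Q, hQ, fun x l hx => ?_⟩
    have := hd ℂ (Sum.elim x l) fun j => by rw [hX]; exact hx j
    rwa [hφ] at this
  · have hv : Sum.elim (fun k => v (.inl k)) (fun k => v (.inr k)) = v := by
      funext s; cases s <;> rfl
    refine .inr ⟨K, inferInstance, inferInstance, fun k => v (.inl k), fun k => v (.inr k),
      fun j => by rw [← hX]; exact h0 j, fun P hP => ?_, ?_⟩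
    · refine (MvPolynomial.rename_injective _ (Option.some_injective (Fin n)))
        ((hind (MvPolynomial.rename some P) ?_).trans (map_zero _).symm)
      rw [hφ, MvPolynomial.aeval_rename]
      exact hP
    · obtain ⟨D, hD⟩ := hD none
      refine ⟨D, fun k => ?_, ?_⟩
      · simpa using (congrArg D (congrFun (hφ K v) (some k))).symm.trans (hD (some k))
      · rw [hv]
        simpa using hD none

/-- The coordinates of critical points are algebraic functions of the data. -/
theorem exists_coordinate_relation (i : Fin n) :
    ∃ Q : MvPolynomial (Option (Fin n)) ℂ, Q ≠ 0 ∧ ∀ (x : Fin n → ℂ) (l : Fin r → ℂ),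
      (∀ j, MvPolynomial.aeval x (G j) = 0) →
        MvPolynomial.aeval (fun o : Option (Fin n) => o.elim (x i) (lagr G x l)) Q = 0 := by
  rcases lagr_dependent_or_exists_derivation G (MvPolynomial.X (.inl i)) with
    ⟨Q, hQ, h⟩ | ⟨K, _, _, x, l, hx, hind, D, hD, hi⟩
  · exact ⟨Q, hQ, fun x l hx => by simpa using h x l hx⟩
  · exfalso
    obtain ⟨P, hP, h⟩ := exists_degenerate_relation G i
    refine hP (hind P (h K x l (fun k => D (x k)) (fun j => -D (l j))
      ⟨hx, derivation_eq_zero_of_zero G D x hx, fun k => ?_⟩ (by simpa using hi)))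
    have := hD k
    rw [derivation_lagr] at this
    simp only [neg_mul, Finset.sum_neg_distrib]
    exact eq_neg_of_add_eq_zero_left this

/-- The critical values of the squared distance are algebraic functions of the data. -/
theorem exists_value_relation :
    ∃ Q : MvPolynomial (Option (Fin n)) ℂ, Q ≠ 0 ∧ ∀ (x : Fin n → ℂ) (l : Fin r → ℂ),
      (∀ j, MvPolynomial.aeval x (G j) = 0) →
        MvPolynomial.aeval (fun o : Option (Fin n) =>
          o.elim (∑ k, (x k - lagr G x l k) ^ 2) (lagr G x l)) Q = 0 := by
  have hh : ∀ (K : Type) [Field K] [Algebra ℂ K] (x : Fin n → K) (l : Fin r → K),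
      MvPolynomial.aeval (Sum.elim x l) (∑ k, (∑ j, MvPolynomial.X (.inr j) *
        MvPolynomial.rename Sum.inl (MvPolynomial.pderiv k (G j))) ^ 2) =
        ∑ k, (x k - lagr G x l k) ^ 2 := fun K _ _ x l => by
    simp [lagr, MvPolynomial.aeval_rename]
  rcases lagr_dependent_or_exists_derivation G (∑ k, (∑ j, MvPolynomial.X (.inr j) *
      MvPolynomial.rename Sum.inl (MvPolynomial.pderiv k (G j))) ^ 2) with
    ⟨Q, hQ, h⟩ | ⟨K, _, _, x, l, hx, -, D, hD, hi⟩
  · exact ⟨Q, hQ, fun x l hx => by simpa only [hh] using h x l hx⟩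
  · exfalso
    rw [hh, map_sum] at hi
    have h1 : ∀ k, D ((x k - lagr G x l k) ^ 2) = -2 * ((∑ j, l j * MvPolynomial.aeval x
        (MvPolynomial.pderiv k (G j))) * D (x k)) := fun k => by
      rw [Derivation.leibniz_pow, map_sub, hD, sub_zero]
      simp only [lagr, nsmul_eq_mul, smul_eq_mul]
      push_cast
      ring
    simp only [h1] at hi
    rw [← Finset.mul_sum,
      sum_multiplier_mul G x l _ (derivation_eq_zero_of_zero G D x hx), mul_zero] at hi
    exact zero_ne_one hi

end

section

section Generic

variable {n m d : ℕ} {Y : Set (Fin n → ℂ)}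

/-- The squared distance from `α`, shifted by `c`. -/
def distFn (α : Fin n → ℂ) (c : ℂ) : MvPolynomial (Fin n) ℂ :=
  ∑ k, (MvPolynomial.X k - MvPolynomial.C (α k)) ^ 2 + MvPolynomial.C c

lemma eval_distFn (α : Fin n → ℂ) (c : ℂ) (x : Fin n → ℂ) :
    MvPolynomial.eval x (distFn α c) = ∑ k, (x k - α k) ^ 2 + c := by
  simp [distFn]

lemma pderiv_distFn (α : Fin n → ℂ) (c : ℂ) (k : Fin n) :
    MvPolynomial.pderiv k (distFn α c) = 2 * (MvPolynomial.X k - MvPolynomial.C (α k)) := by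
  classical
  have h : ∀ i, MvPolynomial.pderiv k ((MvPolynomial.X i - MvPolynomial.C (α i)) ^ 2) =
      if i = k then 2 * (MvPolynomial.X k - MvPolynomial.C (α k)) else 0 := fun i => by
    rw [Derivation.leibniz_pow, map_sub, MvPolynomial.pderiv_C, sub_zero, MvPolynomial.pderiv_X]
    by_cases h : i = k
    · subst h; simp
    · simp [h]
  rw [distFn, map_add, map_sum, MvPolynomial.pderiv_C, add_zero, Finset.sum_congr rfl fun i _ => h i]
  simp

lemma pd_distFn (α : Fin n → ℂ) (c : ℂ) (x w : Fin n → ℂ) :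
    pd (distFn α c) x w = 2 * ∑ k, (x k - α k) * w k := by
  simp [pd_apply, pderiv_distFn, Finset.mul_sum, mul_assoc]

lemma mem_critSet_distFn {α : Fin n → ℂ} {c : ℂ} {x : Fin n → ℂ} :
    x ∈ critSet Y (distFn α c) ↔
      x ∈ Y ∧ ∀ w ∈ zTangent Y x, ∑ k, (x k - α k) * w k = 0 := by
  simp [critSet, pd_distFn]

lemma exists_generators (Y : Set (Fin n → ℂ)) :
    ∃ (r : ℕ) (G : Fin r → MvPolynomial (Fin n) ℂ),
      (∀ j, ∀ y ∈ Y, MvPolynomial.eval y (G j) = 0) ∧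
      ∀ x ∈ Y, ∀ w, (∀ j, pd (G j) x w = 0) → w ∈ zTangent Y x := by
  let I : Ideal (MvPolynomial (Fin n) ℂ) :=
    { carrier := {p | ∀ y ∈ Y, MvPolynomial.eval y p = 0}
      add_mem' := fun ha hb y hy => by rw [map_add, ha y hy, hb y hy, add_zero]
      zero_mem' := fun y _ => map_zero _
      smul_mem' := fun a p hp y hy => by rw [smul_eq_mul, map_mul, hp y hy, mul_zero] }
  obtain ⟨r, G, hG⟩ := Submodule.fg_iff_exists_fin_generating_family.1
    (IsNoetherian.noetherian I)
  have hGI : ∀ j, G j ∈ I := fun j => hG ▸ Submodule.subset_span ⟨j, rfl⟩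
  refine ⟨r, G, hGI, fun x hx w hw => mem_zTangent.2 fun p hp => ?_⟩
  have hp' : p ∈ Submodule.span (MvPolynomial (Fin n) ℂ) (Set.range G) := hG ▸ hp
  suffices h : ∀ q ∈ Submodule.span (MvPolynomial (Fin n) ℂ) (Set.range G),
      MvPolynomial.eval x q = 0 ∧ pd q x w = 0 from (h p hp').2
  intro q hq
  induction hq using Submodule.span_induction with
  | mem q hq =>
    obtain ⟨j, rfl⟩ := hq
    exact ⟨hGI j x hx, hw j⟩
  | zero => simp [pd_apply]
  | add q q' _ _ h h' =>
    refine ⟨by rw [map_add, h.1, h'.1, add_zero], ?_⟩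
    have := congrArg₂ (· + ·) h.2 h'.2
    simpa [pd_apply, add_mul, Finset.sum_add_distrib] using this
  | smul a q _ h =>
    refine ⟨by rw [smul_eq_mul, map_mul, h.1, mul_zero], ?_⟩
    have h2 := h.2
    rw [pd_apply] at h2 ⊢
    simp only [smul_eq_mul, Derivation.leibniz, map_add, map_mul, h.1, zero_mul, add_zero,
      mul_assoc]
    rw [← Finset.mul_sum, h2, mul_zero]

lemma exists_multiplier {r : ℕ} {G : Fin r → MvPolynomial (Fin n) ℂ} {x v : Fin n → ℂ}
    (h : ∀ w, (∀ j, pd (G j) x w = 0) → ∑ k, v k * w k = 0) :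
    ∃ a : Fin r → ℂ, ∀ k, v k = ∑ j, a j * MvPolynomial.aeval x (MvPolynomial.pderiv k (G j)) := by
  classical
  let V : (Fin n → ℂ) →ₗ[ℂ] ℂ := ∑ k, v k • LinearMap.proj k
  have hV : ∀ w, V w = ∑ k, v k * w k := fun w => by simp [V]
  have h1 : V ∈ Submodule.span ℂ (Set.range fun j => (pd (G j) x : (Fin n → ℂ) →ₗ[ℂ] ℂ)) := by
    refine mem_span_of_iInf_ker_le_ker fun w hw => ?_
    rw [LinearMap.mem_ker, hV]
    exact h w fun j => by simpa using (Submodule.mem_iInf _).1 hw j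
  obtain ⟨a, ha⟩ := (Submodule.mem_span_range_iff_exists_fun ℂ).1 h1
  refine ⟨a, fun k => ?_⟩
  have := LinearMap.congr_fun ha (Pi.single k 1)
  rw [hV] at this
  simpa [pd_apply, Pi.single_apply, MvPolynomial.aeval_eq_eval] using this.symm

lemma exists_lagr {r : ℕ} {G : Fin r → MvPolynomial (Fin n) ℂ} {c : ℂ}
    (hG : ∀ x ∈ Y, ∀ w, (∀ j, pd (G j) x w = 0) → w ∈ zTangent Y x) {x α : Fin n → ℂ}
    (hx : x ∈ critSet Y (distFn α c)) : ∃ l, lagr G x l = α := by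
  rw [mem_critSet_distFn] at hx
  obtain ⟨a, ha⟩ := exists_multiplier (v := fun k => x k - α k) fun w hw =>
    hx.2 w (hG x hx.1 w hw)
  refine ⟨-a, funext fun k => ?_⟩
  simp only [lagr, Pi.neg_apply, neg_mul, Finset.sum_neg_distrib, ← ha k]
  ring

/-- Roots of a polynomial with parameters are locally bounded where the leading coefficient does
not vanish. -/
lemma exists_root_bound (Q : MvPolynomial (Option (Fin n)) ℂ) (hQ : Q ≠ 0) :
    ∃ a : MvPolynomial (Fin n) ℂ, a ≠ 0 ∧ ∀ α, MvPolynomial.eval α a ≠ 0 →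
      {t : ℂ | MvPolynomial.eval (fun o : Option (Fin n) => o.elim t α) Q = 0}.Finite ∧
      ∃ R : ℝ, ∀ᶠ α' in 𝓝 α, ∀ t : ℂ,
        MvPolynomial.eval (fun o : Option (Fin n) => o.elim t α') Q = 0 → ‖t‖ ≤ R := by
  set P := MvPolynomial.optionEquivLeft ℂ (Fin n) Q with hP
  have hP0 : P ≠ 0 := by simpa [hP] using hQ
  refine ⟨P.leadingCoeff, Polynomial.leadingCoeff_ne_zero.2 hP0, fun α hα => ?_⟩
  have hroot : ∀ α' : Fin n → ℂ, MvPolynomial.eval α' P.leadingCoeff ≠ 0 → ∀ t,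
      MvPolynomial.eval (fun o : Option (Fin n) => o.elim t α') Q = 0 →
      (P.map (MvPolynomial.eval α')) ≠ 0 ∧ (P.map (MvPolynomial.eval α')).IsRoot t := by
    intro α' h t ht
    refine ⟨fun h0 => h ?_, ?_⟩
    · rw [← Polynomial.leadingCoeff_map_of_leadingCoeff_ne_zero _ h, h0]; simp
    · rw [Polynomial.IsRoot, hP, ← MvPolynomial.optionEquivLeft_elim_eval]; exact ht
  constructor
  · exact (Polynomial.finite_setOfPred_isRoot (p := P.map (MvPolynomial.eval α)) fun h0 => hα (by
      rw [← Polynomial.leadingCoeff_map_of_leadingCoeff_ne_zero _ hα, h0]; simp)).subset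
      fun t ht => (hroot α hα t ht).2
  let B : (Fin n → ℂ) → NNReal := fun α' => (Finset.range P.natDegree).sup
    (fun i => ‖MvPolynomial.eval α' (P.coeff i)‖₊) / ‖MvPolynomial.eval α' P.leadingCoeff‖₊ + 1
  have hBc : ContinuousAt B α := by
    refine (ContinuousAt.div₀ ?_ ?_ (by simpa using hα)).add continuousAt_const
    · exact (Continuous.finset_sup_apply fun i _ =>
        (MvPolynomial.continuous_eval _).nnnorm).continuousAt
    · exact (MvPolynomial.continuous_eval _).nnnorm.continuousAt
  refine ⟨B α + 1, ?_⟩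
  have e1 : ∀ᶠ α' in 𝓝 α, MvPolynomial.eval α' P.leadingCoeff ≠ 0 :=
    (MvPolynomial.continuous_eval _).continuousAt.eventually_ne hα
  have e2 : ∀ᶠ α' in 𝓝 α, B α' < B α + 1 :=
    hBc.eventually_lt continuousAt_const (lt_add_one _)
  filter_upwards [e1, e2] with α' h1 h2 t ht
  obtain ⟨h3, h4⟩ := hroot α' h1 t ht
  have h5 := h4.norm_lt_cauchyBound h3
  have h6 : (P.map (MvPolynomial.eval α')).cauchyBound = B α' := by
    rw [Polynomial.cauchyBound, Polynomial.leadingCoeff_map_of_leadingCoeff_ne_zero _ h1,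
      Polynomial.natDegree_map_of_leadingCoeff_ne_zero _ h1]
    simp only [Polynomial.coeff_map, B]
  rw [h6] at h5
  have h7 : (B α' : ℝ) < B α + 1 := by exact_mod_cast h2
  linarith

end Generic

end

section

open scoped ContDiff

section Generic

variable {n m d : ℕ}

lemma generic_critSet_bound (Y : Set (Fin n → ℂ)) :
    ∃ q : MvPolynomial (Fin n) ℂ, q ≠ 0 ∧ ∀ α, MvPolynomial.eval α q ≠ 0 → ∀ c,
      (critSet Y (distFn α c)).Finite ∧
      ∃ R : ℝ, ∀ᶠ α' in 𝓝 α, ∀ x ∈ critSet Y (distFn α' c), ‖x‖ ≤ R := by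
  obtain ⟨r, G, hG0, hG⟩ := exists_generators Y
  choose Q hQ0 hQ using exists_coordinate_relation G
  choose a ha0 ha using fun i => exists_root_bound (Q i) (hQ0 i)
  refine ⟨∏ i, a i, Finset.prod_ne_zero_iff.2 fun i _ => ha0 i, fun α hα c => ?_⟩
  rw [map_prod, Finset.prod_ne_zero_iff] at hα
  have hroot : ∀ α' x, x ∈ critSet Y (distFn α' c) → ∀ i,
      MvPolynomial.eval (fun o : Option (Fin n) => o.elim (x i) α') (Q i) = 0 := by
    intro α' x hx i
    obtain ⟨l, hl⟩ := exists_lagr hG hx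
    have := hQ i x l fun j => by
      rw [MvPolynomial.aeval_eq_eval]; exact hG0 j x hx.1
    rw [hl, MvPolynomial.aeval_eq_eval] at this
    exact this
  choose hfin R hR using fun i => ha i α (hα i (Finset.mem_univ i))
  refine ⟨(Set.Finite.pi hfin).subset fun x hx i _ => hroot α x hx i, ∑ i, |R i|, ?_⟩
  filter_upwards [eventually_all.2 hR] with α' h x hx
  refine (pi_norm_le_iff_of_nonneg (Finset.sum_nonneg fun i _ => abs_nonneg _)).2 fun i => ?_
  exact ((h i _ (hroot α' x hx i)).trans (le_abs_self _)).trans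
    (Finset.single_le_sum (f := fun i => |R i|) (fun i _ => abs_nonneg _) (Finset.mem_univ i))

lemma generic_critValue_ne_zero (Y : Set (Fin n → ℂ)) :
    ∃ q : MvPolynomial (Fin (n + 1)) ℂ, q ≠ 0 ∧ ∀ β, MvPolynomial.eval β q ≠ 0 →
      ∀ x ∈ critSet Y (distFn (fun k => β k.succ) (β 0)),
        MvPolynomial.eval x (distFn (fun k => β k.succ) (β 0)) ≠ 0 := by
  obtain ⟨r, G, hG0, hG⟩ := exists_generators Y
  obtain ⟨Q, hQ0, hQ⟩ := exists_value_relation G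
  have hev : ∀ β : Fin (n + 1) → ℂ, MvPolynomial.eval β (MvPolynomial.aeval
      (fun o : Option (Fin n) => o.elim (-MvPolynomial.X 0) (fun k => MvPolynomial.X k.succ)) Q) =
      MvPolynomial.eval (fun o : Option (Fin n) => o.elim (-β 0) (fun k => β k.succ)) Q := by
    intro β
    rw [← MvPolynomial.aeval_eq_eval β, ← MvPolynomial.aeval_eq_eval, ← AlgHom.comp_apply,
      MvPolynomial.comp_aeval]
    congr 2
    funext o
    cases o <;> simp
  refine ⟨MvPolynomial.aeval
    (fun o : Option (Fin n) => o.elim (-MvPolynomial.X 0) (fun k => MvPolynomial.X k.succ)) Q,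
    fun h0 => hQ0 (MvPolynomial.funext fun s => ?_), fun β hβ x hx hz => hβ ?_⟩
  · have := hev (Fin.cons (-s none) fun k => s (some k))
    rw [h0, map_zero] at this
    rw [map_zero, this]
    congr 2
    funext o
    cases o <;> simp
  · obtain ⟨l, hl⟩ := exists_lagr hG hx
    have := hQ x l fun j => by
      rw [MvPolynomial.aeval_eq_eval]; exact hG0 j x hx.1
    rw [hl, MvPolynomial.aeval_eq_eval] at this
    rw [eval_distFn] at hz
    rw [hev, ← eq_neg_of_add_eq_zero_left hz]
    exact this

lemma distFn_tame {Y : Set (Fin n → ℂ)} {α : Fin n → ℂ} {c : ℂ}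
    (h : ∃ R : ℝ, ∀ᶠ α' in 𝓝 α, ∀ x ∈ critSet Y (distFn α' c), ‖x‖ ≤ R) :
    ∃ R C : ℝ, ∀ x ∈ Y, R < ‖x‖ → ∃ w ∈ zTangent Y x, ‖w‖ ≤ C ∧ pd (distFn α c) x w = 1 := by
  obtain ⟨R, hR⟩ := h
  obtain ⟨δ, hδ, hball⟩ := Metric.nhds_basis_closedBall.mem_iff.1 hR
  refine ⟨R, δ⁻¹, fun x hx hxR => ?_⟩
  have hex : ∃ w ∈ zTangent Y x, δ * ‖w‖ < ‖pd (distFn α c) x w‖ := by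
    by_contra! hcon
    let g₀ : StrongDual ℂ (zTangent Y x) := (pd (distFn α c) x).comp (zTangent Y x).subtypeL
    have hg₀ : ‖g₀‖ ≤ δ := g₀.opNorm_le_bound hδ.le fun w => hcon w w.2
    obtain ⟨g, hg, hgn⟩ := exists_extension_norm_eq (zTangent Y x) g₀
    let α' : Fin n → ℂ := fun k => α k + g (Pi.single k 1) / 2
    have hα' : α' ∈ Metric.closedBall α δ := by
      rw [Metric.mem_closedBall, dist_eq_norm, pi_norm_le_iff_of_nonneg hδ.le]
      intro k
      have h1 : ‖g (Pi.single k 1)‖ ≤ δ := by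
        have h2 := g.le_opNorm (Pi.single k 1)
        rw [Pi.norm_single, norm_one, mul_one, hgn] at h2
        exact h2.trans hg₀
      simp only [Pi.sub_apply, α', add_sub_cancel_left, norm_div]
      have : ‖(2 : ℂ)‖ = 2 := by simp
      rw [this]
      linarith
    have hx' : x ∈ critSet Y (distFn α' c) := by
      refine mem_critSet_distFn.2 ⟨hx, fun w hw => ?_⟩
      have h1 : g w = pd (distFn α c) x w := hg ⟨w, hw⟩
      have h2 : g w = ∑ k, w k * g (Pi.single k 1) := by
        have e : ∀ k : Fin n, (Pi.single k 1 : Fin n → ℂ) = fun j => if k = j then 1 else 0 :=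
          fun k => funext fun j => by simp [Pi.single_apply, eq_comm]
        simpa [e] using (g : (Fin n → ℂ) →ₗ[ℂ] ℂ).pi_apply_eq_sum_univ w
      rw [pd_distFn] at h1
      have h3 : ∑ k, (x k - α' k) * w k =
          ∑ k, (x k - α k) * w k - (∑ k, w k * g (Pi.single k 1)) / 2 := by
        rw [Finset.sum_div, ← Finset.sum_sub_distrib]
        exact Finset.sum_congr rfl fun k _ => by simp only [α']; ring
      rw [h3, ← h2, h1]
      ring
    exact absurd (hball hα' x hx') (not_le.2 hxR)
  obtain ⟨w, hw, hlt⟩ := hex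
  have hpos : 0 < ‖pd (distFn α c) x w‖ := (by positivity : 0 ≤ δ * ‖w‖).trans_lt hlt
  refine ⟨(pd (distFn α c) x w)⁻¹ • w, Submodule.smul_mem _ _ hw, ?_, ?_⟩
  · rw [norm_smul, norm_inv, inv_mul_le_iff₀ hpos, ← div_eq_mul_inv, le_div_iff₀ hδ]
    linarith
  · rw [map_smul, smul_eq_mul, inv_mul_cancel₀ (norm_pos_iff.1 hpos)]

variable {Y : Set (Fin n → ℂ)} {p : Fin n → ℂ}

lemma Chart.L_fderiv (χ : Chart Y d p) {u : Fin d → ℂ} (hu : u ∈ χ.U) (a : Fin d → ℂ) :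
    χ.L (fderiv ℂ χ.ψ u a) = a := by
  have h1 : HasFDerivAt (fun u => χ.L (χ.ψ u - p)) (χ.L.comp (fderiv ℂ χ.ψ u)) u :=
    χ.L.hasFDerivAt.comp u ((χ.hasFDerivAt hu).sub_const p)
  have h2 : HasFDerivAt (fun u => χ.L (χ.ψ u - p)) (.id ℂ (Fin d → ℂ)) u :=
    (hasFDerivAt_id u).congr_of_eventuallyEq (by
      filter_upwards [χ.isOpen_U.mem_nhds hu] with v hv using χ.left v hv)
  exact congrArg (fun T => T a) (h1.unique h2)

/-- The Hessian of a polynomial with vanishing differential in a chart. -/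
lemma Chart.fderiv_fderiv_pull (χ : Chart Y d p) (F : MvPolynomial (Fin n) ℂ)
    (hF : ∀ i, MvPolynomial.eval p (MvPolynomial.pderiv i F) = 0) (a b : Fin d → ℂ) :
    fderiv ℂ (fderiv ℂ (χ.pull F)) 0 a b =
      ∑ i, pd (MvPolynomial.pderiv i F) p (fderiv ℂ χ.ψ 0 a) * fderiv ℂ χ.ψ 0 b i := by
  have hs : DifferentiableAt ℂ (fderiv ℂ (χ.pull F)) 0 :=
    ((χ.contDiffAt_pull F χ.zero_mem).fderiv_right (m := 1) (by simp)).differentiableAt one_ne_zero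
  have h1 : HasFDerivAt (fun u => fderiv ℂ (χ.pull F) u b)
      ((ContinuousLinearMap.apply ℂ ℂ b).comp (fderiv ℂ (fderiv ℂ (χ.pull F)) 0)) 0 :=
    (ContinuousLinearMap.apply ℂ ℂ b).hasFDerivAt.comp 0 hs.hasFDerivAt
  have hψ : DifferentiableAt ℂ (fderiv ℂ χ.ψ) 0 :=
    ((χ.contDiffAt χ.zero_mem).fderiv_right (m := 1) (by simp)).differentiableAt one_ne_zero
  have hψb : ∀ i, DifferentiableAt ℂ (fun u => fderiv ℂ χ.ψ u b i) 0 := fun i =>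
    ((ContinuousLinearMap.proj (R := ℂ) (φ := fun _ : Fin n => ℂ) i).comp
      (ContinuousLinearMap.apply ℂ (Fin n → ℂ) b)).differentiableAt.comp 0 hψ
  have h2 : ∀ i, HasFDerivAt (fun u => MvPolynomial.eval (χ.ψ u) (MvPolynomial.pderiv i F))
      ((pd (MvPolynomial.pderiv i F) p).comp (fderiv ℂ χ.ψ 0)) 0 := fun i => by
    have h3 := hasFDerivAt_eval (MvPolynomial.pderiv i F) (χ.ψ 0)
    have h4 := h3.comp 0 (χ.hasFDerivAt χ.zero_mem)
    rw [χ.map_zero] at h4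
    exact h4
  have h5 : HasFDerivAt (fun u => ∑ i, MvPolynomial.eval (χ.ψ u) (MvPolynomial.pderiv i F) *
      fderiv ℂ χ.ψ u b i) _ 0 :=
    HasFDerivAt.fun_sum fun i _ => (h2 i).mul (hψb i).hasFDerivAt
  have h6 : (fun u => fderiv ℂ (χ.pull F) u b) =ᶠ[𝓝 0] fun u =>
      ∑ i, MvPolynomial.eval (χ.ψ u) (MvPolynomial.pderiv i F) * fderiv ℂ χ.ψ u b i := by
    filter_upwards [χ.isOpen_U.mem_nhds χ.zero_mem] with u hu
    rw [χ.fderiv_pull F hu, ContinuousLinearMap.comp_apply, pd_apply]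
  have h7 := congrArg (fun T => T a) (h1.unique (h5.congr_of_eventuallyEq h6))
  simp only [ContinuousLinearMap.comp_apply, ContinuousLinearMap.apply_apply, sum_apply, add_apply,
    smul_apply, smul_eq_mul, χ.map_zero, hF, zero_mul, zero_add] at h7
  rw [h7]
  exact Finset.sum_congr rfl fun i _ => mul_comm _ _

lemma generic_nondeg (Y : Set (Fin n → ℂ)) :
    ∃ q : MvPolynomial (Fin n) ℂ, q ≠ 0 ∧ ∀ α, MvPolynomial.eval α q ≠ 0 → ∀ c,
      ∀ p ∈ critSet Y (distFn α c), ∀ χ : Chart Y d p, χ.Nondeg (distFn α c) := by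
  obtain ⟨r, G, hG0, hG⟩ := exists_generators Y
  choose P hP0 hP using exists_degenerate_relation G
  refine ⟨∏ i, P i, Finset.prod_ne_zero_iff.2 fun i _ => hP0 i, fun α hα c p hp χ a ha => ?_⟩
  rw [map_prod, Finset.prod_ne_zero_iff] at hα
  obtain ⟨l, hl⟩ := exists_lagr hG hp
  let F : MvPolynomial (Fin n) ℂ := distFn α c + ∑ j, MvPolynomial.C (2 * l j) * G j
  have hpd : ∀ i, MvPolynomial.pderiv i F = 2 * (MvPolynomial.X i - MvPolynomial.C (α i)) +
      ∑ j, MvPolynomial.C (2 * l j) * MvPolynomial.pderiv i (G j) := fun i => by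
    simp only [F, map_add, map_sum, pderiv_distFn, MvPolynomial.pderiv_C_mul]
  have hF : ∀ i, MvPolynomial.eval p (MvPolynomial.pderiv i F) = 0 := fun i => by
    rw [hpd, ← hl]
    simp only [lagr, MvPolynomial.aeval_eq_eval, map_add, map_mul, map_sub, map_sum,
      MvPolynomial.eval_X, MvPolynomial.eval_C, map_ofNat, mul_assoc]
    rw [← Finset.mul_sum]
    ring
  have hF2 : ∀ i w, pd (MvPolynomial.pderiv i F) p w = 2 * lagrHess G p l w i := fun i w => by
    have h1 : ∀ k, MvPolynomial.eval p (MvPolynomial.pderiv k (MvPolynomial.pderiv i F)) =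
        2 * (if k = i then 1 else 0) + ∑ j, 2 * l j *
          MvPolynomial.eval p (MvPolynomial.pderiv i (MvPolynomial.pderiv k (G j))) := fun k => by
      have h2 : (2 : MvPolynomial (Fin n) ℂ) = MvPolynomial.C 2 := rfl
      rw [hpd, map_add, map_sum, h2, MvPolynomial.pderiv_C_mul, map_sub, MvPolynomial.pderiv_C,
        MvPolynomial.pderiv_X]
      simp only [MvPolynomial.pderiv_C_mul, pderiv_pderiv_comm k]
      simp [Pi.single_apply, apply_ite, eq_comm]
    rw [pd_apply]
    simp only [h1, lagrHess, MvPolynomial.aeval_eq_eval, add_mul, Finset.sum_add_distrib, mul_add,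
      Finset.sum_mul, Finset.mul_sum]
    rw [Finset.sum_comm]
    congr 1
    · simp
    · refine Finset.sum_congr rfl fun j _ => Finset.sum_congr rfl fun k _ => by
        rw [pderiv_pderiv_comm]; ring
  have hpull : χ.pull (distFn α c) =ᶠ[𝓝 0] χ.pull F := by
    filter_upwards [χ.isOpen_U.mem_nhds χ.zero_mem] with u hu
    simp [Chart.pull, F, hG0 _ _ (χ.mem u hu).1]
  have hess : ∀ b, ∑ i, lagrHess G p l (fderiv ℂ χ.ψ 0 a) i * fderiv ℂ χ.ψ 0 b i = 0 := by
    intro b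
    have h1 := ha b
    rw [hpull.fderiv.fderiv_eq, χ.fderiv_fderiv_pull F hF] at h1
    simp only [hF2, mul_assoc] at h1
    rw [← Finset.mul_sum] at h1
    exact (mul_eq_zero.1 h1).resolve_left two_ne_zero
  set w := fderiv ℂ χ.ψ 0 a with hw
  have hwT : w ∈ zTangent Y p := by
    have := χ.tan 0 χ.zero_mem a
    rwa [χ.map_zero] at this
  obtain ⟨μ, hμ⟩ := exists_multiplier (G := G) (x := p) (v := lagrHess G p l w) fun v hv => by
    have h1 := hG p hp.1 v hv
    rw [← χ.map_zero] at h1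
    rw [← χ.tan' 0 χ.zero_mem v h1]
    exact hess _
  by_contra ha0
  have hw0 : w ≠ 0 := fun h => ha0 (by rw [← χ.L_fderiv χ.zero_mem a, ← hw, h, map_zero])
  obtain ⟨i, hi⟩ := Function.ne_iff.1 hw0
  refine hα i (Finset.mem_univ i) ?_
  have := hP i ℂ p l ((w i)⁻¹ • w) ((w i)⁻¹ • μ) ⟨fun j => ?_, fun j => ?_, fun k => ?_⟩
    (by simpa using inv_mul_cancel₀ hi)
  · rwa [hl, MvPolynomial.aeval_eq_eval] at this
  · rw [MvPolynomial.aeval_eq_eval]; exact hG0 j p hp.1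
  · have h1 := mem_zTangent.1 (Submodule.smul_mem _ (w i)⁻¹ hwT) (G j) (hG0 j)
    rw [pd_apply] at h1
    simpa only [MvPolynomial.aeval_eq_eval] using h1
  · have h1 : lagrHess G p l ((w i)⁻¹ • w) k = (w i)⁻¹ * lagrHess G p l w k := by
      simp only [lagrHess, Pi.smul_apply, smul_eq_mul, mul_add, Finset.mul_sum]
      congr 1
      exact Finset.sum_congr rfl fun j _ => Finset.sum_congr rfl fun i _ => by ring
    rw [h1, hμ k, Finset.mul_sum]
    exact Finset.sum_congr rfl fun j _ => by simp only [Pi.smul_apply, smul_eq_mul]; ring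

/-- A general shifted squared distance function is good. -/
theorem generically_goodFn (hY : Sm Y m) (hd : d + m = n) :
    Generically (K := ℂ) (σ := Fin (n + 1)) fun β =>
      GoodFn Y d (distFn (fun k => β k.succ) (β 0)) := by
  obtain ⟨q₁, hq₁, h₁⟩ := generic_critSet_bound Y
  obtain ⟨q₂, hq₂, h₂⟩ := generic_nondeg (d := d) Y
  obtain ⟨q₃, hq₃, h₃⟩ := generic_critValue_ne_zero Y
  have hinj := MvPolynomial.rename_injective (R := ℂ) _ (Fin.succ_injective n)
  refine ⟨MvPolynomial.rename Fin.succ q₁ * MvPolynomial.rename Fin.succ q₂ * q₃,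
    mul_ne_zero (mul_ne_zero ?_ ?_) hq₃, fun β hβ => ?_⟩
  · exact fun h => hq₁ (hinj (h.trans (map_zero _).symm))
  · exact fun h => hq₂ (hinj (h.trans (map_zero _).symm))
  rw [map_mul, map_mul, MvPolynomial.eval_rename, MvPolynomial.eval_rename] at hβ
  have hβ₁ := left_ne_zero_of_mul (left_ne_zero_of_mul hβ)
  have hβ₂ := right_ne_zero_of_mul (left_ne_zero_of_mul hβ)
  have hβ₃ := right_ne_zero_of_mul hβ
  obtain ⟨hfin, hbd⟩ := h₁ _ hβ₁ (β 0)
  refine ⟨hfin, h₃ β hβ₃, fun p hp => ?_, distFn_tame hbd⟩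
  obtain ⟨χ⟩ := hY.nonempty_chart hd hp.1
  exact ⟨χ, h₂ _ hβ₂ _ p hp χ⟩

end Generic

end

section

section SmoothSets

/-- A map which is complex differentiable near a point is strictly differentiable there. -/
lemma hasStrictFDerivAt_of_eventually_differentiableAt {E F : Type} [NormedAddCommGroup E]
    [NormedSpace ℂ E] [NormedAddCommGroup F] [NormedSpace ℂ F] {ψ : E → F} {x : E}
    (h : ∀ᶠ u in 𝓝 x, DifferentiableAt ℂ ψ u) : HasStrictFDerivAt ψ (fderiv ℂ ψ x) x := by
  refine hasStrictFDerivAt_of_hasFDerivAt_of_continuousAt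
    (h.mono fun u hu => hu.hasFDerivAt) (Metric.continuousAt_iff'.2 fun ε hε => ?_)
  set T := fderiv ℂ ψ x with hT
  have h1 : ∀ᶠ u in 𝓝 x, ‖ψ u - ψ x - T (u - x)‖ ≤ ε / 4 * ‖u - x‖ :=
    (hasFDerivAt_iff_isLittleO.1 h.self_of_nhds.hasFDerivAt).def (by positivity)
  obtain ⟨r, hr, hball⟩ := Metric.nhds_basis_ball.mem_iff.1 (h.and h1)
  filter_upwards [Metric.ball_mem_nhds x (show 0 < r / 4 by positivity)] with u hu
  rw [Metric.mem_ball, dist_eq_norm] at hu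
  rw [dist_eq_norm]
  refine lt_of_le_of_lt (ContinuousLinearMap.opNorm_le_of_unit_norm (C := ε / 2) (by positivity)
    fun b hb => ?_) (by linarith)
  have hmem : ∀ z : ℂ, ‖z‖ ≤ r / 4 → ‖u + z • b - x‖ < r / 2 := fun z hz => by
    have : u + z • b - x = (u - x) + z • b := by abel
    rw [this]
    refine (norm_add_le _ _).trans_lt ?_
    rw [norm_smul, hb, mul_one]
    linarith
  have hin : ∀ z : ℂ, ‖z‖ ≤ r / 4 → u + z • b ∈ Metric.ball x r := fun z hz => by
    rw [Metric.mem_ball, dist_eq_norm]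
    linarith [hmem z hz]
  let φ : ℂ → F := fun z => ψ (u + z • b) - ψ x - T (u + z • b - x)
  have hline : ∀ z : ℂ, HasDerivAt (fun z : ℂ => u + z • b) b z := fun z => by
    simpa using ((hasDerivAt_id z).smul_const b).const_add u
  have hφ : ∀ z : ℂ, ‖z‖ ≤ r / 4 → HasDerivAt φ (fderiv ℂ ψ (u + z • b) b - T b) z := fun z hz =>
    (((hball (hin z hz)).1.hasFDerivAt.comp_hasDerivAt z (hline z)).sub_const _).sub
      (T.hasFDerivAt.comp_hasDerivAt z ((hline z).sub_const x))
  have h2 : ‖deriv φ 0‖ ≤ (ε / 4 * (r / 2)) / (r / 4) := by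
    refine Complex.norm_deriv_le_of_forall_mem_sphere_norm_le (by positivity) ?_ fun z hz => ?_
    · refine DifferentiableOn.diffContOnCl fun z hz => ?_
      rw [closure_ball _ (by positivity), mem_closedBall_zero_iff] at hz
      exact (hφ z hz).differentiableAt.differentiableWithinAt
    · rw [mem_sphere_zero_iff_norm] at hz
      refine (hball (hin z hz.le)).2.trans ?_
      have := (hmem z hz.le).le
      gcongr
  rw [(hφ 0 (by simp; positivity)).deriv] at h2
  have h3 : (ε / 4 * (r / 2)) / (r / 4) = ε / 2 := by field_simp
  rw [h3] at h2
  simpa using h2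

variable {n d : ℕ} {X : Set (Fin n → ℂ)}

lemma exists_independent_generators {p : Fin n → ℂ} (hp : p ∈ X)
    (hd : Module.finrank ℂ (zTangent X p) = d) :
    ∃ (m : ℕ) (G : Fin m → MvPolynomial (Fin n) ℂ), d + m = n ∧
      (∀ j, ∀ y ∈ X, MvPolynomial.eval y (G j) = 0) ∧
      LinearIndependent ℂ (fun j => pd (G j) p) := by
  obtain ⟨r, G', hG0, hG⟩ := exists_generators X
  obtain ⟨f, hf, hspan, hLI⟩ := Submodule.exists_fun_fin_finrank_span_eq ℂ
    (Set.range fun j => pd (G' j) p)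
  choose σ hσ using hf
  refine ⟨_, fun j => G' (σ j), ?_, fun j => hG0 _, by simpa only [hσ] using hLI⟩
  have hker : LinearMap.ker (ContinuousLinearMap.pi f).toLinearMap =
      zTangent X p := by
    ext w
    constructor
    · intro hw
      have hw' : ∀ g ∈ Submodule.span ℂ (Set.range f), g w = 0 := fun g hg => by
        induction hg using Submodule.span_induction with
        | mem g hg => obtain ⟨j, rfl⟩ := hg; exact congrFun hw j
        | zero => rfl
        | add g g' _ _ h h' => rw [add_apply, h, h', add_zero]
        | smul a g _ h => rw [smul_apply, h, smul_zero]
      exact hG p hp w fun j => hw' _ (by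
        rw [hspan]; exact Submodule.subset_span ⟨j, rfl⟩)
    · intro hw
      refine funext fun j => ?_
      change f j w = 0
      rw [← hσ j]
      exact mem_zTangent.1 hw _ (hG0 _)
  have h1 := LinearMap.finrank_range_add_finrank_ker
    (ContinuousLinearMap.pi f).toLinearMap
  rw [hker, hd, LinearMap.range_eq_top.2 (surjective_pi_of_linearIndependent hLI), finrank_top,
    Module.finrank_fin_fun, Module.finrank_fin_fun] at h1
  omega

lemma eventually_mem_of_isSmoothGermAt {m : ℕ} {p : Fin n → ℂ}
    (hs : IsSmoothGermAt X p d) (hd : d + m = n) {G : Fin m → MvPolynomial (Fin n) ℂ}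
    (hG : ∀ j, ∀ y ∈ X, MvPolynomial.eval y (G j) = 0)
    (hLI : LinearIndependent ℂ (fun j => pd (G j) p)) :
    ∀ᶠ y in 𝓝 p, (∀ j, MvPolynomial.eval y (G j) = 0) → y ∈ X := by
  obtain ⟨ψ, U, hU, h0, hψ0, hψd, -, hinj, V, hV, himg⟩ := hs
  obtain ⟨L, A, hA⟩ := exists_complement_coordinates (d := d) _
    (surjective_pi_of_linearIndependent hLI) (by rw [Module.finrank_fin_fun, hd])
  have hψX : ∀ u ∈ U, ψ u ∈ X := fun u hu => (himg.subset ⟨u, hu, rfl⟩).1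
  have hψs : HasStrictFDerivAt ψ (fderiv ℂ ψ 0) 0 :=
    hasStrictFDerivAt_of_eventually_differentiableAt (by
      filter_upwards [hU.mem_nhds h0] with u hu
      exact (hψd u hu).differentiableAt (hU.mem_nhds hu))
  have htan : ∀ a j, pd (G j) p (fderiv ℂ ψ 0 a) = 0 := fun a j => by
    have h1 : HasFDerivAt (fun u => MvPolynomial.eval (ψ u) (G j))
        ((pd (G j) (ψ 0)).comp (fderiv ℂ ψ 0)) 0 :=
      (hasFDerivAt_eval (G j) (ψ 0)).comp 0 hψs.hasFDerivAt
    have h2 : HasFDerivAt (fun u => MvPolynomial.eval (ψ u) (G j)) (0 : _ →L[ℂ] ℂ) 0 :=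
      (hasFDerivAt_const (0 : ℂ) _).congr_of_eventuallyEq (by
        filter_upwards [hU.mem_nhds h0] with u hu using hG j _ (hψX u hu))
    have h3 := congrArg (fun T => T a) (h1.unique h2)
    rwa [hψ0] at h3
  let h : (Fin d → ℂ) → (Fin d → ℂ) := fun u => L (ψ u - p)
  have hh0 : h 0 = 0 := by simp [h, hψ0]
  have hhd : HasStrictFDerivAt h (L.comp (fderiv ℂ ψ 0)) 0 :=
    L.hasStrictFDerivAt.comp 0 (hψs.sub_const p)
  have hLinj : Function.Injective (L.comp (fderiv ℂ ψ 0) : (Fin d → ℂ) →ₗ[ℂ] (Fin d → ℂ)) := by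
    refine (injective_iff_map_eq_zero _).2 fun a ha => ?_
    refine (injective_iff_map_eq_zero (fderiv ℂ ψ 0)).1 hinj a (A.injective ?_)
    rw [map_zero]
    change (A : (Fin n → ℂ) →L[ℂ] (Fin d → ℂ) × (Fin m → ℂ)) (fderiv ℂ ψ 0 a) = 0
    rw [hA]
    exact Prod.ext ha (funext fun j => htan a j)
  let B : (Fin d → ℂ) ≃L[ℂ] (Fin d → ℂ) :=
    (LinearEquiv.ofInjectiveEndo _ hLinj).toContinuousLinearEquiv
  have hB : (B : (Fin d → ℂ) →L[ℂ] (Fin d → ℂ)) = L.comp (fderiv ℂ ψ 0) := by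
    ext1; rfl
  have hmap : map h (𝓝 0) = 𝓝 0 := by
    have := HasStrictFDerivAt.map_nhds_eq_of_equiv (f := h) (f' := B) (a := 0) (by rwa [hB])
    rwa [hh0] at this
  let Φ : (Fin n → ℂ) → (Fin d → ℂ) × (Fin m → ℂ) := fun x =>
    (L (x - p), fun j => MvPolynomial.eval x (G j))
  have hΦ : HasStrictFDerivAt Φ (A : (Fin n → ℂ) →L[ℂ] (Fin d → ℂ) × (Fin m → ℂ)) p := by
    rw [hA]
    refine HasStrictFDerivAt.prodMk ?_ (hasStrictFDerivAt_pi.2 fun j => ?_)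
    · exact L.hasStrictFDerivAt.comp p ((hasStrictFDerivAt_id p).sub_const p)
    · have := (contDiff_eval (N := 1) (G j)).contDiffAt (x := p)
      rw [← fderiv_eval]
      exact this.hasStrictFDerivAt one_ne_zero
  let H := hΦ.toOpenPartialHomeomorph Φ
  have hHp : H.source ∈ 𝓝 p :=
    H.open_source.mem_nhds hΦ.mem_toOpenPartialHomeomorph_source
  have hW : U ∩ ψ ⁻¹' H.source ∈ 𝓝 (0 : Fin d → ℂ) :=
    inter_mem (hU.mem_nhds h0) (hψs.continuousAt (by rwa [hψ0]))
  have hhW : h '' (U ∩ ψ ⁻¹' H.source) ∈ 𝓝 (0 : Fin d → ℂ) := hmap ▸ image_mem_map hW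
  have hLc : Tendsto (fun y => L (y - p)) (𝓝 p) (𝓝 0) := by
    have : Continuous fun y => L (y - p) := L.continuous.comp (continuous_id.sub continuous_const)
    simpa using this.tendsto p
  filter_upwards [hHp, hLc hhW] with y hy hy' hGy
  obtain ⟨u, ⟨huU, huH⟩, hu⟩ := hy'
  have : y = ψ u := H.injOn hy huH (Prod.ext hu.symm (funext fun j =>
    (hGy j).trans (hG j _ (hψX u huU)).symm))
  exact this ▸ hψX u huU

/-- Smooth closed subvarieties are locally regular zero loci. -/
theorem IsSmoothClosedOfDim.sm (hX : IsSmoothClosedOfDim X d) : ∃ m, d + m = n ∧ Sm X m := by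
  obtain ⟨halg, ⟨x₀, hx₀⟩, h⟩ := hX
  obtain ⟨m, -, hm, -⟩ := exists_independent_generators hx₀ (h x₀ hx₀).2
  refine ⟨m, hm, halg, fun p hp => ?_⟩
  obtain ⟨m', G, hm', hG, hLI⟩ := exists_independent_generators hp (h p hp).2
  obtain rfl : m' = m := by omega
  exact ⟨G, hG, hLI, _, eventually_mem_of_isSmoothGermAt (h p hp).1 hm hG hLI, fun y hy => hy⟩

end SmoothSets

end

section

section EulerCharacteristic

variable {n m d : ℕ} {Y : Set (Fin n → ℂ)} {f : MvPolynomial (Fin n) ℂ}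

lemma Generically.exists {σ : Type} {P : (σ → ℂ) → Prop} (h : Generically P) : ∃ a, P a := by
  obtain ⟨q, hq, h⟩ := h
  by_contra! hcon
  refine hq (MvPolynomial.funext fun a => ?_)
  rw [map_zero]
  by_contra ha
  exact hcon a (h a ha)

lemma Sm.zeroLocus (hY : Sm Y m) (hf : ∀ p ∈ critSet Y f, MvPolynomial.eval p f ≠ 0) :
    Sm (Y ∩ {y | MvPolynomial.eval y f = 0}) (m + 1) := by
  obtain ⟨⟨S, hS⟩, h⟩ := hY
  refine ⟨⟨insert f S, ?_⟩, fun p hp => ?_⟩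
  · ext y
    rw [hS]
    simp [and_comm]
  obtain ⟨G, hG, hLI, O, hO, hOY⟩ := h p hp.1
  refine ⟨Fin.cons f G, ?_, ?_, O, hO, fun y hy hGy => ?_⟩
  · exact Fin.cases (fun y hy => hy.2) fun j y hy => hG j y hy.1
  · have h1 : (fun j => pd ((Fin.cons f G : Fin (m + 1) → MvPolynomial (Fin n) ℂ) j) p) =
        Fin.cons (pd f p) fun j => pd (G j) p :=
      funext (Fin.cases rfl fun j => rfl)
    rw [h1, linearIndependent_finCons]
    refine ⟨hLI, fun hmem => hf p ⟨hp.1, fun w hw => ?_⟩ hp.2⟩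
    obtain ⟨a, ha⟩ := (Submodule.mem_span_range_iff_exists_fun ℂ).1 hmem
    rw [← ha, sum_apply]
    refine Finset.sum_eq_zero fun j _ => ?_
    rw [smul_apply, mem_zTangent.1 hw _ (hG j), smul_zero]
  · exact ⟨hOY y hy fun j => hGy j.succ, hGy 0⟩

lemma Sm.zTangent_eq_zero (hY : Sm Y n) {p w : Fin n → ℂ} (hp : p ∈ Y) (hw : w ∈ zTangent Y p) :
    w = 0 := by
  obtain ⟨χ⟩ := hY.nonempty_chart (zero_add n) hp
  rw [← χ.map_zero] at hw
  rw [← χ.tan' 0 χ.zero_mem w hw, Subsingleton.elim (χ.L w) 0, map_zero]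

lemma GoodFn.isEmpty_zeroLocus (hY : Sm Y n) (hf : GoodFn Y d f) :
    IsEmpty ↥(Y ∩ {y | MvPolynomial.eval y f = 0}) :=
  ⟨fun y => hf.ne y ⟨y.2.1, fun w hw => by
    rw [hY.zTangent_eq_zero y.2.1 hw, map_zero]⟩ y.2.2⟩

theorem Sm.exists_hasEulerChar_zeroLocus : ∀ {d m : ℕ} {Y : Set (Fin n → ℂ)}
    {f : MvPolynomial (Fin n) ℂ}, Sm Y m → d + m = n → GoodFn Y d f →
    ∃ c, HasEulerChar ↥(Y ∩ {y | MvPolynomial.eval y f = 0}) c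
  | 0, m, Y, f, hY, hd, hf => by
    obtain rfl : m = n := by omega
    have := hf.isEmpty_zeroLocus hY
    exact ⟨_, hasEulerChar_empty⟩
  | d + 1, m, Y, f, hY, hd, hf => by
    have hF := hY.zeroLocus hf.ne
    have hd' : d + (m + 1) = n := by omega
    obtain ⟨β, hβ⟩ := (generically_goodFn hF hd').exists
    obtain ⟨c, hc⟩ := hF.exists_hasEulerChar_zeroLocus hd' hβ
    exact ⟨_, (hβ.hasEulerChar hF hd' hc).1⟩

theorem GoodFn.hasEulerChar_compl (hY : Sm Y m) (hd : d + m = n) (hf : GoodFn Y d f) :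
    HasEulerChar ↥(Y ∩ {y | MvPolynomial.eval y f ≠ 0}) ((-1) ^ d * (critSet Y f).ncard) := by
  obtain ⟨c, hc⟩ := hY.exists_hasEulerChar_zeroLocus hd hf
  exact (hf.hasEulerChar hY hd hc).2

end EulerCharacteristic

end

/-- **Theorem 1.2 / Theorem 3.4.** For a smooth closed subvariety `X ⊆ ℂⁿ` (of pure
dimension `d`) and a general `β ∈ ℂⁿ⁺¹`:
`EDdeg(X) = (-1)^{dim X} · χ(X ∩ U_β)`. -/
theorem ed_degree_eq_euler_char_smooth {n d : ℕ} (X : Set (Fin n → ℂ))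
    (hX : IsSmoothClosedOfDim X d) (k : ℕ) (hED : HasEDDeg X d k) :
    Generically (K := ℂ) (σ := Fin (n + 1)) fun β =>
      ∃ e : ℤ, HasEulerChar ↥(X ∩ quadCompl β) e ∧ (k : ℤ) = (-1) ^ d * e := by
  obtain ⟨m, hd, hY⟩ := hX.sm
  obtain ⟨q₁, hq₁, h₁⟩ := generically_goodFn hY hd
  obtain ⟨q₂, hq₂, h₂⟩ := hED
  have hinj := MvPolynomial.rename_injective (R := ℂ) _ (Fin.succ_injective n)
  refine ⟨q₁ * MvPolynomial.rename Fin.succ q₂,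
    mul_ne_zero hq₁ fun h => hq₂ (hinj (h.trans (map_zero _).symm)), fun β hβ => ?_⟩
  rw [map_mul, MvPolynomial.eval_rename] at hβ
  have hcrit : critSet X (distFn (fun k => β k.succ) (β 0)) =
      edCritSet X d (fun k => β k.succ) := by
    ext x
    rw [mem_critSet_distFn]
    exact ⟨fun hx => ⟨hx.1, (hX.2.2 x hx.1).2, hx.2⟩, fun hx => ⟨hx.1, hx.2.2⟩⟩
  have hset : X ∩ quadCompl β =
      X ∩ {y | MvPolynomial.eval y (distFn (fun k => β k.succ) (β 0)) ≠ 0} := by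
    ext x
    simp [quadCompl, eval_distFn]
  have h := (h₁ β (left_ne_zero_of_mul hβ)).hasEulerChar_compl hY hd
  have hcard : (edCritSet X d fun k => β k.succ).ncard = k := (h₂ _ (right_ne_zero_of_mul hβ)).2
  rw [hcrit, hcard, ← hset] at h
  exact ⟨_, h, by rw [← mul_assoc, ← mul_pow]; simp⟩

end PaperED
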